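/- Let U ∈ 𝒰 be such that η_U is differentiable for large x with x·η_U'(x)/η_U(x) → 0 as x → ∞, and let ω_U be an increasing function with ω_U(x) → ∞ satisfying η_U(x/ω_U(x)) = ω_U(x) for all sufficiently large x. Let T = C_{φ_U}. Then for every ε > 0 there is N such that for all n ≥ N: exp(−(π²/2 + ε)·n/ω_U(n)) ≤ a_n(T) ≤ exp(−(π²/2 − ε)·n/ω_U(n)). -/

import Mathlib

open Complex MeasureTheory Filter Set

noncomputable section

abbrev H2 : Type := lp (fun _ : ℕ => ℂ) 2

noncomputable def fa (a : H2) (z : ℂ) : ℂ := ∑' k : ℕ, a k * z ^ k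

noncomputable def approxNum (T : H2 →L[ℂ] H2) (n : ℕ) : ℝ :=
  sInf {c : ℝ | ∃ R : H2 →L[ℂ] H2,
    FiniteDimensional ℂ (LinearMap.range R.toLinearMap) ∧
    Module.finrank ℂ (LinearMap.range R.toLinearMap) ≤ n - 1 ∧ c = ‖T - R‖}

noncomputable def hU (U : ℝ → ℝ) (t : ℝ) : ℝ := ∫ x in t..Real.pi, U x / x ^ 2

def ClassU (U : ℝ → ℝ) : Prop :=
  Continuous U ∧ (∀ t, U (-t) = U t) ∧ Function.Periodic U (2 * Real.pi) ∧
  U 0 = 0 ∧ MonotoneOn U (Set.Icc 0 Real.pi) ∧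
  (∀ t, 0 < t → t ≤ Real.pi → 0 < U t) ∧
  Tendsto (fun t => hU U t) (nhdsWithin 0 (Set.Ioi 0)) atTop

/-- `η_U(x) = -log U(e^{-x})`. -/
noncomputable def etaU (U : ℝ → ℝ) (x : ℝ) : ℝ := -Real.log (U (Real.exp (-x)))

noncomputable def poisson (U : ℝ → ℝ) (r θ : ℝ) : ℝ :=
  ((1 - r ^ 2) / (2 * Real.pi)) *
    ∫ x in (-Real.pi)..Real.pi, U x / (1 - 2 * r * Real.cos (θ - x) + r ^ 2)

namespace QS

lemma H2.summable_sq (a : H2) : Summable (fun k => ‖a k‖ ^ 2) := by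
  have := lp.memℓp a
  rw [memℓp_gen_iff (by norm_num)] at this
  simpa using this

lemma H2.norm_sq (a : H2) : ‖a‖ ^ 2 = ∑' k, ‖a k‖ ^ 2 := by
  have := lp.norm_rpow_eq_tsum (p := 2) (by norm_num) a
  simpa using this

lemma memH2_of {c : ℕ → ℂ} (h : Summable (fun k => ‖c k‖ ^ 2)) : Memℓp c 2 := by
  rw [memℓp_gen_iff (by norm_num)]
  simpa using h

def mk (c : ℕ → ℂ) (h : Summable (fun k => ‖c k‖ ^ 2)) : H2 := ⟨c, memH2_of h⟩

@[simp] lemma mk_apply (c : ℕ → ℂ) (h : Summable (fun k => ‖c k‖ ^ 2)) (k : ℕ) :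
    mk c h k = c k := rfl

lemma ker_summable {z : ℂ} (hz : ‖z‖ < 1) :
    Summable (fun k : ℕ => ‖(starRingEnd ℂ z) ^ k‖ ^ 2) := by
  have : (fun k : ℕ => ‖(starRingEnd ℂ z) ^ k‖ ^ 2) = fun k => (‖z‖ ^ 2) ^ k := by
    ext k; rw [norm_pow, RCLike.norm_conj, ← pow_mul, ← pow_mul, mul_comm]
  rw [this]
  exact summable_geometric_of_lt_one (by positivity) (by nlinarith [norm_nonneg z])

def ker (z : ℂ) (hz : ‖z‖ < 1) : H2 := mk _ (ker_summable hz)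

lemma inner_ker (z : ℂ) (hz : ‖z‖ < 1) (a : H2) : inner ℂ (ker z hz) a = fa a z := by
  rw [lp.inner_eq_tsum]
  unfold fa ker
  congr 1; ext k
  simp [mul_comm]

lemma fa_summable (a : H2) {z : ℂ} (hz : ‖z‖ < 1) : Summable (fun k => a k * z ^ k) := by
  have := lp.summable_inner (𝕜 := ℂ) (ker z hz) a
  refine this.congr fun k => ?_
  simp [ker, mul_comm]

lemma norm_ker_sq (z : ℂ) (hz : ‖z‖ < 1) : ‖ker z hz‖ ^ 2 = (1 - ‖z‖ ^ 2)⁻¹ := by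
  rw [H2.norm_sq]
  have : ∀ k : ℕ, ‖ker z hz k‖ ^ 2 = (‖z‖ ^ 2) ^ k := by
    intro k
    simp only [ker, mk_apply]
    rw [norm_pow, RCLike.norm_conj, ← pow_mul, ← pow_mul, mul_comm]
  simp_rw [this]
  exact tsum_geometric_of_lt_one (by positivity) (by nlinarith [norm_nonneg z])

lemma fa_sq_le (a : H2) {z : ℂ} (hz : ‖z‖ < 1) :
    ‖fa a z‖ ^ 2 ≤ ‖a‖ ^ 2 / (1 - ‖z‖ ^ 2) := by
  rw [← inner_ker z hz, div_eq_mul_inv, ← norm_ker_sq z hz, ← mul_pow, mul_comm]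
  gcongr
  exact norm_inner_le_norm _ _

lemma fa_add (a b : H2) {z : ℂ} (hz : ‖z‖ < 1) : fa (a + b) z = fa a z + fa b z := by
  simp only [← inner_ker z hz, inner_add_right]

lemma fa_sub (a b : H2) {z : ℂ} (hz : ‖z‖ < 1) : fa (a - b) z = fa a z - fa b z := by
  simp only [← inner_ker z hz, inner_sub_right]

lemma fa_smul (c : ℂ) (a : H2) {z : ℂ} (hz : ‖z‖ < 1) : fa (c • a) z = c * fa a z := by
  simp only [← inner_ker z hz, inner_smul_right]

lemma shift_summable (a : H2) :
    Summable (fun k : ℕ => ‖(Nat.casesOn k 0 (fun j => a j) : ℂ)‖ ^ 2) := by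
  rw [← summable_nat_add_iff 1]
  exact H2.summable_sq a

def shift : H2 →ₗᵢ[ℂ] H2 where
  toFun a := mk _ (shift_summable a)
  map_add' a b := by
    ext k; rcases k with _ | k <;> simp
  map_smul' c a := by
    ext k; rcases k with _ | k <;> simp
  norm_map' a := by
    rw [← sq_eq_sq₀ (norm_nonneg _) (norm_nonneg _), H2.norm_sq, H2.norm_sq]
    have := (shift_summable a).tsum_eq_zero_add
    simp only [LinearMap.coe_mk, AddHom.coe_mk, mk_apply]
    rw [this]; simp

@[simp] lemma shift_zero (a : H2) : shift a 0 = 0 := rfl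
@[simp] lemma shift_succ (a : H2) (k : ℕ) : shift a (k + 1) = a k := rfl

lemma fa_shift (a : H2) {z : ℂ} (hz : ‖z‖ < 1) : fa (shift a) z = z * fa a z := by
  unfold fa
  rw [(fa_summable (shift a) hz).tsum_eq_zero_add, ← tsum_mul_left]
  simp only [shift_zero, shift_succ]
  simp only [zero_mul, zero_add]
  congr 1; ext k; ring

lemma back_summable (a : H2) : Summable (fun k : ℕ => ‖a (k + 1)‖ ^ 2) :=
  (summable_nat_add_iff (f := fun k => ‖a k‖ ^ 2) 1).2 (H2.summable_sq a)

def backₗ : H2 →ₗ[ℂ] H2 where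
  toFun a := mk _ (back_summable a)
  map_add' a b := by ext k; simp
  map_smul' c a := by ext k; simp

lemma backₗ_norm (a : H2) : ‖backₗ a‖ ≤ 1 * ‖a‖ := by
  rw [one_mul, ← sq_le_sq₀ (norm_nonneg _) (norm_nonneg _), H2.norm_sq, H2.norm_sq,
    (H2.summable_sq a).tsum_eq_zero_add]
  have : ∀ k, backₗ a k = a (k + 1) := fun k => rfl
  simp_rw [this]
  nlinarith [sq_nonneg ‖a 0‖]

def back : H2 →L[ℂ] H2 := backₗ.mkContinuous 1 backₗ_norm

@[simp] lemma back_apply (a : H2) (k : ℕ) : back a k = a (k + 1) := rfl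

lemma back_norm : ‖back‖ ≤ 1 := LinearMap.mkContinuous_norm_le _ (by norm_num) _

lemma exists_solve (A : H2 →L[ℂ] H2) (hA : ‖A‖ < 1) (y : H2) : ∃ h : H2, h - A h = y := by
  let u := Units.oneSub A hA
  refine ⟨(↑u⁻¹ : H2 →L[ℂ] H2) y, ?_⟩
  have : (↑u * ↑u⁻¹ : H2 →L[ℂ] H2) y = y := by rw [Units.mul_inv]; rfl
  simpa [u] using this

lemma norm_blaschke (a : ℂ) (h : H2) :
    ‖shift h - a • h‖ = ‖h - (starRingEnd ℂ a) • shift h‖ := by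
  rw [← sq_eq_sq₀ (norm_nonneg _) (norm_nonneg _), norm_sub_sq (𝕜 := ℂ), norm_sub_sq (𝕜 := ℂ)]
  simp only [norm_smul, RCLike.norm_conj, LinearIsometry.norm_map, inner_smul_right]
  have : RCLike.re (a * inner ℂ (shift h) h) =
      RCLike.re ((starRingEnd ℂ) a * inner ℂ h (shift h)) := by
    rw [← inner_conj_symm h (shift h), ← map_mul, RCLike.conj_re]
  rw [this]

/-- Blaschke factor. -/
def bl (a z : ℂ) : ℂ := (z - a) / (1 - (starRingEnd ℂ a) * z)

lemma bl_den_ne {a z : ℂ} (ha : ‖a‖ < 1) (hz : ‖z‖ < 1) : 1 - (starRingEnd ℂ a) * z ≠ 0 := by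
  intro h
  have : ‖(starRingEnd ℂ a) * z‖ = 1 := by rw [← sub_eq_zero.1 h]; simp
  rw [norm_mul, RCLike.norm_conj] at this
  nlinarith [norm_nonneg a, norm_nonneg z]

lemma fa_of_blaschke {a : ℂ} (ha : ‖a‖ < 1) (h : H2) {z : ℂ} (hz : ‖z‖ < 1) :
    fa (shift h - a • h) z = bl a z * fa (h - (starRingEnd ℂ a) • shift h) z := by
  rw [fa_sub _ _ hz, fa_sub _ _ hz, fa_smul _ _ hz, fa_smul _ _ hz, fa_shift _ hz, bl]
  rw [div_mul_eq_mul_div, eq_div_iff (bl_den_ne ha hz)]; ring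

lemma exists_mul {a : ℂ} (ha : ‖a‖ < 1) (g : H2) :
    ∃ f : H2, ‖f‖ = ‖g‖ ∧ ∀ z : ℂ, ‖z‖ < 1 → fa f z = bl a z * fa g z := by
  obtain ⟨h, hh⟩ := exists_solve ((starRingEnd ℂ a) • shift.toContinuousLinearMap) (by
    rw [norm_smul, RCLike.norm_conj]
    have := shift.norm_toContinuousLinearMap_le
    nlinarith [norm_nonneg a]) g
  have hh' : h - (starRingEnd ℂ a) • shift h = g := by simpa using hh
  refine ⟨shift h - a • h, by rw [norm_blaschke, hh'], fun z hz => ?_⟩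
  rw [fa_of_blaschke ha h hz, hh']

lemma exists_div {a : ℂ} (ha : ‖a‖ < 1) (f : H2) (hf : fa f a = 0) :
    ∃ g : H2, ‖g‖ = ‖f‖ ∧ ∀ z : ℂ, ‖z‖ < 1 → fa f z = bl a z * fa g z := by
  obtain ⟨h, hh⟩ := exists_solve (a • back) (by
    rw [norm_smul]
    have := back_norm
    nlinarith [norm_nonneg a, norm_nonneg back]) (back f)
  have key : ∀ k, (shift h - a • h - f) (k + 1) = 0 := by
    intro k
    have := congrArg (fun y : H2 => y k) hh
    simp only [_root_.smul_apply, lp.coeFn_sub, lp.coeFn_smul, Pi.sub_apply,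
      Pi.smul_apply, back_apply] at this
    simp only [lp.coeFn_sub, lp.coeFn_smul, Pi.sub_apply, Pi.smul_apply, shift_succ]
    rw [this, sub_self]
  have hc : fa (shift h - a • h - f) a = (shift h - a • h - f) 0 := by
    unfold fa
    rw [tsum_eq_single 0]
    · simp
    · intro k hk
      obtain ⟨j, rfl⟩ := Nat.exists_eq_succ_of_ne_zero hk
      rw [key]; simp
  have h0 : fa (shift h - a • h - f) a = 0 := by
    rw [fa_sub _ _ ha, fa_sub _ _ ha, fa_smul _ _ ha, fa_shift _ ha, hf]; ring
  have hfeq : shift h - a • h = f := by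
    rw [← sub_eq_zero]
    ext k
    rcases k with _ | k
    · rw [← hc, h0]; rfl
    · rw [key]; rfl
  refine ⟨h - (starRingEnd ℂ a) • shift h, by rw [← norm_blaschke, hfeq], fun z hz => ?_⟩
  rw [← fa_of_blaschke ha h hz, hfeq]

lemma exists_divz (q : ℕ) (f : H2) (hf : ∀ k < q, f k = 0) :
    ∃ g : H2, ‖g‖ = ‖f‖ ∧ ∀ z : ℂ, ‖z‖ < 1 → fa f z = z ^ q * fa g z := by
  induction q generalizing f with
  | zero => exact ⟨f, rfl, fun z _ => by simp⟩
  | succ q ih =>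
    have hs : shift (back f) = f := by
      ext k
      rcases k with _ | k
      · simp [hf 0 (by omega)]
      · simp
    obtain ⟨g, hg, hgz⟩ := ih (back f) (fun k hk => by rw [back_apply]; exact hf _ (by omega))
    refine ⟨g, by rw [hg, ← hs, LinearIsometry.norm_map, hs], fun z hz => ?_⟩
    rw [← hs, fa_shift _ hz, hgz z hz]; ring

lemma bl_ne {a z : ℂ} (ha : ‖a‖ < 1) (hz : ‖z‖ < 1) (h : z ≠ a) : bl a z ≠ 0 :=
  div_ne_zero (sub_ne_zero.2 h) (bl_den_ne ha hz)

lemma exists_div_prod {ι : Type*} [DecidableEq ι] (s : Finset ι) (w : ι → ℂ)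
    (hw : ∀ i, ‖w i‖ < 1)
    (hinj : Function.Injective w) (f : H2) (hf : ∀ i ∈ s, fa f (w i) = 0) :
    ∃ g : H2, ‖g‖ = ‖f‖ ∧ ∀ z : ℂ, ‖z‖ < 1 → fa f z = (∏ i ∈ s, bl (w i) z) * fa g z := by
  induction s using Finset.induction_on generalizing f with
  | empty => exact ⟨f, rfl, fun z _ => by simp⟩
  | insert j s hj ih =>
    obtain ⟨g1, h1, h2⟩ := exists_div (hw j) f (hf j (by simp))
    obtain ⟨g, h3, h4⟩ := ih g1 (fun i hi => by
      have := h2 (w i) (hw i)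
      rw [hf i (by simp [hi])] at this
      rcases mul_eq_zero.1 this.symm with h | h
      · exact absurd h (bl_ne (hw j) (hw i) (fun h => hj (hinj h ▸ hi)))
      · exact h)
    refine ⟨g, by rw [h3, h1], fun z hz => ?_⟩
    rw [h2 z hz, h4 z hz, Finset.prod_insert hj]; ring

lemma exists_blaschke {ι : Type*} (s : Finset ι) (w : ι → ℂ) (hw : ∀ i, ‖w i‖ < 1) :
    ∃ f : H2, ‖f‖ = 1 ∧ ∀ z : ℂ, ‖z‖ < 1 → fa f z = ∏ i ∈ s, bl (w i) z := by
  classical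
  induction s using Finset.induction_on with
  | empty =>
    refine ⟨lp.single 2 0 1, by simp [lp.norm_single], fun z hz => ?_⟩
    unfold fa
    rw [tsum_eq_single 0]
    · simp
    · intro k hk; simp [hk]
  | insert j s hj ih =>
    obtain ⟨g, h1, h2⟩ := ih
    obtain ⟨f, h3, h4⟩ := exists_mul (hw j) g
    exact ⟨f, by rw [h3, h1], fun z hz => by rw [h4 z hz, h2 z hz, Finset.prod_insert hj]⟩

/-- Pointwise bound for functions vanishing on the prescribed zero set. -/
lemma fa_vanish_le (m q : ℕ) (w : Fin m → ℂ) (hw : ∀ i, ‖w i‖ < 1) (hw0 : ∀ i, w i ≠ 0)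
    (hinj : Function.Injective w) (f : H2) (hf0 : ∀ k < q, f k = 0)
    (hf : ∀ i, fa f (w i) = 0) {z : ℂ} (hz : ‖z‖ < 1) :
    ‖fa f z‖ ^ 2 ≤ (‖z‖ ^ q * ∏ i, ‖bl (w i) z‖) ^ 2 * (‖f‖ ^ 2 / (1 - ‖z‖ ^ 2)) := by
  obtain ⟨g, h1, h2⟩ := exists_divz q f hf0
  obtain ⟨g', h3, h4⟩ := exists_div_prod Finset.univ w hw hinj g (fun i _ => by
    have := h2 (w i) (hw i)
    rw [hf i] at this
    rcases mul_eq_zero.1 this.symm with h | h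
    · exact absurd h (pow_ne_zero _ (hw0 i))
    · exact h)
  rw [h2 z hz, h4 z hz, norm_mul, norm_mul, norm_pow, norm_prod, ← mul_assoc, mul_pow,
    ← h1, ← h3]
  gcongr
  exact fa_sq_le g' hz

end QS

namespace QS

lemma integral_char (n : ℤ) :
    ∫ x in (-Real.pi)..Real.pi, Complex.exp ((n : ℂ) * x * I) = if n = 0 then 2 * (Real.pi : ℂ) else 0 := by
  split_ifs with h
  · subst h; simp; ring
  · have h1 : (fun x : ℝ => Complex.exp ((n : ℂ) * x * I)) =
        fun x : ℝ => Complex.exp ((n * I : ℂ) * x) := by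
      ext x; congr 1; ring
    rw [h1, integral_exp_mul_complex (by simp [h])]
    have : Complex.exp (n * I * (Real.pi : ℝ)) = Complex.exp (n * I * ((-Real.pi : ℝ) : ℂ)) := by
      rw [Complex.exp_eq_exp_iff_exists_int]
      exact ⟨n, by push_cast; ring⟩
    rw [this]; simp

lemma norm_rexp (r θ : ℝ) (hr : 0 ≤ r) : ‖(r : ℂ) * Complex.exp (θ * I)‖ = r := by
  rw [norm_mul, Complex.norm_exp_ofReal_mul_I, mul_one, Complex.norm_real, Real.norm_of_nonneg hr]

lemma coef_summable (f : H2) {r : ℝ} (hr0 : 0 ≤ r) (hr : r < 1) :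
    Summable (fun j => ‖f j * (r : ℂ) ^ j‖) :=
  (fa_summable f (z := r) (by rw [Complex.norm_real, Real.norm_of_nonneg hr0]; exact hr)).norm

lemma fa_circle_eq (f : H2) (r θ : ℝ) :
    fa f (r * Complex.exp (θ * I)) =
      ∑' j : ℕ, f j * (r : ℂ) ^ j * Complex.exp ((j : ℂ) * θ * I) := by
  unfold fa
  congr 1; ext j
  rw [mul_pow, ← Complex.exp_nat_mul, mul_assoc, mul_assoc]

lemma norm_char (t : ℝ) (j : ℤ) : ‖Complex.exp ((j : ℂ) * t * I)‖ = 1 := by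
  have := Complex.norm_exp_ofReal_mul_I (j * t)
  simpa using this

lemma fa_circle_cont (f : H2) {r : ℝ} (hr0 : 0 ≤ r) (hr : r < 1) :
    Continuous (fun θ : ℝ => fa f (r * Complex.exp (θ * I))) := by
  simp_rw [fa_circle_eq]
  refine continuous_tsum (fun j => by fun_prop) (coef_summable f hr0 hr) (fun j θ => ?_)
  have := norm_char θ j
  push_cast at this
  rw [norm_mul, this, mul_one]

lemma coef_integral (f : H2) {r : ℝ} (hr0 : 0 ≤ r) (hr : r < 1) (k : ℕ) :
    ∫ θ in (-Real.pi)..Real.pi, Complex.exp (((-k : ℤ) : ℂ) * θ * I) *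
      fa f (r * Complex.exp (θ * I)) = 2 * Real.pi * (f k * (r : ℂ) ^ k) := by
  have hs := coef_summable f hr0 hr
  have h := intervalIntegral.hasSum_integral_of_dominated_convergence (μ := volume)
    (a := -Real.pi) (b := Real.pi)
    (F := fun (j : ℕ) (θ : ℝ) => f j * (r : ℂ) ^ j * Complex.exp ((((j : ℤ) - k : ℤ) : ℂ) * θ * I))
    (f := fun θ : ℝ => Complex.exp (((-k : ℤ) : ℂ) * θ * I) * fa f (r * Complex.exp (θ * I)))
    (fun j _ => ‖f j * (r : ℂ) ^ j‖)
    (fun j => (by fun_prop : Continuous _).aestronglyMeasurable)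
    (fun j => ae_of_all _ fun t _ => by rw [norm_mul, norm_char, mul_one])
    (ae_of_all _ fun t _ => hs)
    (by simp)
    (ae_of_all _ fun t _ => by
      have h1 : Summable (fun j : ℕ => f j * (r : ℂ) ^ j * Complex.exp ((j : ℂ) * t * I)) := by
        refine Summable.of_norm (hs.congr fun j => ?_)
        have := norm_char t j
        push_cast at this
        rw [norm_mul _ (Complex.exp _), this, mul_one]
      have h2 := h1.hasSum.mul_left (Complex.exp (((-k : ℤ) : ℂ) * t * I))
      rw [fa_circle_eq]
      refine h2.congr_fun ?_ |> fun h => h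
      intro j
      rw [mul_left_comm, ← Complex.exp_add]
      congr 2
      push_cast; ring)
  have h3 := h.tsum_eq
  rw [← h3, tsum_eq_single k]
  · rw [intervalIntegral.integral_const_mul, integral_char]
    simp; ring
  · intro j hj
    rw [intervalIntegral.integral_const_mul, integral_char, if_neg (by omega), mul_zero]

lemma bessel (f : H2) {r : ℝ} (hr0 : 0 ≤ r) (hr : r < 1) (N : ℕ) :
    ∑ k ∈ Finset.range N, ‖f k * (r : ℂ) ^ k‖ ^ 2 ≤
      (2 * Real.pi)⁻¹ * ∫ θ in (-Real.pi)..Real.pi, ‖fa f (r * Complex.exp (θ * I))‖ ^ 2 := by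
  have hab : -Real.pi < Real.pi := by linarith [Real.pi_pos]
  have hc := fa_circle_cont f hr0 hr
  have hL : MemLp (fun θ : ℝ => fa f (r * Complex.exp (θ * I))) 2
      (volume.restrict (Ioc (-Real.pi) Real.pi)) := by
    obtain ⟨C, hC⟩ := (isCompact_Icc (a := -Real.pi) (b := Real.pi)).exists_bound_of_continuousOn
      hc.continuousOn
    refine MemLp.of_bound hc.aestronglyMeasurable C ?_
    filter_upwards [ae_restrict_mem measurableSet_Ioc] with x hx
    exact hC x (Ioc_subset_Icc_self hx)
  have h := hasSum_sq_fourierCoeffOn hab hL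
  have hpi : Real.pi - -Real.pi = 2 * Real.pi := by ring
  have hco : ∀ k : ℕ, fourierCoeffOn hab (fun θ : ℝ => fa f (r * Complex.exp (θ * I))) (k : ℤ) =
      f k * (r : ℂ) ^ k := by
    intro k
    rw [fourierCoeffOn_eq_integral]
    have h1 := coef_integral f hr0 hr k
    have h2 : ∀ x : ℝ, (fourier (-(k : ℤ)) (x : AddCircle (Real.pi - -Real.pi))) =
        Complex.exp (((-k : ℤ) : ℂ) * x * I) := by
      intro x
      rw [fourier_coe_apply]
      congr 1
      have : (Real.pi : ℂ) ≠ 0 := by exact_mod_cast Real.pi_ne_zero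
      push_cast
      field_simp
      ring
    simp_rw [h2, smul_eq_mul, h1]
    rw [hpi, Complex.real_smul]
    have : (Real.pi : ℂ) ≠ 0 := by exact_mod_cast Real.pi_ne_zero
    push_cast
    field_simp
  rw [hpi] at h
  have h4 := sum_le_hasSum ((Finset.range N).map ⟨fun k : ℕ => (k : ℤ), Nat.cast_injective⟩)
    (fun i _ => by positivity) h
  rw [Finset.sum_map] at h4
  simp only [Function.Embedding.coeFn_mk, hco, smul_eq_mul] at h4
  exact h4

lemma norm_le_of_means (f : H2) (M : ℝ) (hM : 0 ≤ M)
    (h : ∀ r : ℝ, 0 ≤ r → r < 1 →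
      ∫ θ in (-Real.pi)..Real.pi, ‖fa f (r * Complex.exp (θ * I))‖ ^ 2 ≤ 2 * Real.pi * M ^ 2) :
    ‖f‖ ≤ M := by
  rw [← sq_le_sq₀ (norm_nonneg _) hM, H2.norm_sq]
  refine (H2.summable_sq f).tsum_le_of_sum_range_le fun N => ?_
  have ht : Tendsto (fun r : ℝ => ∑ k ∈ Finset.range N, ‖f k * (r : ℂ) ^ k‖ ^ 2)
      (nhdsWithin 1 (Iio 1)) (nhds (∑ k ∈ Finset.range N, ‖f k * ((1 : ℝ) : ℂ) ^ k‖ ^ 2)) := by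
    refine (Continuous.tendsto ?_ 1).mono_left nhdsWithin_le_nhds
    fun_prop
  simp only [Complex.ofReal_one, one_pow, mul_one] at ht
  refine le_of_tendsto ht ?_
  filter_upwards [Ioo_mem_nhdsLT (show (0 : ℝ) < 1 by norm_num)] with r hr
  refine (bessel f hr.1.le hr.2 N).trans ?_
  have := h r hr.1.le hr.2
  have hp := Real.pi_pos
  rw [inv_mul_le_iff₀ (by positivity)]
  exact this

lemma approxNum_set_bdd (T : H2 →L[ℂ] H2) (n : ℕ) : BddBelow {c : ℝ | ∃ R : H2 →L[ℂ] H2,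
    FiniteDimensional ℂ (LinearMap.range R.toLinearMap) ∧
    Module.finrank ℂ (LinearMap.range R.toLinearMap) ≤ n - 1 ∧ c = ‖T - R‖} := by
  refine ⟨0, ?_⟩
  rintro c ⟨R, _, _, rfl⟩
  exact norm_nonneg _

lemma approx_upper (T : H2 →L[ℂ] H2) (n m q : ℕ) (hmq : m + q ≤ n - 1) (w : Fin m → ℂ)
    (hw : ∀ i, ‖w i‖ < 1) (C : ℝ) (hC0 : 0 ≤ C)
    (hC : ∀ f : H2, (∀ k < q, f k = 0) → (∀ i, fa f (w i) = 0) → ‖T f‖ ≤ C * ‖f‖) :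
    approxNum T n ≤ C := by
  let v : Fin m ⊕ Fin q → H2 :=
    Sum.elim (fun i => ker (w i) (hw i)) (fun k => lp.single 2 (k : ℕ) 1)
  let K : Submodule ℂ H2 := Submodule.span ℂ (Set.range v)
  have : FiniteDimensional ℂ K := FiniteDimensional.span_of_finite ℂ (Set.finite_range v)
  have hK : Module.finrank ℂ K ≤ m + q := by
    have := finrank_range_le_card (R := ℂ) v
    simpa [Set.finrank, K] using this
  let P : H2 →L[ℂ] H2 := K.starProjection
  have hle : LinearMap.range (T ∘L P).toLinearMap ≤ K.map T.toLinearMap := by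
    rintro _ ⟨x, rfl⟩
    exact ⟨P x, Submodule.starProjection_apply_mem K x, rfl⟩
  have hfd : FiniteDimensional ℂ (K.map T.toLinearMap) := inferInstance
  refine (csInf_le (approxNum_set_bdd T n) ⟨T ∘L P, Submodule.finiteDimensional_of_le hle,
    (Submodule.finrank_mono hle).trans ((Submodule.finrank_map_le _ _).trans (hK.trans hmq)),
    rfl⟩).trans ?_
  refine ContinuousLinearMap.opNorm_le_bound _ hC0 fun x => ?_
  have hx : (T - T ∘L P) x = T (x - P x) := by simp
  rw [hx]
  have hmem : x - P x ∈ Kᗮ := K.sub_starProjection_mem_orthogonal x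
  have horth : ∀ i, inner ℂ (v i) (x - P x) = 0 := fun i =>
    (Submodule.mem_orthogonal K _).1 hmem _ (Submodule.subset_span ⟨i, rfl⟩)
  have h1 := hC (x - P x) (fun k hk => by
    have := horth (Sum.inr ⟨k, hk⟩)
    simp only [v, Sum.elim_inr, lp.inner_single_left] at this
    simpa using this) (fun i => by
    have := horth (Sum.inl i)
    simp only [v, Sum.elim_inl] at this
    rwa [inner_ker] at this)
  refine h1.trans (mul_le_mul_of_nonneg_left ?_ hC0)
  have : x - P x = Kᗮ.starProjection x := by
    rw [Submodule.starProjection_orthogonal]; simp [P]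
  rw [this]
  exact Submodule.norm_starProjection_apply_le _ x

lemma approx_lower (T : H2 →L[ℂ] H2) (φ : ℂ → ℂ)
    (hT : ∀ (a : H2) (z : ℂ), ‖z‖ < 1 → fa (T a) z = fa a (φ z))
    (n : ℕ) (hn : 1 ≤ n) (z : Fin n → ℂ) (ρ : ℝ) (hρ : ρ < 1) (hz : ∀ i, ‖z i‖ ≤ ρ)
    (hw : ∀ i, ‖φ (z i)‖ < 1) (δ : ℝ)
    (hδ : ∀ j, δ ≤ ∏ i ∈ Finset.univ.erase j, ‖bl (φ (z i)) (φ (z j))‖) :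
    δ * Real.sqrt (1 - ρ ^ 2) / n ≤ approxNum T n := by
  have hz1 : ∀ i, ‖z i‖ < 1 := fun i => (hz i).trans_lt hρ
  refine le_csInf ⟨‖T - 0‖, 0, ?_, ?_, rfl⟩ ?_
  · rw [ContinuousLinearMap.toLinearMap_zero, LinearMap.range_zero]; infer_instance
  · rw [ContinuousLinearMap.toLinearMap_zero, LinearMap.range_zero]; simp
  rintro c ⟨R, hfd, hfr, rfl⟩
  let W := LinearMap.range R.toLinearMap
  let v : Fin n → Module.Dual ℂ W := fun i =>
    ((innerSL ℂ (ker (z i) (hz1 i))).toLinearMap).comp W.subtype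
  have hnot : ¬ LinearIndependent ℂ v := by
    intro h
    have := h.fintype_card_le_finrank
    rw [Subspace.dual_finrank_eq, Fintype.card_fin] at this
    have h2 : Module.finrank ℂ W ≤ n - 1 := hfr
    omega
  obtain ⟨c, hc, i0, hi0⟩ := Fintype.not_linearIndependent_iff.1 hnot
  have : Nonempty (Fin n) := ⟨i0⟩
  obtain ⟨j, hj⟩ := Finite.exists_max (fun i => ‖c i‖)
  have hcj : 0 < ‖c j‖ := (norm_pos_iff.2 hi0).trans_le (hj i0)
  obtain ⟨a, ha, haz⟩ := exists_blaschke (Finset.univ.erase j) (fun i => φ (z i)) hw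
  have hR : ∑ i, c i * fa (R a) (z i) = 0 := by
    have := congrArg (fun L : Module.Dual ℂ W => L ⟨R a, ⟨a, rfl⟩⟩) hc
    simp only [v, LinearMap.sum_apply, LinearMap.smul_apply, LinearMap.comp_apply,
      Submodule.subtype_apply, smul_eq_mul, LinearMap.zero_apply,
      ContinuousLinearMap.coe_coe, innerSL_apply_apply, inner_ker] at this
    exact this
  have hTa : ∑ i, c i * fa (T a) (z i) =
      c j * ∏ i ∈ Finset.univ.erase j, bl (φ (z i)) (φ (z j)) := by
    rw [Finset.sum_eq_single j]
    · rw [hT _ _ (hz1 j), haz _ (hw j)]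
    · intro i _ hij
      rw [hT _ _ (hz1 i), haz _ (hw i), Finset.prod_eq_zero (i := i) (by simp [hij]) (by simp [bl]),
        mul_zero]
    · simp
  have hdiff : ∑ i, c i * fa ((T - R) a) (z i) =
      c j * ∏ i ∈ Finset.univ.erase j, bl (φ (z i)) (φ (z j)) := by
    rw [← hTa, ← sub_zero (∑ i, c i * fa (T a) (z i)), ← hR, ← Finset.sum_sub_distrib]
    refine Finset.sum_congr rfl fun i _ => ?_
    rw [_root_.sub_apply, fa_sub _ _ (hz1 i)]; ring
  have hρ0 : 0 ≤ ρ := (norm_nonneg _).trans (hz i0)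
  have hpos : 0 < 1 - ρ ^ 2 := by nlinarith
  have hev : ∀ i, ‖fa ((T - R) a) (z i)‖ ≤ ‖T - R‖ / Real.sqrt (1 - ρ ^ 2) := by
    intro i
    rw [← sq_le_sq₀ (norm_nonneg _) (by positivity), div_pow, Real.sq_sqrt hpos.le]
    refine (fa_sq_le _ (hz1 i)).trans ?_
    have h1 : ‖(T - R) a‖ ≤ ‖T - R‖ := by simpa [ha] using (T - R).le_opNorm a
    have h2 : ‖z i‖ ^ 2 ≤ ρ ^ 2 := by gcongr; exact hz i
    gcongr
  have hup : ‖∑ i, c i * fa ((T - R) a) (z i)‖ ≤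
      n * (‖c j‖ * (‖T - R‖ / Real.sqrt (1 - ρ ^ 2))) := by
    refine (norm_sum_le _ _).trans ?_
    refine (Finset.sum_le_card_nsmul _ _ (‖c j‖ * (‖T - R‖ / Real.sqrt (1 - ρ ^ 2)))
      fun i _ => ?_).trans (by simp)
    rw [norm_mul]
    exact mul_le_mul (hj i) (hev i) (norm_nonneg _) (norm_nonneg _)
  rw [hdiff, norm_mul, norm_prod] at hup
  have h5 : ‖c j‖ * δ ≤ ‖c j‖ * (n * (‖T - R‖ / Real.sqrt (1 - ρ ^ 2))) := by
    refine (mul_le_mul_of_nonneg_left (hδ j) hcj.le).trans (hup.trans (le_of_eq (by ring)))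
  have h6 := le_of_mul_le_mul_left h5 hcj
  have hs : 0 < Real.sqrt (1 - ρ ^ 2) := Real.sqrt_pos.2 hpos
  have hn' : (0 : ℝ) < n := by exact_mod_cast hn
  rw [div_le_iff₀ hn']
  rw [← mul_div_assoc, le_div_iff₀ hs] at h6
  linarith

end QS

namespace QS

lemma eta_tendsto {U : ℝ → ℝ} (hU : ClassU U) : Tendsto (etaU U) atTop atTop := by
  obtain ⟨hc, -, -, h0, -, hpos, -⟩ := hU
  have h1 : Tendsto (fun x : ℝ => Real.exp (-x)) atTop (nhds 0) :=
    Real.tendsto_exp_neg_atTop_nhds_zero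
  have h2 : Tendsto (fun x : ℝ => U (Real.exp (-x))) atTop (nhdsWithin 0 (Ioi 0)) := by
    refine tendsto_nhdsWithin_iff.2 ⟨?_, ?_⟩
    · have := (hc.tendsto 0).comp h1
      rwa [h0] at this
    · filter_upwards [eventually_ge_atTop 0] with x hx
      refine hpos _ (Real.exp_pos _) ?_
      have : Real.exp (-x) ≤ 1 := Real.exp_le_one_iff.2 (by linarith)
      linarith [Real.pi_gt_three]
  exact tendsto_neg_atBot_atTop.comp (Real.tendsto_log_nhdsGT_zero.comp h2)

lemma eta_mono {U : ℝ → ℝ} (hU : ClassU U) {x y : ℝ} (hx : 0 ≤ x) (hxy : x ≤ y) :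
    etaU U x ≤ etaU U y := by
  obtain ⟨hc, -, -, h0, hm, hpos, -⟩ := hU
  have hp := Real.pi_gt_three
  have e1 : Real.exp (-x) ≤ 1 := Real.exp_le_one_iff.2 (by linarith)
  have e2 : Real.exp (-y) ≤ Real.exp (-x) := Real.exp_le_exp.2 (by linarith)
  have e3 := Real.exp_pos (-y)
  unfold etaU
  rw [neg_le_neg_iff]
  refine Real.log_le_log (hpos _ e3 (by linarith)) (hm ⟨e3.le, by linarith⟩ ⟨by linarith, by linarith⟩ e2)

lemma U_eq_exp {U : ℝ → ℝ} (hU : ClassU U) {t : ℝ} (ht : 0 < t) (ht' : t ≤ Real.pi) :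
    U t = Real.exp (-etaU U (-Real.log t)) := by
  unfold etaU
  rw [neg_neg, neg_neg, Real.exp_log ht, Real.exp_log (hU.2.2.2.2.2.1 t ht ht')]

lemma eta_deriv_le {U : ℝ → ℝ} (hU : ClassU U)
    {x₁ : ℝ} (hη_diff : ∀ x : ℝ, x₁ ≤ x → DifferentiableAt ℝ (etaU U) x)
    (hη : Tendsto (fun x : ℝ => x * deriv (etaU U) x / etaU U x) atTop (nhds 0))
    {δ : ℝ} (hδ : 0 < δ) : ∃ X : ℝ, 1 ≤ X ∧ ∀ x, X ≤ x →
    0 < etaU U x ∧ DifferentiableAt ℝ (etaU U) x ∧ deriv (etaU U) x ≤ δ * (etaU U x / x) := by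
  have h1 := (eta_tendsto hU).eventually_gt_atTop 0
  have h2 := hη.eventually (Iio_mem_nhds hδ)
  obtain ⟨X, hX⟩ := eventually_atTop.1 (h1.and h2)
  refine ⟨max X (max x₁ 1), by simp, fun x hx => ?_⟩
  simp only [max_le_iff] at hx
  obtain ⟨a, b⟩ := hX x hx.1
  refine ⟨a, hη_diff x hx.2.1, ?_⟩
  have hx0 : 0 < x := by linarith
  rw [← mul_div_assoc, le_div_iff₀ hx0]
  have b' : x * deriv (etaU U) x / etaU U x < δ := b
  rw [div_lt_iff₀ a] at b'
  linarith

lemma eta_potter {U : ℝ → ℝ} (hU : ClassU U)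
    {x₁ : ℝ} (hη_diff : ∀ x : ℝ, x₁ ≤ x → DifferentiableAt ℝ (etaU U) x)
    (hη : Tendsto (fun x : ℝ => x * deriv (etaU U) x / etaU U x) atTop (nhds 0))
    {δ : ℝ} (hδ : 0 < δ) : ∃ X : ℝ, 1 ≤ X ∧ ∀ x y, X ≤ x → x ≤ y →
    0 < etaU U x ∧ etaU U y ≤ etaU U x * (y / x) ^ δ := by
  obtain ⟨X, hX1, hX⟩ := eta_deriv_le hU hη_diff hη hδ
  have hd : ∀ x, X ≤ x → HasDerivAt (fun x => Real.log (etaU U x) - δ * Real.log x)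
      (deriv (etaU U) x / etaU U x - δ * x⁻¹) x := by
    intro x hx
    obtain ⟨a, b, c⟩ := hX x hx
    exact (b.hasDerivAt.log a.ne').sub ((Real.hasDerivAt_log (by linarith)).const_mul δ)
  have hanti : AntitoneOn (fun x => Real.log (etaU U x) - δ * Real.log x) (Ici X) := by
    refine antitoneOn_of_deriv_nonpos (convex_Ici X)
      (fun x hx => (hd x hx).continuousAt.continuousWithinAt)
      (fun x hx => (hd x (interior_subset hx)).differentiableAt.differentiableWithinAt)
      (fun x hx => ?_)
    have hx := interior_subset hx
    rw [(hd x hx).deriv]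
    obtain ⟨a, b, c⟩ := hX x hx
    rw [sub_nonpos, div_le_iff₀ a]
    refine c.trans (le_of_eq (by ring))
  refine ⟨X, hX1, fun x y hx hxy => ?_⟩
  have hx0 : 0 < x := by linarith
  have hy0 : 0 < y := by linarith
  have a := (hX x hx).1
  have b := (hX y (hx.trans hxy)).1
  refine ⟨a, ?_⟩
  have h := hanti (show x ∈ Ici X from hx) (show y ∈ Ici X from hx.trans hxy) hxy
  simp only at h
  rw [← Real.log_le_log_iff b (by positivity), Real.log_mul a.ne' (by positivity),
    Real.log_rpow (by positivity), Real.log_div hy0.ne' hx0.ne']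
  linarith

lemma eta_slow {U : ℝ → ℝ} (hU : ClassU U)
    {x₁ : ℝ} (hη_diff : ∀ x : ℝ, x₁ ≤ x → DifferentiableAt ℝ (etaU U) x)
    (hη : Tendsto (fun x : ℝ => x * deriv (etaU U) x / etaU U x) atTop (nhds 0))
    {c : ℝ} (hc : 1 ≤ c) {ε : ℝ} (hε : 0 < ε) :
    ∀ᶠ x in atTop, etaU U (c * x) ≤ (1 + ε) * etaU U x := by
  obtain ⟨δ, hδ, hδ'⟩ : ∃ δ : ℝ, 0 < δ ∧ c ^ δ ≤ 1 + ε := by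
    have : Tendsto (fun δ : ℝ => c ^ δ) (nhdsWithin 0 (Ioi 0)) (nhds (c ^ (0 : ℝ))) := by
      refine Tendsto.mono_left ?_ nhdsWithin_le_nhds
      exact (Real.continuous_const_rpow (by linarith)).tendsto 0
    rw [Real.rpow_zero] at this
    have h1 := this.eventually (Iio_mem_nhds (show (1 : ℝ) < 1 + ε by linarith))
    obtain ⟨δ, h2, h3⟩ := (h1.and self_mem_nhdsWithin).exists
    exact ⟨δ, h3, le_of_lt h2⟩
  obtain ⟨X, hX1, hX⟩ := eta_potter hU hη_diff hη hδ
  filter_upwards [eventually_ge_atTop X] with x hx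
  have hx0 : 0 < x := by linarith
  obtain ⟨a, b⟩ := hX x (c * x) hx (by nlinarith)
  rw [mul_div_assoc, div_self hx0.ne', mul_one] at b
  nlinarith

lemma U_potter {U : ℝ → ℝ} (hU : ClassU U)
    {x₁ : ℝ} (hη_diff : ∀ x : ℝ, x₁ ≤ x → DifferentiableAt ℝ (etaU U) x)
    (hη : Tendsto (fun x : ℝ => x * deriv (etaU U) x / etaU U x) atTop (nhds 0))
    {δ : ℝ} (hδ : 0 < δ) : ∃ T : ℝ, 0 < T ∧ T ≤ 1 ∧ ∀ s t, 0 < s → s ≤ t → t ≤ T →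
    U t ≤ U s * (t / s) ^ δ := by
  obtain ⟨X, hX1, hX⟩ := eta_potter hU hη_diff hη one_pos
  have hXp := (hX X X le_rfl le_rfl).1
  obtain ⟨Y, hY1, hY⟩ := eta_deriv_le hU hη_diff hη
    (show 0 < δ / (etaU U X / X) by have : 0 < X := by linarith
                                    positivity)
  set Z := max X Y
  have hbd : ∀ x, Z ≤ x → deriv (etaU U) x ≤ δ := by
    intro x hx
    obtain ⟨a, b, c⟩ := hY x ((le_max_right _ _).trans hx)
    obtain ⟨d, e⟩ := hX X x le_rfl ((le_max_left _ _).trans hx)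
    have hX0 : 0 < X := by linarith
    have hx0 : 0 < x := by linarith [(le_max_left X Y).trans hx]
    refine c.trans ?_
    rw [Real.rpow_one] at e
    have : etaU U x / x ≤ etaU U X / X := by
      rw [div_le_div_iff₀ hx0 hX0]
      have : etaU U X * (x / X) * X = etaU U X * x := by field_simp
      nlinarith
    calc _ ≤ δ / (etaU U X / X) * (etaU U X / X) := by gcongr
      _ = δ := by field_simp
  have hanti : AntitoneOn (fun x => etaU U x - δ * x) (Ici Z) := by
    have hd : ∀ x, Z ≤ x → HasDerivAt (fun x => etaU U x - δ * x) (deriv (etaU U) x - δ * 1) x := by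
      intro x hx
      exact (hY x ((le_max_right _ _).trans hx)).2.1.hasDerivAt.sub ((hasDerivAt_id x).const_mul δ)
    refine antitoneOn_of_deriv_nonpos (convex_Ici Z)
      (fun x hx => (hd x hx).continuousAt.continuousWithinAt)
      (fun x hx => (hd x (interior_subset hx)).differentiableAt.differentiableWithinAt)
      (fun x hx => ?_)
    have hx := interior_subset hx
    rw [(hd x hx).deriv]
    have := hbd x hx
    linarith
  have hZ : 1 ≤ Z := hX1.trans (le_max_left _ _)
  have hpi := Real.pi_gt_three
  have hT1 : Real.exp (-Z) ≤ 1 := Real.exp_le_one_iff.2 (by linarith)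
  refine ⟨Real.exp (-Z), Real.exp_pos _, hT1, fun s t hs hst ht => ?_⟩
  have ht0 : 0 < t := by linarith
  rw [U_eq_exp hU hs (by linarith), U_eq_exp hU ht0 (by linarith), Real.rpow_def_of_pos (by positivity),
    ← Real.exp_add, Real.exp_le_exp, Real.log_div ht0.ne' hs.ne']
  have hl : Real.log s ≤ Real.log t := Real.log_le_log hs hst
  have hl2 : Real.log t ≤ -Z := by rwa [Real.log_le_iff_le_exp ht0]
  have h := hanti (show -Real.log t ∈ Ici Z from by simp; linarith)
    (show -Real.log s ∈ Ici Z from by simp; linarith) (by linarith)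
  simp only at h
  linarith

lemma x_div_omega {U : ℝ → ℝ} (hU : ClassU U) {ω : ℝ → ℝ} (hω_top : Tendsto ω atTop atTop)
    {x₂ : ℝ} (hωeq : ∀ x : ℝ, x₂ ≤ x → etaU U (x / ω x) = ω x) :
    Tendsto (fun x => x / ω x) atTop atTop := by
  rw [tendsto_atTop]
  intro M
  filter_upwards [eventually_ge_atTop x₂, eventually_gt_atTop 0, hω_top.eventually_gt_atTop 0,
    hω_top.eventually_gt_atTop (etaU U (max M 0))] with x h1 h2 h3 h4
  by_contra h
  push Not at h
  have := eta_mono hU (show 0 ≤ x / ω x by positivity) (h.le.trans (le_max_left M 0))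
  rw [hωeq x h1] at this
  linarith

end QS

namespace QS

def den (r t : ℝ) : ℝ := 1 - 2 * r * Real.cos t + r ^ 2
def Pk (r t : ℝ) : ℝ := (1 - r ^ 2) / den r t
def Qk (r t : ℝ) : ℝ := 2 * r * Real.sin t / den r t

lemma den_pos {r : ℝ} (hr0 : 0 ≤ r) (hr : r < 1) (t : ℝ) : 0 < den r t := by
  unfold den; nlinarith [Real.cos_le_one t]

lemma den_cont (r : ℝ) : Continuous (den r) := by unfold den; fun_prop

lemma Pk_cont {r : ℝ} (hr0 : 0 ≤ r) (hr : r < 1) : Continuous (Pk r) := by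
  unfold Pk
  exact continuous_const.div (den_cont r) (fun t => (den_pos hr0 hr t).ne')

lemma Qk_cont {r : ℝ} (hr0 : 0 ≤ r) (hr : r < 1) : Continuous (Qk r) := by
  unfold Qk
  exact (by fun_prop : Continuous fun t => 2 * r * Real.sin t).div (den_cont r)
    (fun t => (den_pos hr0 hr t).ne')

lemma Pk_nonneg {r : ℝ} (hr0 : 0 ≤ r) (hr : r < 1) (t : ℝ) : 0 ≤ Pk r t :=
  div_nonneg (by nlinarith) (den_pos hr0 hr t).le

lemma Pk_neg (r t : ℝ) : Pk r (-t) = Pk r t := by simp [Pk, den]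
lemma Qk_neg (r t : ℝ) : Qk r (-t) = -Qk r t := by simp [Qk, den, neg_div]
lemma Pk_per (r : ℝ) : Function.Periodic (Pk r) (2 * Real.pi) := fun t => by simp [Pk, den]
lemma Qk_per (r : ℝ) : Function.Periodic (Qk r) (2 * Real.pi) := fun t => by simp [Qk, den]

lemma kernel_eq {r : ℝ} (hr0 : 0 ≤ r) (hr : r < 1) (θ x : ℝ) :
    herglotzRieszKernel 0 (r * Complex.exp (θ * I)) (Complex.exp (x * I)) =
      (Pk r (θ - x) : ℂ) + (Qk r (θ - x) : ℂ) * I := by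
  have hd := den_pos hr0 hr (θ - x)
  have hd' : (den r (θ - x) : ℂ) ≠ 0 := by exact_mod_cast hd.ne'
  have hsplit : Complex.exp (θ * I) = Complex.exp (x * I) * Complex.exp (((θ - x : ℝ) : ℂ) * I) := by
    rw [← Complex.exp_add]; congr 1; push_cast; ring
  have hne : 1 - r * Complex.exp (((θ - x : ℝ) : ℂ) * I) ≠ 0 := by
    intro h
    have h1 := congrArg (fun z => ‖z‖) (sub_eq_zero.1 h)
    simp only [norm_one, norm_rexp r _ hr0] at h1
    linarith
  have h2 : ((Pk r (θ - x) : ℂ) + (Qk r (θ - x) : ℂ) * I) =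
      ((1 - r ^ 2 : ℝ) + (2 * r * Real.sin (θ - x) : ℝ) * I) / (den r (θ - x) : ℂ) := by
    unfold Pk Qk; push_cast; ring
  have h3 : herglotzRieszKernel 0 (r * Complex.exp (θ * I)) (Complex.exp (x * I)) =
      (1 + r * Complex.exp (((θ - x : ℝ) : ℂ) * I)) /
        (1 - r * Complex.exp (((θ - x : ℝ) : ℂ) * I)) := by
    rw [herglotzRieszKernel_def, sub_zero, sub_zero, hsplit]
    refine Eq.trans ?_ (mul_div_mul_left _ _ (Complex.exp_ne_zero (x * I)))
    congr 1 <;> ring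
  rw [h3, h2, div_eq_div_iff hne hd']
  unfold den
  rw [Complex.exp_mul_I]
  generalize θ - x = ψ
  have h4 := Complex.sin_sq_add_cos_sq (ψ : ℂ)
  push_cast
  linear_combination (-2 * (r : ℂ) ^ 2) * h4 + (2 * (r : ℂ) ^ 2 * Complex.sin ψ ^ 2) * Complex.I_sq

/-- conjugate Poisson integral -/
def conjP (U : ℝ → ℝ) (r θ : ℝ) : ℝ :=
  (2 * Real.pi)⁻¹ * ∫ x in (-Real.pi)..Real.pi, U x * Qk r (θ - x)

lemma poisson_eq (U : ℝ → ℝ) (r θ : ℝ) :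
    poisson U r θ = (2 * Real.pi)⁻¹ * ∫ x in (-Real.pi)..Real.pi, U x * Pk r (θ - x) := by
  unfold poisson Pk den
  rw [← intervalIntegral.integral_const_mul, ← intervalIntegral.integral_const_mul]
  congr 1; ext x; ring

lemma int_shift {f : ℝ → ℝ} (hf : Function.Periodic f (2 * Real.pi)) (a : ℝ) :
    ∫ x in a..(a + 2 * Real.pi), f x = ∫ x in (-Real.pi)..Real.pi, f x := by
  rw [hf.intervalIntegral_add_eq a (-Real.pi)]; congr 1; ring

lemma int_shiftC {f : ℝ → ℂ} (hf : Function.Periodic f (2 * Real.pi)) (a : ℝ) :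
    ∫ x in a..(a + 2 * Real.pi), f x = ∫ x in (-Real.pi)..Real.pi, f x := by
  rw [hf.intervalIntegral_add_eq a (-Real.pi)]; congr 1; ring

section rep
variable {U : ℝ → ℝ} (hc : Continuous U) (hper : Function.Periodic U (2 * Real.pi))

lemma U_arg (hper : Function.Periodic U (2 * Real.pi)) (x : ℝ) :
    U (Complex.exp (x * I)).arg = U x := by
  rw [Complex.arg_exp_mul_I]
  unfold toIocMod
  exact hper.sub_zsmul_eq _

def Gf (U : ℝ → ℝ) (z : ℂ) : ℂ :=
  Real.circleAverage (fun ζ => herglotzRieszKernel 0 z ζ • ((U ζ.arg : ℝ) : ℂ)) 0 1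

lemma Gf_diff (hc : Continuous U) (hper : Function.Periodic U (2 * Real.pi)) :
    DifferentiableOn ℂ (Gf U) (Metric.ball 0 1) := by
  refine differentiableOn_circleAverage_herglotzRieszKernel_smul ?_
  have : (fun θ : ℝ => ((U (circleMap 0 1 θ).arg : ℝ) : ℂ)) = fun θ => ((U θ : ℝ) : ℂ) := by
    ext θ
    rw [show circleMap 0 1 θ = Complex.exp (θ * I) by simp [circleMap], U_arg hper]
  unfold CircleIntegrable
  rw [this]
  exact (by fun_prop : Continuous fun θ => ((U θ : ℝ) : ℂ)).intervalIntegrable _ _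

lemma Gf_eq (hc : Continuous U) (hper : Function.Periodic U (2 * Real.pi))
    {r : ℝ} (hr0 : 0 ≤ r) (hr : r < 1) (θ : ℝ) :
    Gf U (r * Complex.exp (θ * I)) = (poisson U r θ : ℂ) + (conjP U r θ : ℂ) * I := by
  have hP := Pk_cont hr0 hr
  have hQ := Qk_cont hr0 hr
  unfold Gf
  rw [Real.circleAverage_def]
  have h1 : ∀ x : ℝ, herglotzRieszKernel 0 (r * Complex.exp (θ * I)) (circleMap 0 1 x) •
      ((U (circleMap 0 1 x).arg : ℝ) : ℂ) =
      ((U x * Pk r (θ - x) : ℝ) : ℂ) + ((U x * Qk r (θ - x) : ℝ) : ℂ) * I := by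
    intro x
    rw [show circleMap 0 1 x = Complex.exp (x * I) by simp [circleMap], U_arg hper,
      kernel_eq hr0 hr, smul_eq_mul]
    push_cast; ring
  simp_rw [h1]
  have h2 := int_shiftC (f := fun x : ℝ => ((U x * Pk r (θ - x) : ℝ) : ℂ) +
    ((U x * Qk r (θ - x) : ℝ) : ℂ) * I) (by
      intro x
      have e1 : Pk r (θ - (x + 2 * Real.pi)) = Pk r (θ - x) := by
        rw [← (Pk_per r) (θ - (x + 2 * Real.pi))]; congr 1; ring
      have e2 : Qk r (θ - (x + 2 * Real.pi)) = Qk r (θ - x) := by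
        rw [← (Qk_per r) (θ - (x + 2 * Real.pi))]; congr 1; ring
      simp only [e1, e2, hper x]) 0
  rw [zero_add] at h2
  rw [h2, intervalIntegral.integral_add, intervalIntegral.integral_mul_const,
    intervalIntegral.integral_ofReal, intervalIntegral.integral_ofReal, poisson_eq, conjP]
  · rw [Complex.real_smul]; push_cast; ring
  · exact (by fun_prop : Continuous _).intervalIntegrable _ _
  · exact (by fun_prop : Continuous _).intervalIntegrable _ _

end rep

/-- only `exp(-F)` matters, and it is given by the Schwarz integral. -/
lemma phi_eq {U : ℝ → ℝ} (hU : ClassU U)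
    (F : ℂ → ℂ) (hF : DifferentiableOn ℂ F (Metric.ball 0 1))
    (hFre : ∀ r θ : ℝ, 0 ≤ r → r < 1 →
      (F ((r : ℂ) * Complex.exp (θ * Complex.I))).re = poisson U r θ)
    (hFim : (F 0).im = 0) {r : ℝ} (hr0 : 0 ≤ r) (hr : r < 1) (θ : ℝ) :
    Complex.exp (-F (r * Complex.exp (θ * I))) =
      Complex.exp (-((poisson U r θ : ℂ) + (conjP U r θ : ℂ) * I)) := by
  obtain ⟨hc, -, hper, -⟩ := hU
  have hG := Gf_diff hc hper
  let E : ℂ → ℂ := fun z => Complex.exp (Gf U z - F z)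
  have hE : DifferentiableOn ℂ E (Metric.ball 0 1) := (hG.sub hF).cexp
  have hpolar : ∀ z : ℂ, z = (‖z‖ : ℂ) * Complex.exp (z.arg * I) := fun z =>
    (Complex.norm_mul_exp_arg_mul_I z).symm
  have hre : ∀ z ∈ Metric.ball (0 : ℂ) 1, (Gf U z - F z).re = 0 := by
    intro z hz
    rw [mem_ball_zero_iff] at hz
    rw [hpolar z, Complex.sub_re, hFre _ _ (norm_nonneg _) hz, Gf_eq hc hper (norm_nonneg _) hz]
    simp
  have hnorm : ∀ z ∈ Metric.ball (0 : ℂ) 1, ‖E z‖ = 1 := by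
    intro z hz
    simp only [E, Complex.norm_exp, hre z hz, Real.exp_zero]
  have h0 : E 0 = 1 := by
    have hm : (0 : ℂ) ∈ Metric.ball (0 : ℂ) 1 := by simp
    have h1 := hre 0 hm
    have h2 : (Gf U 0).im = 0 := by
      have := Gf_eq hc hper le_rfl one_pos 0
      rw [Complex.ofReal_zero, zero_mul] at this
      rw [this]
      simp [conjP, Qk]
    have : Gf U 0 - F 0 = 0 := Complex.ext h1 (by simp [h2, hFim])
    simp [E, this]
  have hconst : EqOn E (Function.const ℂ (E 0)) (Metric.ball 0 1) := by
    refine Complex.eqOn_of_isPreconnected_of_isMaxOn_norm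
      (convex_ball (0 : ℂ) 1).isPreconnected Metric.isOpen_ball hE (by simp) ?_
    intro z hz
    simp only [Function.comp_apply, Set.mem_ofPred_eq]
    rw [hnorm z hz, h0]; simp
  have hz : (r * Complex.exp (θ * I) : ℂ) ∈ Metric.ball (0 : ℂ) 1 := by
    rw [mem_ball_zero_iff, norm_rexp r θ hr0]; exact hr
  have h3 := hconst hz
  simp only [Function.const_apply, h0, E] at h3
  rw [← Gf_eq hc hper hr0 hr]
  calc Complex.exp (-F (r * Complex.exp (θ * I)))
      = Complex.exp (-Gf U (r * Complex.exp (θ * I))) *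
        Complex.exp (Gf U (r * Complex.exp (θ * I)) - F (r * Complex.exp (θ * I))) := by
        rw [← Complex.exp_add]; congr 1; ring
    _ = _ := by rw [h3, mul_one]

lemma fold {U k : ℝ → ℝ} (hc : Continuous U) (hper : Function.Periodic U (2 * Real.pi))
    (hk : Continuous k) (hkper : Function.Periodic k (2 * Real.pi)) (θ : ℝ) :
    ∫ x in (-Real.pi)..Real.pi, U x * k (θ - x) =
      ∫ t in (0 : ℝ)..Real.pi, (U (θ - t) * k t + U (θ + t) * k (-t)) := by
  have h1 : ∫ x in (-Real.pi)..Real.pi, U x * k (θ - x) =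
      ∫ x in (-Real.pi)..Real.pi, U (θ - (θ - x)) * k (θ - x) := by simp
  rw [h1, intervalIntegral.integral_comp_sub_left (fun t => U (θ - t) * k t) θ]
  have h2 := int_shift (f := fun t => U (θ - t) * k t) (by
    intro x
    have : U (θ - (x + 2 * Real.pi)) = U (θ - x) := by
      rw [← hper (θ - (x + 2 * Real.pi))]; congr 1; ring
    simp only [this, hkper x]) (θ - Real.pi)
  rw [show θ - Real.pi + 2 * Real.pi = θ - -Real.pi by ring] at h2
  rw [h2]
  have hcont : Continuous fun t => U (θ - t) * k t := by fun_prop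
  rw [← intervalIntegral.integral_add_adjacent_intervals (b := 0)
    (hcont.intervalIntegrable _ _) (hcont.intervalIntegrable _ _)]
  have h3 := intervalIntegral.integral_comp_neg (a := 0) (b := Real.pi) (fun t => U (θ - t) * k t)
  rw [neg_zero] at h3
  rw [← h3, intervalIntegral.integral_add]
  · simp only [sub_neg_eq_add]; ring
  · exact (by fun_prop : Continuous _).intervalIntegrable _ _
  · exact (by fun_prop : Continuous _).intervalIntegrable _ _

lemma poisson_fold {U : ℝ → ℝ} (hc : Continuous U) (hper : Function.Periodic U (2 * Real.pi))
    {r : ℝ} (hr0 : 0 ≤ r) (hr : r < 1) (θ : ℝ) :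
    poisson U r θ = (2 * Real.pi)⁻¹ *
      ∫ t in (0 : ℝ)..Real.pi, (U (θ - t) + U (θ + t)) * Pk r t := by
  rw [poisson_eq, fold hc hper (Pk_cont hr0 hr) (Pk_per r)]
  congr 2; ext t; rw [Pk_neg]; ring

lemma conjP_fold {U : ℝ → ℝ} (hc : Continuous U) (hper : Function.Periodic U (2 * Real.pi))
    {r : ℝ} (hr0 : 0 ≤ r) (hr : r < 1) (θ : ℝ) :
    conjP U r θ = (2 * Real.pi)⁻¹ *
      ∫ t in (0 : ℝ)..Real.pi, (U (θ - t) - U (θ + t)) * Qk r t := by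
  rw [conjP, fold hc hper (Qk_cont hr0 hr) (Qk_per r)]
  congr 2; ext t; rw [Qk_neg]; ring

lemma Pk_int {r : ℝ} (hr0 : 0 ≤ r) (hr : r < 1) : ∫ t in (0 : ℝ)..Real.pi, Pk r t = Real.pi := by
  have h1 : (poisson (fun _ => 1) r 0) = 1 := by
    have hd : DiffContOnCl ℂ (fun _ : ℂ => (1 : ℂ)) (Metric.ball 0 1) := diffContOnCl_const
    have hz : (r * Complex.exp ((0 : ℝ) * I) : ℂ) ∈ Metric.ball (0 : ℂ) 1 := by
      rw [mem_ball_zero_iff, norm_rexp r 0 hr0]; exact hr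
    have h := hd.circleAverage_re_herglotzRieszKernel_smul hz
    have h2 := congrArg Complex.re
      (Gf_eq (U := fun _ => 1) continuous_const (fun _ => rfl) hr0 hr 0)
    have hci : CircleIntegrable (fun _ : ℂ => (1 : ℝ)) 0 1 := by
      unfold CircleIntegrable; simp
    unfold Gf at h2
    rw [re_circleAverage_herglotzRieszKernel_smul hci hz] at h2
    have h3 : (Real.circleAverage ((Complex.re ∘ herglotzRieszKernel 0 (r * Complex.exp ((0 : ℝ) * I))) •
      fun _ => (1 : ℝ)) 0 1) = 1 := by
      have h4 : ((Real.circleAverage ((Complex.re ∘ herglotzRieszKernel 0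
        (r * Complex.exp ((0 : ℝ) * I))) • fun _ => (1 : ℝ)) 0 1 : ℝ) : ℂ) = 1 := by
        rw [← h, Real.circleAverage_def, Real.circleAverage_def]
        rw [Complex.real_smul, smul_eq_mul, Complex.ofReal_mul, ← intervalIntegral.integral_ofReal]
        congr 2
        ext x
        simp
      exact_mod_cast h4
    rw [h3] at h2
    simpa using h2.symm
  rw [poisson_fold continuous_const (fun _ => rfl) hr0 hr, intervalIntegral.integral_const_mul,
    inv_mul_eq_iff_eq_mul₀ (by positivity)] at h1
  linarith

end QS

namespace QS

lemma U_red {U : ℝ → ℝ} (hU : ClassU U) (x : ℝ) : ∃ y, 0 ≤ y ∧ y ≤ Real.pi ∧ U x = U y := by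
  obtain ⟨hc, hev, hper, h0, hm, hp, -⟩ := hU
  refine ⟨|(Complex.exp (x * I)).arg|, abs_nonneg _, Complex.abs_arg_le_pi _, ?_⟩
  rw [← U_arg hper x]
  rcases abs_choice (Complex.exp (x * I)).arg with h | h <;> rw [h]
  rw [hev]

lemma U_nonneg {U : ℝ → ℝ} (hU : ClassU U) (x : ℝ) : 0 ≤ U x := by
  obtain ⟨y, hy0, hy, h⟩ := U_red hU x
  obtain ⟨hc, hev, hper, h0, hm, hp, -⟩ := hU
  rw [h, ← h0]
  exact hm ⟨le_rfl, Real.pi_pos.le⟩ ⟨hy0, hy⟩ hy0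

lemma U_le_pi {U : ℝ → ℝ} (hU : ClassU U) (x : ℝ) : U x ≤ U Real.pi := by
  obtain ⟨y, hy0, hy, h⟩ := U_red hU x
  obtain ⟨hc, hev, hper, h0, hm, hp, -⟩ := hU
  rw [h]
  exact hm ⟨hy0, hy⟩ ⟨Real.pi_pos.le, le_rfl⟩ hy

lemma U_mono {U : ℝ → ℝ} (hU : ClassU U) {x y : ℝ} (hx : 0 ≤ x) (hxy : x ≤ y)
    (hy : y ≤ Real.pi) : U x ≤ U y :=
  hU.2.2.2.2.1 ⟨hx, hxy.trans hy⟩ ⟨hx.trans hxy, hy⟩ hxy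

lemma U_pos {U : ℝ → ℝ} (hU : ClassU U) {x : ℝ} (hx : 0 < x) (hy : x ≤ Real.pi) : 0 < U x :=
  hU.2.2.2.2.2.1 x hx hy

lemma poisson_neg {U : ℝ → ℝ} (hU : ClassU U) {r : ℝ} (hr0 : 0 ≤ r) (hr : r < 1) (θ : ℝ) :
    poisson U r (-θ) = poisson U r θ := by
  obtain ⟨hc, hev, hper, -⟩ := hU
  rw [poisson_fold hc hper hr0 hr, poisson_fold hc hper hr0 hr]
  congr 2; ext t
  rw [← hev (-θ - t), ← hev (-θ + t)]
  rw [show -(-θ - t) = θ + t by ring, show -(-θ + t) = θ - t by ring]; ring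

lemma conjP_neg {U : ℝ → ℝ} (hU : ClassU U) {r : ℝ} (hr0 : 0 ≤ r) (hr : r < 1) (θ : ℝ) :
    conjP U r (-θ) = -conjP U r θ := by
  obtain ⟨hc, hev, hper, -⟩ := hU
  rw [conjP_fold hc hper hr0 hr, conjP_fold hc hper hr0 hr, ← mul_neg,
    ← intervalIntegral.integral_neg]
  congr 2; ext t
  rw [← hev (-θ - t), ← hev (-θ + t)]
  rw [show -(-θ - t) = θ + t by ring, show -(-θ + t) = θ - t by ring]; ring

lemma conjP_zero {U : ℝ → ℝ} (hU : ClassU U) {r : ℝ} (hr0 : 0 ≤ r) (hr : r < 1) :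
    conjP U r 0 = 0 := by
  have := conjP_neg hU hr0 hr 0
  rw [neg_zero] at this; linarith

lemma Pk_half {r : ℝ} (hr0 : 0 ≤ r) (hr : r < 1) :
    Real.pi / 2 ≤ ∫ t in (0 : ℝ)..(Real.pi / 2), Pk r t := by
  have hP := Pk_cont hr0 hr
  have h1 := intervalIntegral.integral_add_adjacent_intervals (a := 0) (b := Real.pi / 2)
    (c := Real.pi) (μ := volume) (hP.intervalIntegrable _ _) (hP.intervalIntegrable _ _)
  rw [Pk_int hr0 hr] at h1
  have hpi := Real.pi_pos
  have h2 : ∫ t in (Real.pi / 2)..Real.pi, Pk r t ≤ ∫ t in (Real.pi / 2)..Real.pi, (1 : ℝ) := by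
    refine intervalIntegral.integral_mono_on (by linarith) (hP.intervalIntegrable _ _)
      (by simp) ?_
    intro t ht
    have hcos : Real.cos t ≤ 0 :=
      Real.cos_nonpos_of_pi_div_two_le_of_le ht.1 (by linarith [ht.2])
    unfold Pk
    rw [div_le_one (den_pos hr0 hr t)]
    unfold den
    nlinarith
  rw [intervalIntegral.integral_const] at h2
  simp at h2
  linarith

lemma u_lower {U : ℝ → ℝ} (hU : ClassU U) {r : ℝ} (hr0 : 0 ≤ r) (hr : r < 1) {θ : ℝ}
    (hθ : |θ| ≤ Real.pi) : (1 / 4) * U (min |θ| (Real.pi / 2)) ≤ poisson U r θ := by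
  have hpi := Real.pi_pos
  wlog h : 0 ≤ θ generalizing θ with H
  · rw [← poisson_neg hU hr0 hr, ← abs_neg]
    exact H (by rwa [abs_neg]) (by linarith)
  rw [abs_of_nonneg h] at hθ ⊢
  have hn := U_nonneg hU
  have hm : ∀ t ∈ Icc 0 (Real.pi / 2), U (min θ (Real.pi / 2)) ≤ U (θ + t) := by
    intro t ht
    by_cases hy : θ + t ≤ Real.pi
    · exact U_mono hU (le_min h (by linarith)) ((min_le_left _ _).trans (by linarith [ht.1])) hy
    · have : U (θ + t) = U (2 * Real.pi - (θ + t)) := by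
        rw [← hU.2.1 (θ + t), ← hU.2.2.1 (-(θ + t))]; congr 1; ring
      rw [this]
      exact U_mono hU (le_min h (by linarith)) ((min_le_right _ _).trans (by linarith [ht.2]))
        (by linarith)
  obtain ⟨hc, hev, hper, -⟩ := hU
  have hP := Pk_cont hr0 hr
  have hP0 := Pk_nonneg hr0 hr
  rw [poisson_fold hc hper hr0 hr]
  have hcont : Continuous fun t => (U (θ - t) + U (θ + t)) * Pk r t := by fun_prop
  have h1 : U (min θ (Real.pi / 2)) * (Real.pi / 2) ≤
      ∫ t in (0 : ℝ)..Real.pi, (U (θ - t) + U (θ + t)) * Pk r t := by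
    calc U (min θ (Real.pi / 2)) * (Real.pi / 2)
        ≤ U (min θ (Real.pi / 2)) * ∫ t in (0 : ℝ)..(Real.pi / 2), Pk r t :=
          mul_le_mul_of_nonneg_left (Pk_half hr0 hr) (hn _)
      _ = ∫ t in (0 : ℝ)..(Real.pi / 2), U (min θ (Real.pi / 2)) * Pk r t := by
          rw [intervalIntegral.integral_const_mul]
      _ ≤ ∫ t in (0 : ℝ)..(Real.pi / 2), (U (θ - t) + U (θ + t)) * Pk r t := by
          refine intervalIntegral.integral_mono_on (by linarith)
            ((by fun_prop : Continuous _).intervalIntegrable _ _)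
            (hcont.intervalIntegrable _ _) ?_
          intro t ht
          exact mul_le_mul_of_nonneg_right (by linarith [hm t ht, hn (θ - t)]) (hP0 t)
      _ ≤ _ := by
          rw [← intervalIntegral.integral_add_adjacent_intervals (a := 0) (b := Real.pi / 2)
            (c := Real.pi) (μ := volume) (hcont.intervalIntegrable _ _)
            (hcont.intervalIntegrable _ _)]
          have : 0 ≤ ∫ t in (Real.pi / 2)..Real.pi, (U (θ - t) + U (θ + t)) * Pk r t :=
            intervalIntegral.integral_nonneg (by linarith)
              (fun t _ => mul_nonneg (add_nonneg (hn _) (hn _)) (hP0 t))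
          linarith
  rw [inv_mul_eq_div, le_div_iff₀ (by positivity)]
  linarith

lemma u_upper {U : ℝ → ℝ} (hU : ClassU U) {r : ℝ} (hr0 : 0 ≤ r) (hr : r < 1) (θ : ℝ) :
    poisson U r θ ≤ U Real.pi := by
  have hpi := Real.pi_pos
  have hn := U_le_pi hU
  obtain ⟨hc, hev, hper, -⟩ := hU
  have hP := Pk_cont hr0 hr
  have hP0 := Pk_nonneg hr0 hr
  rw [poisson_fold hc hper hr0 hr]
  have h1 : ∫ t in (0 : ℝ)..Real.pi, (U (θ - t) + U (θ + t)) * Pk r t ≤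
      ∫ t in (0 : ℝ)..Real.pi, (2 * U Real.pi) * Pk r t := by
    refine intervalIntegral.integral_mono_on (by linarith)
            ((by fun_prop : Continuous _).intervalIntegrable _ _)
            ((by fun_prop : Continuous _).intervalIntegrable _ _) ?_
    intro t ht
    exact mul_le_mul_of_nonneg_right (by linarith [hn (θ + t), hn (θ - t)]) (hP0 t)
  rw [intervalIntegral.integral_const_mul, Pk_int hr0 hr] at h1
  rw [inv_mul_eq_div, div_le_iff₀ (by positivity)]
  linarith

lemma den_ge {r t : ℝ} (hr0 : 0 ≤ r) (ht0 : 0 ≤ t) (ht : t ≤ Real.pi) :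
    4 * r * (t / Real.pi) ^ 2 ≤ den r t := by
  have hpi := Real.pi_pos
  have h1 : t / Real.pi ≤ Real.sin (t / 2) := by
    have := Real.mul_le_sin (x := t / 2) (by linarith) (by linarith)
    calc t / Real.pi = 2 / Real.pi * (t / 2) := by ring
      _ ≤ _ := this
  have h2 : Real.cos t = 1 - 2 * Real.sin (t / 2) ^ 2 := by
    have := Real.cos_sq' (t/2)
    have h3 := Real.cos_two_mul (t / 2)
    rw [show 2 * (t / 2) = t by ring] at h3
    rw [h3, this]; ring
  have h0 : 0 ≤ t / Real.pi := by positivity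
  have h3 : (t / Real.pi) ^ 2 ≤ Real.sin (t / 2) ^ 2 := by gcongr
  unfold den
  rw [h2]
  nlinarith [sq_nonneg (1 - r)]

lemma U_ge_sqrt {U : ℝ → ℝ} (hU : ClassU U) {x₁ : ℝ}
    (hη_diff : ∀ x : ℝ, x₁ ≤ x → DifferentiableAt ℝ (etaU U) x)
    (hη : Tendsto (fun x : ℝ => x * deriv (etaU U) x / etaU U x) atTop (nhds 0)) :
    ∃ c, 0 < c ∧ ∀ t, 0 ≤ t → t ≤ Real.pi → c * Real.sqrt t ≤ U t := by
  obtain ⟨T, hT0, hT1, h⟩ := U_potter hU hη_diff hη (δ := 1 / 2) (by norm_num)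
  have hpi := Real.pi_gt_three
  have hUT := U_pos hU hT0 (by linarith)
  have hsp : 0 < Real.sqrt Real.pi := Real.sqrt_pos.2 (by linarith)
  have hspT : Real.sqrt T ≤ Real.sqrt Real.pi := Real.sqrt_le_sqrt (by linarith)
  refine ⟨U T / Real.sqrt Real.pi, by positivity, ?_⟩
  intro t ht0 ht
  rw [div_mul_eq_mul_div, div_le_iff₀ hsp]
  rcases ht0.eq_or_lt with rfl | ht0
  · simp; exact mul_nonneg (U_nonneg hU _) (by positivity)
  rcases le_total t T with htT | htT
  · have h1 := h t T ht0 htT le_rfl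
    rw [← Real.sqrt_eq_rpow, Real.sqrt_div' _ ht0.le] at h1
    have hst : 0 < Real.sqrt t := Real.sqrt_pos.2 ht0
    calc U T * Real.sqrt t ≤ U t * (Real.sqrt T / Real.sqrt t) * Real.sqrt t := by gcongr
      _ = U t * Real.sqrt T := by field_simp
      _ ≤ _ := mul_le_mul_of_nonneg_left hspT (U_nonneg hU _)
  · exact mul_le_mul (U_mono hU hT0.le htT ht) (Real.sqrt_le_sqrt ht) (Real.sqrt_nonneg _)
      (U_nonneg hU _)

lemma u_axis {U : ℝ → ℝ} (hU : ClassU U) {x₁ : ℝ}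
    (hη_diff : ∀ x : ℝ, x₁ ≤ x → DifferentiableAt ℝ (etaU U) x)
    (hη : Tendsto (fun x : ℝ => x * deriv (etaU U) x / etaU U x) atTop (nhds 0)) :
    ∃ C, 0 < C ∧ ∀ s, 0 < s → s ≤ 1 / 2 → poisson U (1 - s ^ 3) 0 ≤ C * U s := by
  obtain ⟨c, hc0, hcU⟩ := U_ge_sqrt hU hη_diff hη
  have hpi := Real.pi_gt_three
  have hUpi := U_pos hU (by linarith : 0 < Real.pi) le_rfl
  refine ⟨1 + U Real.pi * Real.pi ^ 2 / c, by positivity, ?_⟩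
  intro s hs0 hs
  have hs3 : s ^ 3 ≤ 1 / 2 := by
    calc s ^ 3 ≤ (1 / 2) ^ 3 := by gcongr
      _ ≤ _ := by norm_num
  have hs30 : 0 < s ^ 3 := by positivity
  set r := 1 - s ^ 3 with hr
  have hr0 : 0 ≤ r := by linarith
  have hr1 : r < 1 := by linarith
  have hsU : s ≤ U s / c := by
    rw [le_div_iff₀ hc0]
    have h1 := hcU s hs0.le (by linarith)
    have : s ≤ Real.sqrt s := Real.le_sqrt_of_sq_le (by nlinarith)
    nlinarith
  have hP := Pk_cont hr0 hr1
  have hP0 := Pk_nonneg hr0 hr1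
  have hU' := hU
  obtain ⟨hc, hev, hper, -⟩ := hU'
  rw [poisson_fold hc hper hr0 hr1]
  have h1 : ∫ t in (0 : ℝ)..Real.pi, (U (0 - t) + U (0 + t)) * Pk r t ≤
      ∫ t in (0 : ℝ)..Real.pi, ((2 * U s) * Pk r t + 2 * U Real.pi * (Real.pi ^ 2 * s)) := by
    refine intervalIntegral.integral_mono_on (by linarith)
            ((by fun_prop : Continuous _).intervalIntegrable _ _)
            ((by fun_prop : Continuous _).intervalIntegrable _ _) ?_
    intro t ht
    rw [zero_sub, zero_add, hev]
    rcases le_total t s with hts | hts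
    · have : U t ≤ U s := U_mono hU ht.1 hts (by linarith)
      have h2 := mul_le_mul_of_nonneg_right this (hP0 t)
      have h3 : 0 ≤ 2 * U Real.pi * (Real.pi ^ 2 * s) := by positivity
      linarith
    · have hPb : Pk r t ≤ Real.pi ^ 2 * s := by
        unfold Pk
        have ht0 : 0 < t := by linarith
        rw [div_le_iff₀ (den_pos hr0 hr1 t)]
        have hd := den_ge hr0 ht.1 ht.2
        have hd2 : 2 * (s / Real.pi) ^ 2 ≤ den r t := by
          refine le_trans ?_ hd
          have : (s / Real.pi) ^ 2 ≤ (t / Real.pi) ^ 2 := by gcongr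
          have h5 : 0 ≤ (s / Real.pi) ^ 2 := by positivity
          nlinarith
        calc 1 - r ^ 2 ≤ 2 * s ^ 3 := by rw [hr]; nlinarith
          _ = Real.pi ^ 2 * s * (2 * (s / Real.pi) ^ 2) := by field_simp
          _ ≤ _ := by gcongr
      have h2 : U t * Pk r t ≤ U Real.pi * (Real.pi ^ 2 * s) :=
        mul_le_mul (U_le_pi hU t) hPb (hP0 t) hUpi.le
      have h3 := mul_nonneg (U_nonneg hU s) (hP0 t)
      linarith
  rw [intervalIntegral.integral_add ((by fun_prop : Continuous _).intervalIntegrable _ _)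
    (by simp), intervalIntegral.integral_const_mul, Pk_int hr0 hr1,
    intervalIntegral.integral_const] at h1
  rw [inv_mul_eq_div, div_le_iff₀ (by positivity)]
  refine h1.trans ?_
  simp only [sub_zero, smul_eq_mul]
  have : U Real.pi * Real.pi ^ 2 * s ≤ U Real.pi * Real.pi ^ 2 * (U s / c) := by gcongr
  have h6 : U Real.pi * Real.pi ^ 2 / c * U s = U Real.pi * Real.pi ^ 2 * (U s / c) := by ring
  rw [add_mul, h6]
  nlinarith

end QS

namespace QS

lemma Qk_nonneg {r t : ℝ} (hr0 : 0 ≤ r) (hr : r < 1) (ht0 : 0 ≤ t) (ht : t ≤ Real.pi) :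
    0 ≤ Qk r t := by
  unfold Qk
  have := Real.sin_nonneg_of_nonneg_of_le_pi ht0 ht
  exact div_nonneg (by positivity) (den_pos hr0 hr t).le

lemma Qk_le {r t : ℝ} (hr0 : 0 ≤ r) (hr : r < 1) (ht0 : 0 < t) (ht : t ≤ Real.pi) :
    Qk r t ≤ 5 / t := by
  unfold Qk
  rw [div_le_div_iff₀ (den_pos hr0 hr t) ht0]
  have hd := den_ge hr0 ht0.le ht
  have hs := Real.sin_le ht0.le
  have hpi := Real.pi_gt_three
  have hpi2 : Real.pi ^ 2 ≤ 10 := by nlinarith [Real.pi_lt_d2]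
  have h1 : t ^ 2 ≤ 10 * (t / Real.pi) ^ 2 := by
    rw [div_pow, mul_div_assoc', le_div_iff₀ (by positivity)]
    nlinarith [sq_nonneg t]
  have h2 : r * t ^ 2 ≤ r * (10 * (t / Real.pi) ^ 2) := by gcongr
  have h3 : 2 * r * Real.sin t * t ≤ 2 * r * t * t := by gcongr
  nlinarith

/-- Bernoulli -/
lemma bern {δ x : ℝ} (h0 : 0 ≤ δ) (h1 : δ ≤ 1) (hx : 0 ≤ x) : (1 + x) ^ δ ≤ 1 + δ * x :=
  rpow_one_add_le_one_add_mul_self (by linarith) h0 h1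

lemma U_diff_nonneg {U : ℝ → ℝ} (hU : ClassU U) {θ t : ℝ} (hθ0 : 0 ≤ θ)
    (hθ : θ ≤ Real.pi / 2) (ht0 : 0 ≤ t) (ht : t ≤ Real.pi) : U (θ - t) ≤ U (θ + t) := by
  have h1 : U (θ - t) = U |θ - t| := by
    rcases abs_choice (θ - t) with h | h <;> rw [h]
    rw [hU.2.1]
  rw [h1]
  by_cases hy : θ + t ≤ Real.pi
  · exact U_mono hU (abs_nonneg _) (abs_le.2 ⟨by linarith, by linarith⟩) hy
  · have : U (θ + t) = U (2 * Real.pi - (θ + t)) := by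
      rw [← hU.2.1 (θ + t), ← hU.2.2.1 (-(θ + t))]; congr 1; ring
    rw [this]
    exact U_mono hU (abs_nonneg _) (abs_le.2 ⟨by linarith, by linarith⟩) (by linarith)

section
variable {U : ℝ → ℝ} {δ T θ : ℝ}

lemma va (hU : ClassU U) (hδ0 : 0 < δ) (hδ : δ ≤ 1 / 2) (hT : T ≤ 1)
    (hp : ∀ s t, 0 < s → s ≤ t → t ≤ T → U t ≤ U s * (t / s) ^ δ)
    (hθ0 : 0 < θ) (hθ : θ ≤ T / 4) {r t : ℝ} (hr0 : 0 ≤ r) (hr : r < 1)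
    (ht0 : 0 ≤ t) (ht : t ≤ θ / 2) :
    (U (θ + t) - U (θ - t)) * Qk r t ≤ 20 * δ * U θ / θ := by
  have hpi := Real.pi_gt_three
  have hUn := U_nonneg hU
  rcases ht0.eq_or_lt with rfl | ht0
  · simp only [add_zero, sub_zero, sub_self, zero_mul]
    have := hUn θ
    positivity
  have h1 := hp (θ - t) (θ + t) (by linarith) (by linarith) (by linarith)
  have h2 : (θ + t) / (θ - t) = 1 + 2 * t / (θ - t) := by
    have : θ - t ≠ 0 := by linarith
    field_simp; ring
  have h3 : 2 * t / (θ - t) ≤ 4 * t / θ := by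
    rw [div_le_div_iff₀ (by linarith) hθ0]; nlinarith
  have h3' : 0 ≤ 2 * t / (θ - t) := div_nonneg (by linarith) (by linarith)
  rw [h2] at h1
  have h4 := bern hδ0.le (by linarith) h3'
  have h5 : U (θ + t) - U (θ - t) ≤ U θ * (δ * (4 * t / θ)) := by
    have h6 : U (θ + t) ≤ U (θ - t) * (1 + δ * (2 * t / (θ - t))) :=
      h1.trans (mul_le_mul_of_nonneg_left h4 (hUn _))
    calc U (θ + t) - U (θ - t) ≤ U (θ - t) * (δ * (2 * t / (θ - t))) := by linarith
      _ ≤ _ := by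
        refine mul_le_mul (U_mono hU (by linarith) (by linarith) (by linarith)) (by gcongr)
          (by positivity) (hUn _)
  have hQ := Qk_le hr0 hr ht0 (by linarith)
  have hQ0 := Qk_nonneg hr0 hr ht0.le (by linarith : t ≤ Real.pi)
  calc (U (θ + t) - U (θ - t)) * Qk r t ≤ (U θ * (δ * (4 * t / θ))) * (5 / t) := by
        refine mul_le_mul h5 hQ hQ0 ?_
        have := hUn θ
        positivity
    _ = _ := by field_simp; ring

lemma vb (hU : ClassU U) (hδ0 : 0 < δ) (hδ : δ ≤ 1 / 2) (hT : T ≤ 1)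
    (hp : ∀ s t, 0 < s → s ≤ t → t ≤ T → U t ≤ U s * (t / s) ^ δ)
    (hθ0 : 0 < θ) (hθ : θ ≤ T / 4) {r t : ℝ} (hr0 : 0 ≤ r) (hr : r < 1)
    (ht0 : θ / 2 ≤ t) (ht : t ≤ 2 * θ) :
    (U (θ + t) - U (θ - t)) * Qk r t ≤ 30 * U θ / θ * (1 - (|t - θ| / (3 * θ)) ^ δ) := by
  have hpi := Real.pi_gt_three
  have hUn := U_nonneg hU
  have habs : |t - θ| ≤ θ := abs_le.2 ⟨by linarith, by linarith⟩
  have hx0 : 0 ≤ |t - θ| / (3 * θ) := by positivity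
  have hx1 : |t - θ| / (3 * θ) ≤ 1 := by rw [div_le_one (by positivity)]; linarith
  have hxd : (|t - θ| / (3 * θ)) ^ δ ≤ 1 := Real.rpow_le_one hx0 hx1 hδ0.le
  have h1 : U (θ + t) ≤ U (3 * θ) := U_mono hU (by linarith) (by linarith) (by linarith)
  have h3 : U (3 * θ) ≤ 3 * U θ := by
    have := hp θ (3 * θ) hθ0 (by linarith) (by linarith)
    rw [mul_div_assoc, div_self hθ0.ne', mul_one] at this
    have h4 : (3 : ℝ) ^ δ ≤ 3 ^ (1 : ℝ) := Real.rpow_le_rpow_of_exponent_le (by norm_num) (by linarith)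
    rw [Real.rpow_one] at h4
    nlinarith [hUn θ]
  have h2 : U (3 * θ) * (|t - θ| / (3 * θ)) ^ δ ≤ U (θ - t) := by
    rcases eq_or_ne t θ with rfl | hne
    · simp only [sub_self, abs_zero, zero_div, Real.zero_rpow hδ0.ne', mul_zero]; exact hUn _
    have hpos : 0 < |t - θ| := abs_pos.2 (sub_ne_zero.2 hne)
    have h5 := hp |t - θ| (3 * θ) hpos (by linarith) (by linarith)
    have h6 : U (θ - t) = U |t - θ| := by
      rcases abs_choice (t - θ) with h | h <;> rw [h]
      · rw [← hU.2.1]; congr 1; ring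
      · congr 1; ring
    rw [h6]
    have h7 : (3 * θ / |t - θ|) ^ δ * (|t - θ| / (3 * θ)) ^ δ = 1 := by
      rw [← Real.mul_rpow (by positivity) (by positivity)]
      rw [show 3 * θ / |t - θ| * (|t - θ| / (3 * θ)) = 1 by field_simp, Real.one_rpow]
    calc U (3 * θ) * (|t - θ| / (3 * θ)) ^ δ
        ≤ (U |t - θ| * (3 * θ / |t - θ|) ^ δ) * (|t - θ| / (3 * θ)) ^ δ := by gcongr
      _ = U |t - θ| * ((3 * θ / |t - θ|) ^ δ * (|t - θ| / (3 * θ)) ^ δ) := by ring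
      _ = _ := by rw [h7, mul_one]
  have h8 : U (θ + t) - U (θ - t) ≤ 3 * U θ * (1 - (|t - θ| / (3 * θ)) ^ δ) := by
    nlinarith
  have ht' : 0 < t := by linarith
  have hQ := Qk_le hr0 hr ht' (by linarith)
  have hQ0 := Qk_nonneg hr0 hr ht'.le (by linarith : t ≤ Real.pi)
  have hQ2 : Qk r t ≤ 10 / θ := hQ.trans (by rw [div_le_div_iff₀ ht' hθ0]; linarith)
  calc (U (θ + t) - U (θ - t)) * Qk r t
      ≤ (3 * U θ * (1 - (|t - θ| / (3 * θ)) ^ δ)) * (10 / θ) := by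
        refine mul_le_mul h8 hQ2 hQ0 ?_
        exact mul_nonneg (by have := hUn θ; positivity) (by linarith)
    _ = _ := by ring

lemma vc (hU : ClassU U) (hδ0 : 0 < δ) (hδ : δ ≤ 1 / 2) (hT : T ≤ 1)
    (hp : ∀ s t, 0 < s → s ≤ t → t ≤ T → U t ≤ U s * (t / s) ^ δ)
    (hθ0 : 0 < θ) (hθ : θ ≤ T / 4) {r t : ℝ} (hr0 : 0 ≤ r) (hr : r < 1)
    (ht0 : 2 * θ ≤ t) (ht : t ≤ T / 2) :
    (U (θ + t) - U (θ - t)) * Qk r t ≤ 20 * δ * U θ * θ ^ (1 / 2 : ℝ) * t ^ (-3 / 2 : ℝ) := by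
  have hpi := Real.pi_gt_three
  have hUn := U_nonneg hU
  have ht' : 0 < t := by linarith
  have h0 : U (θ - t) = U (t - θ) := by rw [← hU.2.1]; congr 1; ring
  have h1 := hp (t - θ) (θ + t) (by linarith) (by linarith) (by linarith)
  have h2 : (θ + t) / (t - θ) = 1 + 2 * θ / (t - θ) := by
    have : t - θ ≠ 0 := by linarith
    field_simp; ring
  have h3 : 2 * θ / (t - θ) ≤ 4 * θ / t := by
    rw [div_le_div_iff₀ (by linarith) ht']; nlinarith
  have h3' : 0 ≤ 2 * θ / (t - θ) := div_nonneg (by linarith) (by linarith)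
  rw [h2] at h1
  have h4 := bern hδ0.le (by linarith) h3'
  have hg : U (t - θ) ≤ U θ * (t / θ) ^ (1 / 2 : ℝ) := by
    refine (hp θ (t - θ) hθ0 (by linarith) (by linarith)).trans ?_
    refine mul_le_mul_of_nonneg_left ?_ (hUn _)
    have h1' : 1 ≤ (t - θ) / θ := by rw [le_div_iff₀ hθ0]; linarith
    calc ((t - θ) / θ) ^ δ ≤ ((t - θ) / θ) ^ (1 / 2 : ℝ) :=
          Real.rpow_le_rpow_of_exponent_le h1' hδ
      _ ≤ _ := Real.rpow_le_rpow (by linarith) (by gcongr; linarith) (by norm_num)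
  have h5 : U (θ + t) - U (θ - t) ≤ (U θ * (t / θ) ^ (1 / 2 : ℝ)) * (δ * (4 * θ / t)) := by
    have h6 : U (θ + t) ≤ U (t - θ) * (1 + δ * (2 * θ / (t - θ))) :=
      h1.trans (mul_le_mul_of_nonneg_left h4 (hUn _))
    rw [h0]
    calc U (θ + t) - U (t - θ) ≤ U (t - θ) * (δ * (2 * θ / (t - θ))) := by linarith
      _ ≤ _ := by
        refine mul_le_mul hg (by gcongr) (by positivity) ?_
        have := hUn θ
        positivity
  have hQ := Qk_le hr0 hr ht' (by linarith)
  have hQ0 := Qk_nonneg hr0 hr ht'.le (by linarith : t ≤ Real.pi)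
  have e1 : (t / θ) ^ (1 / 2 : ℝ) = t ^ (1 / 2 : ℝ) / θ ^ (1 / 2 : ℝ) :=
    Real.div_rpow ht'.le hθ0.le _
  have e2 : t ^ (-3 / 2 : ℝ) = t ^ (1 / 2 : ℝ) / t ^ 2 := by
    rw [show (-3 / 2 : ℝ) = 1 / 2 - (2 : ℕ) by norm_num, Real.rpow_sub ht', Real.rpow_natCast]
  have e3 : θ ^ (1 / 2 : ℝ) * θ ^ (1 / 2 : ℝ) = θ := by
    rw [← Real.rpow_add hθ0]; norm_num
  have e4 : 0 < θ ^ (1 / 2 : ℝ) := Real.rpow_pos_of_pos hθ0 _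
  calc (U (θ + t) - U (θ - t)) * Qk r t
      ≤ ((U θ * (t / θ) ^ (1 / 2 : ℝ)) * (δ * (4 * θ / t))) * (5 / t) := by
        refine mul_le_mul h5 hQ hQ0 ?_
        have := hUn θ
        positivity
    _ = _ := by
        rw [e1, e2]
        set a := θ ^ (1 / 2 : ℝ)
        set b := t ^ (1 / 2 : ℝ)
        rw [← e3]
        field_simp; norm_num; try ring

lemma vb_int (hδ0 : 0 < δ) (hθ0 : 0 < θ) :
    ∫ t in (0 : ℝ)..(2 * θ), (1 - (|t - θ| / (3 * θ)) ^ δ) ≤ 6 * δ * θ := by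
  have hcont : Continuous fun t : ℝ => (|t - θ| / (3 * θ)) ^ δ := by
    refine Continuous.rpow_const (by fun_prop) (fun _ => Or.inr hδ0.le)
  rw [intervalIntegral.integral_sub (by simp) (hcont.intervalIntegrable _ _)]
  rw [intervalIntegral.integral_comp_sub_right (fun s => (|s| / (3 * θ)) ^ δ) θ]
  rw [show 0 - θ = -θ by ring, show 2 * θ - θ = θ by ring]
  have hcont' : Continuous fun t : ℝ => (|t| / (3 * θ)) ^ δ := by
    refine Continuous.rpow_const (by fun_prop) (fun _ => Or.inr hδ0.le)
  have hpos : ∫ s in (0 : ℝ)..θ, (|s| / (3 * θ)) ^ δ = θ * (3 ^ (-δ) / (1 + δ)) := by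
    have : ∫ s in (0 : ℝ)..θ, (|s| / (3 * θ)) ^ δ = ∫ s in (0 : ℝ)..θ, s ^ δ * ((3 * θ) ^ δ)⁻¹ := by
      refine intervalIntegral.integral_congr ?_
      intro s hs
      rw [uIcc_of_le hθ0.le] at hs
      simp only
      rw [abs_of_nonneg hs.1, Real.div_rpow hs.1 (by positivity), div_eq_mul_inv]
    rw [this, intervalIntegral.integral_mul_const, integral_rpow (Or.inl (by linarith))]
    rw [Real.zero_rpow (by linarith), sub_zero, Real.mul_rpow (by norm_num) hθ0.le,
      Real.rpow_add hθ0, Real.rpow_one, Real.rpow_neg (by norm_num)]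
    have := Real.rpow_pos_of_pos hθ0 δ
    have h3 := Real.rpow_pos_of_pos (by norm_num : (0:ℝ) < 3) δ
    field_simp; ring
  rw [← intervalIntegral.integral_add_adjacent_intervals (b := 0)
    (hcont'.intervalIntegrable _ _) (hcont'.intervalIntegrable _ _)]
  have h3 := intervalIntegral.integral_comp_neg (a := 0) (b := θ) (fun s => (|s| / (3 * θ)) ^ δ)
  simp only [abs_neg, neg_zero] at h3
  rw [← h3, hpos]
  simp only [intervalIntegral.integral_const, smul_eq_mul, sub_zero, mul_one]
  have h4 : 1 - 3 * δ ≤ 3 ^ (-δ) / (1 + δ) := by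
    rw [le_div_iff₀ (by linarith)]
    have h5 : 1 - 2 * δ ≤ (3 : ℝ) ^ (-δ) := by
      rw [Real.rpow_def_of_pos (by norm_num)]
      have := Real.add_one_le_exp (Real.log 3 * -δ)
      have h6 := Real.log_le_sub_one_of_pos (by norm_num : (0:ℝ) < 3)
      nlinarith
    nlinarith
  nlinarith

lemma vc_int (hθ0 : 0 < θ) (hθ : 2 * θ ≤ T) :
    θ ^ (1 / 2 : ℝ) * ∫ t in (2 * θ)..T, t ^ (-3 / 2 : ℝ) ≤ 2 := by
  have h0 : (0:ℝ) ∉ uIcc (2 * θ) T := by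
    rw [uIcc_of_le hθ]; intro h; linarith [h.1]
  rw [integral_rpow (Or.inr ⟨by norm_num, h0⟩)]
  have e : (-3 / 2 + 1 : ℝ) = -(1 / 2) := by norm_num
  rw [e]
  have h1 : 0 ≤ T ^ (-(1 / 2) : ℝ) := Real.rpow_nonneg (by linarith) _
  have h2 : θ ^ (1 / 2 : ℝ) * (2 * θ) ^ (-(1 / 2) : ℝ) ≤ 1 := by
    rw [Real.rpow_neg (by positivity), ← div_eq_mul_inv, div_le_one (by positivity)]
    exact Real.rpow_le_rpow hθ0.le (by linarith) (by norm_num)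
  have h3 : 0 ≤ θ ^ (1 / 2 : ℝ) := Real.rpow_nonneg hθ0.le _
  calc θ ^ (1 / 2 : ℝ) * ((T ^ (-(1 / 2) : ℝ) - (2 * θ) ^ (-(1 / 2) : ℝ)) / -(1 / 2))
      = 2 * (θ ^ (1 / 2 : ℝ) * (2 * θ) ^ (-(1 / 2) : ℝ)) - 2 * (θ ^ (1 / 2 : ℝ) * T ^ (-(1 / 2) : ℝ)) := by
        ring
    _ ≤ 2 := by nlinarith [mul_nonneg h3 h1]

lemma vd_int (hU : ClassU U) (hθ0 : 0 < θ) (a b : ℝ) :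
    ∫ t in a..b, (U (θ + t) - U (θ - t)) ≤ 2 * θ * U Real.pi := by
  have hc := hU.1
  have h0 : ∀ t, U (θ - t) = U (t - θ) := fun t => by rw [← hU.2.1]; congr 1; ring
  simp_rw [h0]
  rw [intervalIntegral.integral_sub ((by fun_prop : Continuous _).intervalIntegrable _ _)
    ((by fun_prop : Continuous _).intervalIntegrable _ _)]
  rw [intervalIntegral.integral_comp_add_left U θ, intervalIntegral.integral_comp_sub_right U θ]
  have hi : ∀ x y, IntervalIntegrable U volume x y := fun x y => hc.intervalIntegrable x y
  have e1 := intervalIntegral.integral_add_adjacent_intervals (hi (a - θ) (θ + a)) (hi (θ + a) (θ + b))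
  have e2 := intervalIntegral.integral_add_adjacent_intervals (hi (a - θ) (b - θ)) (hi (b - θ) (θ + b))
  have e3 : 0 ≤ ∫ t in (a - θ)..(θ + a), U t :=
    intervalIntegral.integral_nonneg (by linarith) (fun t _ => U_nonneg hU t)
  have e4 : ∫ t in (b - θ)..(θ + b), U t ≤ ∫ t in (b - θ)..(θ + b), U Real.pi :=
    intervalIntegral.integral_mono_on (by linarith) (hi _ _) (by simp) (fun t _ => U_le_pi hU t)
  rw [intervalIntegral.integral_const, smul_eq_mul, show θ + b - (b - θ) = 2 * θ by ring] at e4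
  linarith

lemma v_main (hU : ClassU U) (hδ0 : 0 < δ) (hδ : δ ≤ 1 / 2) (hT0 : 0 < T) (hT : T ≤ 1)
    (hp : ∀ s t, 0 < s → s ≤ t → t ≤ T → U t ≤ U s * (t / s) ^ δ)
    (hθ0 : 0 < θ) (hθ : θ ≤ T / 4) {r : ℝ} (hr0 : 0 ≤ r) (hr : r < 1) :
    |conjP U r θ| ≤ (2 * Real.pi)⁻¹ * (230 * δ * U θ + 20 * θ * U Real.pi / T) := by
  have hpi := Real.pi_gt_three
  have hUn := U_nonneg hU
  have hc := hU.1
  have hQc := Qk_cont hr0 hr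
  set f : ℝ → ℝ := fun t => (U (θ + t) - U (θ - t)) * Qk r t with hf
  have hfc : Continuous f := by simp only [hf]; fun_prop
  have hi : ∀ x y, IntervalIntegrable f volume x y := fun x y => hfc.intervalIntegrable x y
  have hv : conjP U r θ = -((2 * Real.pi)⁻¹ * ∫ t in (0 : ℝ)..Real.pi, f t) := by
    rw [conjP_fold hU.1 hU.2.2.1 hr0 hr, ← mul_neg, ← intervalIntegral.integral_neg]
    congr 2; ext t; simp only [hf]; ring
  have hnn : 0 ≤ ∫ t in (0 : ℝ)..Real.pi, f t :=
    intervalIntegral.integral_nonneg (by linarith) (fun t ht =>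
      mul_nonneg (sub_nonneg.2 (U_diff_nonneg hU hθ0.le (by linarith) ht.1 ht.2))
        (Qk_nonneg hr0 hr ht.1 ht.2))
  rw [hv, abs_neg, abs_of_nonneg (mul_nonneg (by positivity) hnn)]
  refine mul_le_mul_of_nonneg_left ?_ (by positivity)
  rw [← intervalIntegral.integral_add_adjacent_intervals (hi 0 (T / 2)) (hi (T / 2) Real.pi),
    ← intervalIntegral.integral_add_adjacent_intervals (hi 0 (2 * θ)) (hi (2 * θ) (T / 2)),
    ← intervalIntegral.integral_add_adjacent_intervals (hi 0 (θ / 2)) (hi (θ / 2) (2 * θ))]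
  have Ia : ∫ t in (0 : ℝ)..(θ / 2), f t ≤ 10 * δ * U θ := by
    have : ∫ t in (0 : ℝ)..(θ / 2), f t ≤ ∫ t in (0 : ℝ)..(θ / 2), 20 * δ * U θ / θ :=
      intervalIntegral.integral_mono_on (by linarith) (hi _ _) (by simp) (fun t ht =>
        va hU hδ0 hδ hT hp hθ0 hθ hr0 hr ht.1 ht.2)
    rw [intervalIntegral.integral_const, smul_eq_mul] at this
    refine this.trans (le_of_eq ?_)
    field_simp; ring
  have Ib : ∫ t in (θ / 2)..(2 * θ), f t ≤ 180 * δ * U θ := by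
    have hcont : Continuous fun t : ℝ => (1 - (|t - θ| / (3 * θ)) ^ δ) := by
      refine continuous_const.sub (Continuous.rpow_const (by fun_prop) (fun _ => Or.inr hδ0.le))
    have h1 : ∫ t in (θ / 2)..(2 * θ), f t ≤
        ∫ t in (θ / 2)..(2 * θ), 30 * U θ / θ * (1 - (|t - θ| / (3 * θ)) ^ δ) :=
      intervalIntegral.integral_mono_on (by linarith) (hi _ _)
        ((continuous_const.mul hcont).intervalIntegrable _ _) (fun t ht =>
        vb hU hδ0 hδ hT hp hθ0 hθ hr0 hr ht.1 ht.2)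
    rw [intervalIntegral.integral_const_mul] at h1
    have h2 := vb_int hδ0 hθ0 
    rw [← intervalIntegral.integral_add_adjacent_intervals (hcont.intervalIntegrable 0 (θ / 2))
      (hcont.intervalIntegrable (θ / 2) (2 * θ))] at h2
    have h3 : 0 ≤ ∫ t in (0 : ℝ)..(θ / 2), (1 - (|t - θ| / (3 * θ)) ^ δ) := by
      refine intervalIntegral.integral_nonneg (by linarith) (fun t ht => ?_)
      have habs : |t - θ| ≤ θ := abs_le.2 ⟨by linarith [ht.1], by linarith [ht.2]⟩
      have := Real.rpow_le_one (by positivity : 0 ≤ |t - θ| / (3 * θ))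
        (by rw [div_le_one (by positivity)]; linarith) hδ0.le
      linarith
    have h4 : 0 ≤ 30 * U θ / θ := by have := hUn θ; positivity
    calc _ ≤ _ := h1
      _ ≤ 30 * U θ / θ * (6 * δ * θ) := mul_le_mul_of_nonneg_left (by linarith) h4
      _ = _ := by field_simp; ring
  have Ic : ∫ t in (2 * θ)..(T / 2), f t ≤ 40 * δ * U θ := by
    have h0 : (0:ℝ) ∉ uIcc (2 * θ) (T / 2) := by
      rw [uIcc_of_le (by linarith)]; intro h; linarith [h.1]
    have h1 : ∫ t in (2 * θ)..(T / 2), f t ≤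
        ∫ t in (2 * θ)..(T / 2), 20 * δ * U θ * θ ^ (1 / 2 : ℝ) * t ^ (-3 / 2 : ℝ) :=
      intervalIntegral.integral_mono_on (by linarith) (hi _ _)
        ((intervalIntegral.intervalIntegrable_rpow (Or.inr h0)).const_mul _) (fun t ht =>
        vc hU hδ0 hδ hT hp hθ0 hθ hr0 hr ht.1 ht.2)
    rw [intervalIntegral.integral_const_mul] at h1
    have h2 := vc_int hθ0 (by linarith : 2 * θ ≤ T / 2)
    have h4 : 0 ≤ 20 * δ * U θ := by have := hUn θ; positivity
    calc _ ≤ _ := h1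
      _ = 20 * δ * U θ * (θ ^ (1 / 2 : ℝ) * ∫ t in (2 * θ)..(T / 2), t ^ (-3 / 2 : ℝ)) := by ring
      _ ≤ 20 * δ * U θ * 2 := mul_le_mul_of_nonneg_left h2 h4
      _ = _ := by ring
  have Id : ∫ t in (T / 2)..Real.pi, f t ≤ 20 * θ * U Real.pi / T := by
    have h1 : ∫ t in (T / 2)..Real.pi, f t ≤
        ∫ t in (T / 2)..Real.pi, 10 / T * (U (θ + t) - U (θ - t)) := by
      refine intervalIntegral.integral_mono_on (by linarith) (hi _ _)
        ((by fun_prop : Continuous _).intervalIntegrable _ _) (fun t ht => ?_)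
      have ht' : 0 < t := by linarith [ht.1]
      have hQ := Qk_le hr0 hr ht' ht.2
      have hQ2 : Qk r t ≤ 10 / T :=
        hQ.trans (by rw [div_le_div_iff₀ ht' hT0]; linarith [ht.1])
      have := mul_le_mul_of_nonneg_left hQ2
        (sub_nonneg.2 (U_diff_nonneg hU hθ0.le (by linarith) ht'.le ht.2))
      simp only [hf]; linarith
    rw [intervalIntegral.integral_const_mul] at h1
    have h2 := vd_int hU hθ0 (T / 2) Real.pi
    calc _ ≤ _ := h1
      _ ≤ 10 / T * (2 * θ * U Real.pi) := mul_le_mul_of_nonneg_left h2 (by positivity)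
      _ = _ := by ring
  linarith
end

lemma v_bound {U : ℝ → ℝ} (hU : ClassU U) {x₁ : ℝ}
    (hη_diff : ∀ x : ℝ, x₁ ≤ x → DifferentiableAt ℝ (etaU U) x)
    (hη : Tendsto (fun x : ℝ => x * deriv (etaU U) x / etaU U x) atTop (nhds 0))
    {ε : ℝ} (hε : 0 < ε) :
    ∃ θ0, 0 < θ0 ∧ θ0 ≤ 1 ∧ ∀ r θ, 0 ≤ r → r < 1 → |θ| ≤ θ0 →
      |conjP U r θ| ≤ ε * poisson U r θ := by
  have hpi := Real.pi_gt_three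
  obtain ⟨c, hc0, hcU⟩ := U_ge_sqrt hU hη_diff hη
  set δ := min (1 / 2) (ε / 460) with hδd
  have hδ0 : 0 < δ := lt_min (by norm_num) (by positivity)
  have hδ1 : δ ≤ 1 / 2 := min_le_left _ _
  have hδ2 : δ ≤ ε / 460 := min_le_right _ _
  obtain ⟨T, hT0, hT1, hp⟩ := U_potter hU hη_diff hη hδ0
  have hUpi := U_pos hU (by linarith : 0 < Real.pi) le_rfl
  set κ := ε * c * T / (40 * U Real.pi) with hκ
  have hκ0 : 0 < κ := by positivity
  refine ⟨min (T / 4) (κ ^ 2), lt_min (by linarith) (by positivity),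
    (min_le_left _ _).trans (by linarith), ?_⟩
  intro r θ hr0 hr hθ
  wlog h : 0 ≤ θ generalizing θ with H
  · rw [← poisson_neg hU hr0 hr, ← abs_neg (conjP U r θ), ← conjP_neg hU hr0 hr]
    exact H (-θ) (by rwa [abs_neg]) (by linarith)
  rw [abs_of_nonneg h] at hθ
  rcases h.eq_or_lt with rfl | hθ0
  · rw [conjP_zero hU hr0 hr, abs_zero]
    have := u_lower hU hr0 hr (θ := 0) (by simp; linarith)
    have h2 := U_nonneg hU (min |0| (Real.pi / 2))
    exact mul_nonneg hε.le (by linarith)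
  have h1 := v_main hU hδ0 hδ1 hT0 hT1 hp hθ0 (hθ.trans (min_le_left _ _)) hr0 hr
  have hθT : θ ≤ T / 4 := hθ.trans (min_le_left _ _)
  have h2 := u_lower hU hr0 hr (θ := θ) (by rw [abs_of_pos hθ0]; linarith)
  rw [abs_of_pos hθ0, min_eq_left (by linarith)] at h2
  have hs : Real.sqrt θ ≤ κ := by
    rw [Real.sqrt_le_left hκ0.le]; exact hθ.trans (min_le_right _ _)
  have h3 := hcU θ hθ0.le (by linarith)
  have hUθ := U_nonneg hU θ
  have h4 : 20 * θ * U Real.pi / T ≤ ε / 2 * U θ := by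
    have h5 : θ = Real.sqrt θ * Real.sqrt θ := (Real.mul_self_sqrt hθ0.le).symm
    have h6 : θ ≤ κ * (U θ / c) := by
      rw [h5]
      refine mul_le_mul hs ?_ (Real.sqrt_nonneg _) hκ0.le
      rw [← h5, le_div_iff₀ hc0]; linarith
    calc 20 * θ * U Real.pi / T ≤ 20 * (κ * (U θ / c)) * U Real.pi / T := by gcongr
      _ = _ := by rw [hκ]; field_simp; norm_num; try ring
  have h7 : 230 * δ * U θ ≤ ε / 2 * U θ := by
    refine mul_le_mul_of_nonneg_right (by linarith) hUθ
  have h8 : (2 * Real.pi)⁻¹ ≤ 1 / 4 := by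
    rw [inv_le_comm₀ (by positivity) (by norm_num)]; linarith
  calc |conjP U r θ| ≤ (2 * Real.pi)⁻¹ * (ε * U θ) :=
        h1.trans (mul_le_mul_of_nonneg_left (by linarith) (by positivity))
    _ ≤ 1 / 4 * (ε * U θ) := mul_le_mul_of_nonneg_right h8 (by positivity)
    _ = ε * (1 / 4 * U θ) := by ring
    _ ≤ _ := by gcongr

end QS

namespace QS

lemma odd_sum : HasSum (fun k : ℕ => 1 / (2 * (k : ℝ) + 1) ^ 2) (Real.pi ^ 2 / 8) := by
  have h := hasSum_zeta_two
  have he : HasSum (fun k : ℕ => 1 / ((2 * k : ℕ) : ℝ) ^ 2) (Real.pi ^ 2 / 6 / 4) := by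
    have e : (fun k : ℕ => 1 / ((2 * k : ℕ) : ℝ) ^ 2) = fun k : ℕ => 1 / (k : ℝ) ^ 2 / 4 := by
      ext k; push_cast; ring
    rw [e]; exact h.div_const 4
  have hs : Summable (fun k : ℕ => 1 / ((2 * k + 1 : ℕ) : ℝ) ^ 2) :=
    h.summable.comp_injective (i := fun k => 2 * k + 1) (fun a b hab => by simpa using hab)
  have h2 := HasSum.even_add_odd (f := fun n : ℕ => 1 / (n : ℝ) ^ 2) he hs.hasSum
  have h3 := h2.unique h
  have h4 : (∑' k : ℕ, 1 / ((2 * k + 1 : ℕ) : ℝ) ^ 2) = Real.pi ^ 2 / 8 := by linarith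
  have h5 := hs.hasSum
  rw [h4] at h5
  convert h5 using 1
  ext k; push_cast; ring

lemma tanh_eq' (x : ℝ) : Real.tanh (x / 2) = (1 - Real.exp (-x)) / (1 + Real.exp (-x)) := by
  rw [Real.tanh_eq_sinh_div_cosh, Real.sinh_eq, Real.cosh_eq]
  have h1 : Real.exp (-x) = Real.exp (-(x / 2)) * Real.exp (-(x / 2)) := by
    rw [← Real.exp_add]; congr 1; ring
  have h2 : Real.exp (x / 2) * Real.exp (-(x / 2)) = 1 := by rw [← Real.exp_add]; simp
  have := Real.exp_pos (x / 2)
  have h3 := Real.exp_pos (-(x / 2))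
  rw [h1]
  rw [div_eq_div_iff (by positivity) (by positivity)]
  linear_combination (Real.exp (-(x/2))) * h2

lemma tanh_pos' {x : ℝ} (hx : 0 < x) : 0 < Real.tanh (x / 2) := by
  rw [tanh_eq']
  have : Real.exp (-x) < 1 := Real.exp_lt_one_iff.2 (by linarith)
  exact div_pos (by linarith) (by positivity)

lemma log_tanh {x : ℝ} (hx : 0 < x) :
    HasSum (fun k : ℕ => 2 / (2 * (k : ℝ) + 1) * Real.exp (-((2 * k + 1) * x)))
      (-Real.log (Real.tanh (x / 2))) := by
  have h1 : Real.exp (-x) < 1 := Real.exp_lt_one_iff.2 (by linarith)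
  have h0 := Real.exp_pos (-x)
  have h := Real.hasSum_log_sub_log_of_abs_lt_one (x := Real.exp (-x)) (by rwa [abs_of_pos h0])
  rw [tanh_eq', Real.log_div (by linarith) (by linarith), neg_sub]
  convert h using 1
  ext k
  rw [← Real.exp_nat_mul]
  push_cast
  rw [show (2 * (k:ℝ) + 1) * -x = -((2 * k + 1) * x) by ring]
  ring

lemma geo_le {a : ℝ} (ha : 0 < a) (M : ℕ) :
    ∑ m ∈ Finset.range M, Real.exp (-(((m : ℝ) + 1) * a)) ≤ 1 / a := by
  have hq : Real.exp (-a) < 1 := Real.exp_lt_one_iff.2 (by linarith)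
  have hq0 := Real.exp_pos (-a)
  have h1 : ∀ m : ℕ, Real.exp (-(((m : ℝ) + 1) * a)) = Real.exp (-a) * Real.exp (-a) ^ m := by
    intro m
    rw [← Real.exp_nat_mul, ← Real.exp_add]; congr 1; ring
  simp_rw [h1]
  rw [← Finset.mul_sum, geom_sum_eq hq.ne]
  have h2 : (Real.exp (-a) ^ M - 1) / (Real.exp (-a) - 1) ≤ 1 / (1 - Real.exp (-a)) := by
    rw [← neg_div_neg_eq, neg_sub, neg_sub]
    gcongr
    have := pow_pos hq0 M; linarith
  have h3 : Real.exp (-a) * Real.exp a = 1 := by rw [← Real.exp_add]; simp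
  have h4 := Real.add_one_le_exp a
  calc _ ≤ Real.exp (-a) * (1 / (1 - Real.exp (-a))) := by gcongr
    _ = Real.exp (-a) / (1 - Real.exp (-a)) := by ring
    _ ≤ 1 / a := by
      rw [div_le_div_iff₀ (by linarith) ha]
      nlinarith

lemma E1 {d : ℝ} (hd : 0 < d) (M : ℕ) :
    Real.exp (-(Real.pi ^ 2 / (8 * d))) ≤
      ∏ m ∈ Finset.range M, Real.tanh (((m : ℝ) + 1) * d) := by
  have hx : ∀ m : ℕ, 0 < 2 * (((m : ℝ) + 1) * d) := fun m => by positivity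
  have htp : ∀ m : ℕ, 0 < Real.tanh (((m : ℝ) + 1) * d) := fun m => by
    have := tanh_pos' (hx m)
    rwa [mul_div_cancel_left₀ _ (by norm_num : (2:ℝ) ≠ 0)] at this
  have hsum := hasSum_sum (s := Finset.range M) (fun m _ => log_tanh (hx m))
  have hle : ∑ m ∈ Finset.range M, -Real.log (Real.tanh (2 * (((m : ℝ) + 1) * d) / 2)) ≤
      Real.pi ^ 2 / 8 * (1 / d) := by
    refine hasSum_le ?_ hsum (odd_sum.mul_right (1 / d))
    intro k
    rw [← Finset.mul_sum]
    have hg := geo_le (a := 2 * (2 * (k:ℝ) + 1) * d) (by positivity) M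
    have e : ∀ m : ℕ, Real.exp (-((2 * (k:ℝ) + 1) * (2 * (((m : ℝ) + 1) * d)))) =
        Real.exp (-(((m : ℝ) + 1) * (2 * (2 * (k:ℝ) + 1) * d))) := fun m => by congr 1; ring
    simp_rw [e]
    calc _ ≤ 2 / (2 * (k:ℝ) + 1) * (1 / (2 * (2 * (k:ℝ) + 1) * d)) := by gcongr
      _ = _ := by field_simp
  have hprod : ∏ m ∈ Finset.range M, Real.tanh (((m : ℝ) + 1) * d) =
      Real.exp (-∑ m ∈ Finset.range M, -Real.log (Real.tanh (2 * (((m : ℝ) + 1) * d) / 2))) := by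
    rw [Finset.sum_neg_distrib, neg_neg, Real.exp_sum]
    refine Finset.prod_congr rfl (fun m _ => ?_)
    rw [mul_div_cancel_left₀ _ (by norm_num : (2:ℝ) ≠ 0), Real.exp_log (htp m)]
  rw [hprod, Real.exp_le_exp, neg_le_neg_iff]
  refine hle.trans (le_of_eq ?_)
  field_simp

lemma E1' {d : ℝ} (hd : 0 < d) (n : ℕ) (j : Fin n) :
    Real.exp (-(Real.pi ^ 2 / (4 * d))) ≤
      ∏ i ∈ Finset.univ.erase j, |Real.tanh (((i : ℕ) : ℝ) * d - ((j : ℕ) : ℝ) * d)| := by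
  set h : ℕ → ℝ := fun i => if i = (j : ℕ) then 1 else |Real.tanh ((i : ℝ) * d - ((j : ℕ) : ℝ) * d)| with hh
  have hE : ∏ i ∈ Finset.univ.erase j, |Real.tanh (((i : ℕ) : ℝ) * d - ((j : ℕ) : ℝ) * d)| =
      ∏ i ∈ Finset.range n, h i := by
    rw [← Fin.prod_univ_eq_prod_range h n, ← Finset.prod_erase Finset.univ (a := j) (by simp [hh])]
    refine Finset.prod_congr rfl (fun i hi => ?_)
    have : (i : ℕ) ≠ j := fun e => (Finset.mem_erase.1 hi).1 (Fin.ext e)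
    simp [hh, this]
  have htp : ∀ m : ℕ, 0 < Real.tanh (((m : ℝ) + 1) * d) := fun m => by
    have := tanh_pos' (by positivity : 0 < 2 * (((m : ℝ) + 1) * d))
    rwa [mul_div_cancel_left₀ _ (by norm_num : (2:ℝ) ≠ 0)] at this
  have hn : n = (j + 1) + (n - j - 1) := by omega
  rw [hE, hn, Finset.prod_range_add, Finset.prod_range_succ]
  have h1 : h j = 1 := by simp [hh]
  have h2 : ∏ x ∈ Finset.range (n - j - 1), h (j + 1 + x) =
      ∏ m ∈ Finset.range (n - j - 1), Real.tanh (((m : ℝ) + 1) * d) := by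
    refine Finset.prod_congr rfl (fun m _ => ?_)
    have : (j : ℕ) + 1 + m ≠ j := by omega
    simp only [hh, this, if_false]
    rw [show (((j : ℕ) + 1 + m : ℕ) : ℝ) * d - ((j : ℕ) : ℝ) * d = ((m : ℝ) + 1) * d by push_cast; ring,
      abs_of_pos (htp m)]
  have h3 : ∏ x ∈ Finset.range (j : ℕ), h x =
      ∏ m ∈ Finset.range (j : ℕ), Real.tanh (((m : ℝ) + 1) * d) := by
    rw [← Finset.prod_range_reflect]
    refine Finset.prod_congr rfl (fun m hm => ?_)
    have hm := Finset.mem_range.1 hm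
    have : (j : ℕ) - 1 - m ≠ j := by omega
    simp only [hh, this, if_false]
    have hc : (((j : ℕ) - 1 - m : ℕ) : ℝ) = ((j : ℕ) : ℝ) - 1 - m := by
      rw [Nat.cast_sub (by omega), Nat.cast_sub (by omega)]; simp
    rw [hc, show (((j : ℕ) : ℝ) - 1 - m) * d - ((j : ℕ) : ℝ) * d = -(((m : ℝ) + 1) * d) by ring,
      Real.tanh_neg, abs_neg, abs_of_pos (htp m)]
  rw [h1, h2, h3, mul_one]
  calc Real.exp (-(Real.pi ^ 2 / (4 * d)))
      = Real.exp (-(Real.pi ^ 2 / (8 * d))) * Real.exp (-(Real.pi ^ 2 / (8 * d))) := by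
        rw [← Real.exp_add]; congr 1; field_simp; norm_num
    _ ≤ _ := mul_le_mul (E1 hd _) (E1 hd _) (Real.exp_pos _).le
        (Finset.prod_nonneg (fun m _ => (htp m).le))

lemma geo_ge {a : ℝ} (ha : 0 < a) (M : ℕ) :
    (1 - Real.exp (-(M * a))) / a ≤ ∑ m ∈ Finset.range M, Real.exp (-((m : ℝ) * a)) := by
  have hq : Real.exp (-a) < 1 := Real.exp_lt_one_iff.2 (by linarith)
  have h1 : ∀ m : ℕ, Real.exp (-((m : ℝ) * a)) = Real.exp (-a) ^ m := by
    intro m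
    rw [← Real.exp_nat_mul]; congr 1; ring
  simp_rw [h1]
  rw [geom_sum_eq hq.ne, ← neg_div_neg_eq (Real.exp (-a) ^ M - 1), neg_sub, neg_sub]
  have h2 := Real.add_one_le_exp (-a)
  have h3 : Real.exp (-a) ^ M ≤ 1 := pow_le_one₀ (Real.exp_pos _).le hq.le
  gcongr
  · linarith

lemma E2 {ε : ℝ} (hε : 0 < ε) : ∃ a0 Λ : ℝ, 0 < a0 ∧ 0 < Λ ∧ ∀ (d c t0 : ℝ) (M : ℕ),
    0 < d → 0 < c → d + c ≤ a0 → 0 ≤ t0 → t0 ≤ d → Λ ≤ M * d →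
    (Real.pi ^ 2 / 4 - ε) / d ≤
      ∑ m ∈ Finset.range M, -Real.log (Real.tanh ((t0 + m * d + c) / 2)) := by
  have htend := odd_sum.tendsto_sum_nat
  obtain ⟨K, hK⟩ := (htend.eventually (lt_mem_nhds
    (show Real.pi ^ 2 / 8 - ε / 4 < Real.pi ^ 2 / 8 by linarith))).exists
  have hK8 : ∑ k ∈ Finset.range K, 1 / (2 * (k:ℝ) + 1) ^ 2 ≤ Real.pi ^ 2 / 8 :=
    sum_le_hasSum _ (fun k _ => by positivity) odd_sum
  set S := ∑ k ∈ Finset.range K, 1 / (2 * (k:ℝ) + 1) ^ 2 with hS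
  have hS0 : 0 ≤ S := Finset.sum_nonneg (fun k _ => by positivity)
  have hpi2 : Real.pi ^ 2 ≤ 10 := by nlinarith [Real.pi_lt_d2, Real.pi_gt_three]
  have hpi3 : 0 < Real.pi ^ 2 := by positivity
  -- choose μ
  set μ := min (1 / 2) (ε / 20) with hμ
  have hμ0 : 0 < μ := lt_min (by norm_num) (by positivity)
  have hμ1 : μ ≤ 1 / 2 := min_le_left _ _
  have hμ2 : μ ≤ ε / 20 := min_le_right _ _
  refine ⟨μ / (2 * K + 1), -Real.log μ, by positivity, ?_, ?_⟩
  · have := Real.log_neg hμ0 (by linarith); linarith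
  intro d c t0 M hd hc hdc ht0 htd hM
  have hx : ∀ m : ℕ, 0 < t0 + m * d + c := fun m => by positivity
  have hsum := hasSum_sum (s := Finset.range M) (fun m _ => log_tanh (hx m))
  have hfin := sum_le_hasSum (Finset.range K) (fun k _ =>
    Finset.sum_nonneg (fun m _ => by positivity)) hsum
  refine le_trans ?_ hfin
  have hterm : ∀ k ∈ Finset.range K, (2 / d) * ((1 - μ) * (1 - μ)) * (1 / (2 * (k:ℝ) + 1) ^ 2) ≤
      ∑ m ∈ Finset.range M, 2 / (2 * (k : ℝ) + 1) * Real.exp (-((2 * k + 1) * (t0 + m * d + c))) := by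
    intro k hk
    have hkK : (k:ℝ) + 1 ≤ K := by exact_mod_cast Finset.mem_range.1 hk
    have hg := geo_ge (a := (2 * (k:ℝ) + 1) * d) (by positivity) M
    have e : ∀ m : ℕ, 2 / (2 * (k : ℝ) + 1) * Real.exp (-((2 * k + 1) * (t0 + m * d + c))) =
      2 / (2 * (k : ℝ) + 1) * Real.exp (-((2 * k + 1) * (t0 + c))) *
        Real.exp (-((m:ℝ) * ((2 * (k:ℝ) + 1) * d))) := by
      intro m; rw [mul_assoc, ← Real.exp_add]; congr 2; ring
    simp_rw [e]
    rw [← Finset.mul_sum]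
    have h1 : 1 - μ ≤ Real.exp (-((2 * k + 1) * (t0 + c))) := by
      have := Real.add_one_le_exp (-((2 * (k:ℝ) + 1) * (t0 + c)))
      have h2 : (2 * (k:ℝ) + 1) * (t0 + c) ≤ μ := by
        calc (2 * (k:ℝ) + 1) * (t0 + c) ≤ (2 * K + 1) * (μ / (2 * K + 1)) := by
              refine mul_le_mul (by linarith) (by linarith) (by linarith) (by positivity)
          _ = μ := by field_simp
      linarith
    have h2 : 1 - μ ≤ 1 - Real.exp (-(M * ((2 * (k:ℝ) + 1) * d))) := by
      have h3 : Real.exp (-(M * ((2 * (k:ℝ) + 1) * d))) ≤ Real.exp (Real.log μ) := by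
        rw [Real.exp_le_exp]
        have : 0 ≤ (M:ℝ) * d * (2 * k) := by positivity
        nlinarith
      rw [Real.exp_log hμ0] at h3; linarith
    calc (2 / d) * ((1 - μ) * (1 - μ)) * (1 / (2 * (k:ℝ) + 1) ^ 2)
        = 2 / (2 * (k : ℝ) + 1) * (1 - μ) * ((1 - μ) / ((2 * (k:ℝ) + 1) * d)) := by field_simp
      _ ≤ 2 / (2 * (k : ℝ) + 1) * Real.exp (-((2 * k + 1) * (t0 + c))) *
          ((1 - Real.exp (-(M * ((2 * (k:ℝ) + 1) * d)))) / ((2 * (k:ℝ) + 1) * d)) := by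
          have : 0 ≤ 1 - μ := by linarith
          gcongr
      _ ≤ _ := by gcongr
  refine le_trans ?_ (Finset.sum_le_sum hterm)
  rw [← Finset.mul_sum, ← hS, show 2 / d * ((1 - μ) * (1 - μ)) * S = 2 * ((1 - μ) * (1 - μ)) * S / d by ring]
  refine div_le_div_of_nonneg_right ?_ hd.le
  have h1 : μ * S ≤ ε / 20 * (10 / 8) :=
    mul_le_mul hμ2 (by linarith) hS0 (by linarith)
  nlinarith [mul_nonneg (sq_nonneg μ) hS0]

lemma E3 {ε : ℝ} (hε : 0 < ε) : ∃ a0 Λ : ℝ, 0 < a0 ∧ 0 < Λ ∧ ∀ (d c A s : ℝ) (m : ℕ),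
    0 < d → 0 < c → d + c ≤ a0 → A + Λ ≤ s → s ≤ A + m * d - Λ →
    ∏ j : Fin m, Real.tanh ((|s - (A + (j : ℕ) * d)| + c) / 2) ≤
      Real.exp (-(Real.pi ^ 2 / 2 - ε) / d) := by
  obtain ⟨a0, Λ, ha0, hΛ, h⟩ := E2 (ε := ε / 2) (by linarith)
  refine ⟨min a0 1, Λ + 1, lt_min ha0 one_pos, by linarith, ?_⟩
  intro d c A s m hd hc hdc hs1 hs2
  have hda : d + c ≤ a0 := hdc.trans (min_le_left _ _)
  have hd1 : d + c ≤ 1 := hdc.trans (min_le_right _ _)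
  set j0 := ⌊(s - A) / d⌋₊ with hj0
  have hpos : 0 ≤ (s - A) / d := div_nonneg (by linarith) hd.le
  have hf1 : (j0 : ℝ) * d ≤ s - A := by
    rw [← le_div_iff₀ hd]; exact Nat.floor_le hpos
  have hf2 : s - A < ((j0 : ℝ) + 1) * d := by
    rw [← div_lt_iff₀ hd]; exact Nat.lt_floor_add_one _
  have hjm : j0 + 1 ≤ m := by
    have : (j0 : ℝ) < m := by
      by_contra hcon
      push Not at hcon
      nlinarith
    exact_mod_cast this
  have hm : m = (j0 + 1) + (m - j0 - 1) := by omega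
  have hmc : ((m - j0 - 1 : ℕ) : ℝ) = (m : ℝ) - j0 - 1 := by
    rw [Nat.cast_sub (by omega), Nat.cast_sub (by omega)]; simp
  have htp : ∀ j : ℕ, 0 < Real.tanh ((|s - (A + (j : ℕ) * d)| + c) / 2) := fun j =>
    tanh_pos' (by positivity)
  rw [Fin.prod_univ_eq_prod_range (fun j : ℕ => Real.tanh ((|s - (A + (j : ℕ) * d)| + c) / 2)) m]
  have hexp : ∏ j ∈ Finset.range m, Real.tanh ((|s - (A + (j : ℕ) * d)| + c) / 2) =
      Real.exp (-∑ j ∈ Finset.range m, -Real.log (Real.tanh ((|s - (A + (j : ℕ) * d)| + c) / 2))) := by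
    rw [Finset.sum_neg_distrib, neg_neg, Real.exp_sum]
    exact Finset.prod_congr rfl (fun j _ => (Real.exp_log (htp j)).symm)
  rw [hexp, Real.exp_le_exp, neg_div, neg_le_neg_iff]
  rw [hm, Finset.sum_range_add]
  have e1 : ∑ j ∈ Finset.range (j0 + 1), -Real.log (Real.tanh ((|s - (A + (j : ℕ) * d)| + c) / 2)) =
      ∑ i ∈ Finset.range (j0 + 1), -Real.log (Real.tanh (((s - A - j0 * d) + i * d + c) / 2)) := by
    rw [← Finset.sum_range_reflect]
    refine Finset.sum_congr rfl (fun i hi => ?_)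
    have hi := Finset.mem_range.1 hi
    have hc : ((j0 + 1 - 1 - i : ℕ) : ℝ) = (j0 : ℝ) - i := by
      rw [Nat.add_sub_cancel, Nat.cast_sub (by omega)]
    rw [hc]
    have h0 : 0 ≤ (i:ℝ) * d := by positivity
    rw [abs_of_nonneg (by nlinarith)]
    congr 4; ring
  have e2 : ∑ j ∈ Finset.range (m - j0 - 1),
      -Real.log (Real.tanh ((|s - (A + ((j0 + 1 + j : ℕ) : ℝ) * d)| + c) / 2)) =
      ∑ i ∈ Finset.range (m - j0 - 1), -Real.log (Real.tanh (((A + (j0 + 1) * d - s) + i * d + c) / 2)) := by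
    refine Finset.sum_congr rfl (fun i hi => ?_)
    push_cast
    have h0 : 0 ≤ (i:ℝ) * d := by positivity
    rw [abs_of_nonpos (by nlinarith)]
    congr 4; ring
  rw [e1, e2]
  have h1 := h d c (s - A - j0 * d) (j0 + 1) hd hc hda (by linarith) (by linarith)
    (by push_cast; linarith)
  have h2 := h d c (A + (j0 + 1) * d - s) (m - j0 - 1) hd hc hda (by linarith) (by linarith)
    (by rw [hmc]; nlinarith)
  have h3 : (Real.pi ^ 2 / 2 - ε) / d = (Real.pi ^ 2 / 4 - ε / 2) / d + (Real.pi ^ 2 / 4 - ε / 2) / d := by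
    ring
  rw [h3]
  linarith

end QS

namespace QS

lemma y_tendsto {U : ℝ → ℝ} (hU : ClassU U) {ω : ℝ → ℝ} (hω_top : Tendsto ω atTop atTop)
    {x₂ : ℝ} (hωeq : ∀ x : ℝ, x₂ ≤ x → etaU U (x / ω x) = ω x) :
    Tendsto (fun n : ℕ => (n : ℝ) / ω n) atTop atTop :=
  (x_div_omega hU hω_top hωeq).comp tendsto_natCast_atTop_atTop

lemma eta_le_lin {U : ℝ → ℝ} (hU : ClassU U) {x₁ : ℝ}
    (hη_diff : ∀ x : ℝ, x₁ ≤ x → DifferentiableAt ℝ (etaU U) x)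
    (hη : Tendsto (fun x : ℝ => x * deriv (etaU U) x / etaU U x) atTop (nhds 0)) :
    ∀ᶠ y in atTop, etaU U y ≤ y := by
  obtain ⟨c, hc0, hcU⟩ := U_ge_sqrt hU hη_diff hη
  filter_upwards [eventually_ge_atTop 0, eventually_ge_atTop (-2 * Real.log c)] with y hy hy2
  have hpi := Real.pi_gt_three
  have h1 := hcU (Real.exp (-y)) (Real.exp_pos _).le
    ((Real.exp_le_one_iff.2 (by linarith)).trans (by linarith))
  have hs : Real.sqrt (Real.exp (-y)) = Real.exp (-y / 2) := by
    rw [Real.exp_half]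
  rw [hs] at h1
  have h2 := Real.log_le_log (by positivity) h1
  rw [Real.log_mul hc0.ne' (Real.exp_pos _).ne', Real.log_exp] at h2
  unfold etaU
  linarith

lemma n_le_exp {U : ℝ → ℝ} (hU : ClassU U) {x₁ : ℝ}
    (hη_diff : ∀ x : ℝ, x₁ ≤ x → DifferentiableAt ℝ (etaU U) x)
    (hη : Tendsto (fun x : ℝ => x * deriv (etaU U) x / etaU U x) atTop (nhds 0))
    {ω : ℝ → ℝ} (hω_top : Tendsto ω atTop atTop)
    {x₂ : ℝ} (hωeq : ∀ x : ℝ, x₂ ≤ x → etaU U (x / ω x) = ω x) {ε : ℝ} (hε : 0 < ε) :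
    ∀ᶠ n : ℕ in atTop, (n : ℝ) ≤ Real.exp (ε * (n / ω n)) := by
  have hy := y_tendsto hU hω_top hωeq
  have hn : Tendsto (fun n : ℕ => (n : ℝ)) atTop atTop := tendsto_natCast_atTop_atTop
  have h1 : ∀ᶠ y : ℝ in atTop, y ^ 2 ≤ Real.exp (ε * y) := by
    have := (isLittleO_pow_exp_pos_mul_atTop 2 hε).bound (c := 1) one_pos
    filter_upwards [this] with y h
    rw [one_mul, Real.norm_eq_abs, Real.norm_eq_abs, abs_of_nonneg (sq_nonneg y),
      abs_of_pos (Real.exp_pos _)] at h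
    exact h
  filter_upwards [hy.eventually h1, hy.eventually (eta_le_lin hU hη_diff hη),
    hn.eventually (hω_top.eventually_gt_atTop 0), hn.eventually_ge_atTop x₂,
    hy.eventually_ge_atTop 0] with n h1 h2 h3 h4 h5
  rw [hωeq _ h4] at h2
  refine le_trans ?_ h1
  calc (n : ℝ) = (n / ω n) * ω n := by field_simp
    _ ≤ (n / ω n) * (n / ω n) := by gcongr
    _ = _ := by ring

lemma tanh_ge (τ : ℝ) (hτ : 0 ≤ τ) : Real.tanh τ ≤ 1 - Real.exp (-(2 * τ)) := by
  have := tanh_eq' (2 * τ)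
  rw [mul_div_cancel_left₀ _ (by norm_num : (2:ℝ) ≠ 0)] at this
  rw [this]
  have h0 := Real.exp_pos (-(2 * τ))
  have h1 : Real.exp (-(2 * τ)) ≤ 1 := Real.exp_le_one_iff.2 (by linarith)
  rw [div_le_iff₀ (by linarith)]
  nlinarith

lemma tanh_sub' (a b : ℝ) :
    (Real.tanh a - Real.tanh b) / (1 - Real.tanh b * Real.tanh a) = Real.tanh (a - b) := by
  have ha := Real.cosh_pos a
  have hb := Real.cosh_pos b
  have hab := Real.cosh_pos (a - b)
  have h1 : Real.tanh a - Real.tanh b = Real.sinh (a - b) / (Real.cosh a * Real.cosh b) := by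
    rw [Real.tanh_eq_sinh_div_cosh, Real.tanh_eq_sinh_div_cosh, Real.sinh_sub]; field_simp
  have h2 : 1 - Real.tanh b * Real.tanh a = Real.cosh (a - b) / (Real.cosh a * Real.cosh b) := by
    rw [Real.tanh_eq_sinh_div_cosh, Real.tanh_eq_sinh_div_cosh, Real.cosh_sub]; field_simp
  rw [h1, h2, Real.tanh_eq_sinh_div_cosh (a - b)]
  field_simp

lemma bl_real (a b : ℝ) :
    ‖bl (Real.tanh a : ℂ) (Real.tanh b : ℂ)‖ = |Real.tanh (a - b)| := by
  unfold bl
  rw [Complex.conj_ofReal]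
  have : ((Real.tanh b : ℂ) - (Real.tanh a : ℂ)) / (1 - (Real.tanh a : ℂ) * (Real.tanh b : ℂ)) =
      ((Real.tanh (b - a) : ℝ) : ℂ) := by
    rw [← tanh_sub']; push_cast; rfl
  rw [this, Complex.norm_real, Real.norm_eq_abs, ← abs_neg, ← Real.tanh_neg, neg_sub]

lemma tanh_surj {x : ℝ} (h0 : 0 ≤ x) (h1 : x < 1) : ∃ τ, 0 ≤ τ ∧ Real.tanh τ = x := by
  refine ⟨Real.artanh x, Real.artanh_nonneg h0, Real.tanh_artanh ⟨by linarith, h1⟩⟩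

lemma tanh_mono' {a b : ℝ} (hab : a ≤ b) : Real.tanh a ≤ Real.tanh b := by
  have h1 := Real.cosh_pos a
  have h2 := Real.cosh_pos b
  rw [Real.tanh_eq_sinh_div_cosh, Real.tanh_eq_sinh_div_cosh, div_le_div_iff₀ h1 h2]
  have h3 := Real.sinh_sub b a
  have h4 : 0 ≤ Real.sinh (b - a) := Real.sinh_nonneg_iff.2 (by linarith)
  linarith

set_option maxHeartbeats 2000000 in
lemma lower_bound {U : ℝ → ℝ} (hU : ClassU U) {x₁ : ℝ}
    (hη_diff : ∀ x : ℝ, x₁ ≤ x → DifferentiableAt ℝ (etaU U) x)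
    (hη : Tendsto (fun x : ℝ => x * deriv (etaU U) x / etaU U x) atTop (nhds 0))
    {ω : ℝ → ℝ} (hω_top : Tendsto ω atTop atTop)
    {x₂ : ℝ} (hωeq : ∀ x : ℝ, x₂ ≤ x → etaU U (x / ω x) = ω x)
    {F : ℂ → ℂ} (hF : DifferentiableOn ℂ F (Metric.ball 0 1))
    (hFre : ∀ r θ : ℝ, 0 ≤ r → r < 1 →
      (F ((r : ℂ) * Complex.exp (θ * Complex.I))).re = poisson U r θ)
    (hFim : (F 0).im = 0)
    {φ : ℂ → ℂ} (hφ : ∀ z, φ z = Complex.exp (-F z))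
    {T : H2 →L[ℂ] H2}
    (hT : ∀ (a : H2) (z : ℂ), ‖z‖ < 1 → fa (T a) z = fa a (φ z))
    {ε : ℝ} (hε : 0 < ε) :
    ∀ᶠ n : ℕ in atTop, Real.exp (-(Real.pi ^ 2 / 2 + ε) * n / ω n) ≤ approxNum T n := by
  have hpi := Real.pi_gt_three
  have hpi2 : Real.pi ^ 2 ≤ 10 := by nlinarith [Real.pi_lt_d2]
  have hy := y_tendsto hU hω_top hωeq
  have hn : Tendsto (fun n : ℕ => (n : ℝ)) atTop atTop := tendsto_natCast_atTop_atTop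
  -- the symbol on the real axis
  set g : ℝ → ℝ := fun r => Real.exp (-(F r).re) with hg
  have hFr : ∀ r : ℝ, 0 ≤ r → r < 1 → (F r).re = poisson U r 0 := by
    intro r h0 h1
    have := hFre r 0 h0 h1
    simpa using this
  have hφg : ∀ r : ℝ, 0 ≤ r → r < 1 → φ r = (g r : ℂ) := by
    intro r h0 h1
    have h := phi_eq hU F hF hFre hFim h0 h1 0
    rw [conjP_zero hU h0 h1] at h
    simp only [Complex.ofReal_zero, zero_mul, Complex.exp_zero, mul_one, add_zero] at h
    rw [hφ, h, hg]
    simp only [hFr r h0 h1]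
    push_cast; rfl
  have hgc : ∀ b, b < 1 → ContinuousOn g (Icc 0 b) := by
    intro b hb
    have h1 : ContinuousOn (fun r : ℝ => F r) (Icc 0 b) := by
      refine hF.continuousOn.comp (Complex.continuous_ofReal.continuousOn) ?_
      intro r hr
      rw [mem_ball_zero_iff, Complex.norm_real, Real.norm_eq_abs, abs_of_nonneg hr.1]
      linarith [hr.2]
    exact Real.continuous_exp.comp_continuousOn (Complex.continuous_re.comp_continuousOn h1).neg
  have hg0 : g 0 < 1 := by
    have h1 : poisson U 0 0 = poisson U 0 Real.pi := by unfold poisson; simp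
    have h2 := u_lower hU le_rfl one_pos (θ := Real.pi) (by rw [abs_of_pos (by linarith)])
    have h3 : 0 < U (min |Real.pi| (Real.pi / 2)) := by
      refine U_pos hU (lt_min (abs_pos.2 (by linarith)) (by linarith))
        ((min_le_right _ _).trans (by linarith))
    simp only [hg, hFr 0 le_rfl one_pos, h1]
    exact Real.exp_lt_one_iff.2 (by linarith)
  obtain ⟨τ0, hτ0, hτg⟩ : ∃ τ, 0 ≤ τ ∧ Real.tanh τ = g 0 := tanh_surj (Real.exp_pos _).le hg0
  clear_value g
  obtain ⟨C, hC0, hC⟩ := u_axis hU hη_diff hη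
  -- parameters
  set ε1 := min 1 (ε / 45) with hε1
  have hε10 : 0 < ε1 := lt_min one_pos (by positivity)
  have hε11 : ε1 ≤ 1 := min_le_left _ _
  have hε12 : ε1 ≤ ε / 45 := min_le_right _ _
  set σ := min 1 (2 * ε / 9) with hσ
  have hσ0 : 0 < σ := lt_min one_pos (by positivity)
  have hσ1 : σ ≤ 1 := min_le_left _ _
  have hσ2 : σ ≤ 2 * ε / 9 := min_le_right _ _
  have hslow := eta_slow hU hη_diff hη (c := 1 / σ) (by rw [le_div_iff₀ hσ0]; linarith) hε10
  have hyσ : Tendsto (fun n : ℕ => σ * ((n : ℝ) / ω n)) atTop atTop := hy.const_mul_atTop hσ0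
  have hω_n := hω_top.comp hn
  filter_upwards [hyσ.eventually hslow, hyσ.eventually_ge_atTop 1, hn.eventually_ge_atTop x₂,
    n_le_exp hU hη_diff hη hω_top hωeq (ε := ε / 3) (by positivity), eventually_ge_atTop 1,
    hω_n.eventually_ge_atTop (1 + (1 + ε1) ^ 2 / ε1 * (2 * τ0 + |Real.log C|))] with
    n h1 h2 h3 h4 h5 h6
  simp only [Function.comp_apply] at h6
  have hnpos : (0:ℝ) < n := by exact_mod_cast h5
  set y := (n:ℝ) / ω n with hyd
  have e0 : 1 / σ * (σ * y) = y := by field_simp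
  rw [e0, hωeq _ h3] at h1
  have hω0 : 0 < ω n := by
    have : 0 ≤ (1 + ε1) ^ 2 / ε1 * (2 * τ0 + |Real.log C|) := by positivity
    linarith
  -- L'
  set L := etaU U (σ * y) - Real.log C with hL
  have hLω : ω n ≤ (1 + ε1) ^ 2 * (L - 2 * τ0) := by
    have h7 : (1 + ε1) ^ 2 * (2 * τ0 + |Real.log C|) ≤ ε1 * ω n := by
      have : (1 + ε1) ^ 2 / ε1 * (2 * τ0 + |Real.log C|) ≤ ω n := by linarith
      calc (1 + ε1) ^ 2 * (2 * τ0 + |Real.log C|)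
          = ε1 * ((1 + ε1) ^ 2 / ε1 * (2 * τ0 + |Real.log C|)) := by field_simp
        _ ≤ _ := by gcongr
    have h8 : (1 + ε1) * ω n ≤ (1 + ε1) ^ 2 * etaU U (σ * y) := by nlinarith
    have h9 : (1 + ε1) ^ 2 * Real.log C ≤ (1 + ε1) ^ 2 * |Real.log C| := by
      gcongr; exact le_abs_self _
    rw [hL]; nlinarith
  have hLpos : 0 < L - 2 * τ0 := by
    by_contra hcon
    push Not at hcon
    have : (1 + ε1) ^ 2 * (L - 2 * τ0) ≤ 0 := mul_nonpos_of_nonneg_of_nonpos (by positivity) hcon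
    linarith
  -- s and rmax
  set s := Real.exp (-(σ * y)) with hs
  have hs0 : 0 < s := Real.exp_pos _
  have hs12 : s ≤ 1 / 2 := by
    have h7 : s ≤ Real.exp (-1) := Real.exp_le_exp.2 (by linarith)
    have h8 : Real.exp (-1) ≤ 1 / 2 := by
      rw [Real.exp_neg, inv_eq_one_div]
      have := Real.add_one_le_exp (1:ℝ)
      exact one_div_le_one_div_of_le (by norm_num) (by linarith)
    linarith
  have hs3 : s ^ 3 ≤ 1 / 2 := by
    calc s ^ 3 ≤ (1 / 2) ^ 3 := by gcongr
      _ ≤ _ := by norm_num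
  have hs30 : 0 < s ^ 3 := by positivity
  set ρ := 1 - s ^ 3 with hρ
  have hρ0 : 0 ≤ ρ := by linarith
  have hρ1 : ρ < 1 := by linarith
  have huρ : poisson U ρ 0 ≤ Real.exp (-L) := by
    refine (hC s hs0 hs12).trans (le_of_eq ?_)
    rw [U_eq_exp hU hs0 (by linarith), hs, Real.log_exp, neg_neg, hL, neg_sub, Real.exp_sub,
      Real.exp_log hC0, Real.exp_neg]
    rfl
  have hgρ : Real.tanh (L / 2) ≤ g ρ := by
    have h7 := tanh_ge (L / 2) (by linarith)
    rw [mul_div_cancel₀ _ (by norm_num : (2:ℝ) ≠ 0)] at h7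
    have h8 : 1 - poisson U ρ 0 ≤ g ρ := by
      simp only [hg, hFr ρ hρ0 hρ1]
      have := Real.add_one_le_exp (-poisson U ρ 0)
      linarith
    linarith
  set d := (L / 2 - τ0) / n with hd
  have hd0 : 0 < d := div_pos (by linarith) hnpos
  have htanh_mono : ∀ a b : ℝ, a ≤ b → Real.tanh a ≤ Real.tanh b := fun a b hab =>
    tanh_mono' hab
  have hex : ∀ j : Fin n, ∃ r : ℝ, r ∈ Icc 0 ρ ∧ g r = Real.tanh (τ0 + (j : ℕ) * d) := by
    intro j
    have hj : ((j : ℕ) : ℝ) ≤ n := by exact_mod_cast j.2.le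
    have hj0 : 0 ≤ ((j : ℕ) : ℝ) * d := by positivity
    have := intermediate_value_Icc hρ0 (hgc ρ hρ1)
    have hm : Real.tanh (τ0 + (j : ℕ) * d) ∈ Icc (g 0) (g ρ) := by
      constructor
      · rw [show g 0 = Real.tanh τ0 from hτg.symm]; exact htanh_mono _ _ (by linarith)
      · refine le_trans (htanh_mono _ _ ?_) hgρ
        have : ((j : ℕ) : ℝ) * d ≤ n * d := by gcongr
        have h9 : n * d = L / 2 - τ0 := by rw [hd]; field_simp
        linarith
    obtain ⟨r, hr, hr'⟩ := this hm
    exact ⟨r, hr, hr'⟩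
  choose z hz hzg using hex
  have hφz : ∀ j, φ (z j) = (Real.tanh (τ0 + (j : ℕ) * d) : ℂ) := by
    intro j
    rw [hφg _ (hz j).1 (by linarith [(hz j).2]), hzg j]
  have hlow := approx_lower T φ hT n h5 (fun j => (z j : ℂ)) ρ hρ1
    (fun j => by
      rw [Complex.norm_real, Real.norm_eq_abs, abs_of_nonneg (hz j).1]; exact (hz j).2)
    (fun j => by
      rw [hφz j, Complex.norm_real, Real.norm_eq_abs]
      exact Real.abs_tanh_lt_one _)
    (Real.exp (-(Real.pi ^ 2 / (4 * d)))) (fun j => by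
      refine (E1' hd0 n j).trans (le_of_eq ?_)
      refine Finset.prod_congr rfl (fun i _ => ?_)
      rw [hφz i, hφz j, bl_real]
      congr 2; ring)
  refine le_trans ?_ hlow
  have hsq : Real.exp (-(3 * σ / 2 * y)) ≤ Real.sqrt (1 - ρ ^ 2) := by
    refine Real.le_sqrt_of_sq_le ?_
    have h7 : Real.exp (-(3 * σ / 2 * y)) ^ 2 = s ^ 3 := by
      rw [hs, ← Real.exp_nat_mul, ← Real.exp_nat_mul]; congr 1; push_cast; ring
    rw [h7]
    nlinarith
  have hδ : Real.exp (-((Real.pi ^ 2 / 2 + ε / 3) * y)) ≤ Real.exp (-(Real.pi ^ 2 / (4 * d))) := by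
    rw [Real.exp_le_exp, neg_le_neg_iff]
    have h7 : Real.pi ^ 2 / (4 * d) = Real.pi ^ 2 / 2 * (n / (L - 2 * τ0)) := by
      rw [hd]; field_simp; ring
    have h8 : n / (L - 2 * τ0) ≤ (1 + ε1) ^ 2 * y := by
      rw [hyd, mul_div_assoc', div_le_div_iff₀ hLpos hω0]
      nlinarith
    have hy0 : 0 < y := by positivity
    rw [h7]
    calc Real.pi ^ 2 / 2 * (n / (L - 2 * τ0)) ≤ Real.pi ^ 2 / 2 * ((1 + ε1) ^ 2 * y) := by gcongr
      _ = (Real.pi ^ 2 / 2 * (1 + ε1) ^ 2) * y := by ring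
      _ ≤ _ := by
        gcongr
        have k1 : (1 + ε1) ^ 2 ≤ 1 + 3 * ε1 := by nlinarith
        have k2 : Real.pi ^ 2 / 2 * (1 + ε1) ^ 2 ≤ Real.pi ^ 2 / 2 * (1 + 3 * ε1) := by gcongr
        have k3 : Real.pi ^ 2 * ε1 ≤ 10 * ε1 := by gcongr
        linarith
  have hfin : Real.exp (-(Real.pi ^ 2 / 2 + ε) * n / ω n) ≤
      Real.exp (-((Real.pi ^ 2 / 2 + ε / 3) * y)) * Real.exp (-(3 * σ / 2 * y)) *
        Real.exp (-(ε / 3 * y)) := by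
    rw [← Real.exp_add, ← Real.exp_add, Real.exp_le_exp]
    have hy0 : 0 < y := by positivity
    have : -(Real.pi ^ 2 / 2 + ε) * n / ω n = -(Real.pi ^ 2 / 2 + ε) * y := by rw [hyd]; ring
    rw [this]
    nlinarith
  refine hfin.trans ?_
  rw [div_eq_mul_inv]
  refine mul_le_mul (mul_le_mul hδ hsq (Real.exp_pos _).le (Real.exp_pos _).le) ?_
    (Real.exp_pos _).le (by positivity)
  rw [Real.exp_neg]
  exact inv_anti₀ hnpos h4

end QS

namespace QS

lemma tanh_sq_half (x : ℝ) :
    Real.tanh (x / 2) ^ 2 = (Real.cosh x - 1) / (Real.cosh x + 1) := by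
  have h1 : Real.cosh x = Real.cosh (x / 2) ^ 2 + Real.sinh (x / 2) ^ 2 := by
    rw [← Real.cosh_two_mul]; congr 1; ring
  have h2 := Real.cosh_sq (x / 2)
  have h3 := Real.cosh_pos (x / 2)
  rw [Real.tanh_eq_sinh_div_cosh, div_pow, h1]
  rw [show Real.cosh (x / 2) ^ 2 + Real.sinh (x / 2) ^ 2 - 1 = 2 * Real.sinh (x / 2) ^ 2 by linarith,
    show Real.cosh (x / 2) ^ 2 + Real.sinh (x / 2) ^ 2 + 1 = 2 * Real.cosh (x / 2) ^ 2 by linarith]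
  field_simp

lemma norm_w (u v : ℝ) : ‖Complex.exp (-((u : ℂ) + (v : ℂ) * I))‖ = Real.exp (-u) := by
  rw [Complex.norm_exp]; simp

lemma w_re (u v : ℝ) : (Complex.exp (-((u : ℂ) + (v : ℂ) * I))).re = Real.exp (-u) * Real.cos v := by
  rw [Complex.exp_re]; simp

/-- the angle estimate -/
lemma angle (u v c : ℝ) (hu : 0 < u) (hc : 0 ≤ c) (hv : |v| ≤ c * u)
    (w : ℂ) (hw : w = Complex.exp (-((u : ℂ) + (v : ℂ) * I))) :
    ‖1 - w‖ * ‖1 + w‖ ≤ (1 - ‖w‖ ^ 2) * Real.cosh c := by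
  have hn : ‖w‖ = Real.exp (-u) := by rw [hw, norm_w]
  have hre : w.re = Real.exp (-u) * Real.cos v := by rw [hw, w_re]
  have him : w.re ^ 2 + w.im ^ 2 = ‖w‖ ^ 2 := by
    rw [← Complex.normSq_eq_norm_sq, Complex.normSq_apply]; ring
  have hE0 := Real.exp_pos (-u)
  have hE1 : Real.exp (-u) < 1 := Real.exp_lt_one_iff.2 (by linarith)
  set E := Real.exp (-u) with hE
  have hK : 0 < 1 - E ^ 2 := by nlinarith
  have hcosh : 1 + c ^ 2 ≤ Real.cosh c ^ 2 := by
    rw [Real.cosh_sq]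
    have := Real.self_le_sinh_iff.2 hc
    nlinarith
  have hsinhu : 2 * u * E ≤ 1 - E ^ 2 := by
    have h1 := Real.self_le_sinh_iff.2 hu.le
    rw [Real.sinh_eq, ← hE] at h1
    have h2 : Real.exp u * E = 1 := by rw [hE, ← Real.exp_add]; simp
    nlinarith
  have hsin : Real.sin v ^ 2 ≤ (c * u) ^ 2 := by
    have h1 : |Real.sin v| ≤ |v| := Real.abs_sin_le_abs
    rw [← sq_abs]
    exact pow_le_pow_left₀ (abs_nonneg _) (h1.trans hv) 2
  have e1 : ‖1 - w‖ ^ 2 = 1 - 2 * w.re + ‖w‖ ^ 2 := by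
    rw [← him, ← Complex.normSq_eq_norm_sq, Complex.normSq_apply]; simp; ring
  have e2 : ‖1 + w‖ ^ 2 = 1 + 2 * w.re + ‖w‖ ^ 2 := by
    rw [← him, ← Complex.normSq_eq_norm_sq, Complex.normSq_apply]; simp; ring
  refine le_of_sq_le_sq ?_ (by rw [hn]; positivity)
  rw [mul_pow, mul_pow, e1, e2, hn, hre]
  have h3 := Real.sin_sq_add_cos_sq v
  have h4 : (1 - 2 * (E * Real.cos v) + E ^ 2) * (1 + 2 * (E * Real.cos v) + E ^ 2) =
      (1 - E ^ 2) ^ 2 + 4 * E ^ 2 * Real.sin v ^ 2 := by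
    have : Real.cos v ^ 2 = 1 - Real.sin v ^ 2 := by linarith
    calc _ = (1 + E ^ 2) ^ 2 - 4 * E ^ 2 * Real.cos v ^ 2 := by ring
      _ = _ := by rw [this]; ring
  rw [h4]
  have h5 : 4 * E ^ 2 * Real.sin v ^ 2 ≤ c ^ 2 * (1 - E ^ 2) ^ 2 := by
    calc 4 * E ^ 2 * Real.sin v ^ 2 ≤ 4 * E ^ 2 * (c * u) ^ 2 := by gcongr
      _ = c ^ 2 * (2 * u * E) ^ 2 := by ring
      _ ≤ _ := by gcongr
  calc _ ≤ (1 - E ^ 2) ^ 2 * (1 + c ^ 2) := by linarith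
    _ ≤ _ := by gcongr

lemma bl_bound (u v c t : ℝ) (hu : 0 < u) (hc : 0 ≤ c) (hv : |v| ≤ c * u)
    (w : ℂ) (hw : w = Complex.exp (-((u : ℂ) + (v : ℂ) * I))) :
    ‖bl (Real.tanh (-t / 2) : ℂ) w‖ ≤
      Real.tanh ((|Real.log (‖1 - w‖ / ‖1 + w‖) - t| + c) / 2) := by
  have hang := angle u v c hu hc hv w hw
  have hn : ‖w‖ = Real.exp (-u) := by rw [hw, norm_w]
  have hn1 : ‖w‖ < 1 := by rw [hn]; exact Real.exp_lt_one_iff.2 (by linarith)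
  have hp : 0 < ‖1 - w‖ := by
    have := norm_sub_norm_le (1:ℂ) w
    rw [norm_one] at this; linarith
  have hq : 0 < ‖1 + w‖ := by
    have := norm_sub_norm_le (1:ℂ) (-w)
    rw [norm_one, norm_neg, sub_neg_eq_add] at this; linarith
  set b := Real.exp t with hb
  have hb0 : 0 < b := Real.exp_pos _
  have hwj : (Real.tanh (-t / 2) : ℂ) = (1 - b) / (1 + b) := by
    rw [tanh_eq', neg_neg, ← hb]; push_cast; rfl
  have hb1 : (1 + (b:ℂ)) ≠ 0 := by
    intro h
    have := congrArg Complex.re h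
    simp at this; linarith
  have hbl : bl (Real.tanh (-t / 2) : ℂ) w = (b * (1 + w) - (1 - w)) / (b * (1 + w) + (1 - w)) := by
    unfold bl
    rw [Complex.conj_ofReal, hwj]
    rw [show w - (1 - (b:ℂ)) / (1 + b) = (b * (1 + w) - (1 - w)) / (1 + b) by field_simp; ring,
      show 1 - (1 - (b:ℂ)) / (1 + b) * w = (b * (1 + w) + (1 - w)) / (1 + b) by field_simp; ring]
    rw [div_div_div_cancel_right₀ hb1]
  have him : w.re ^ 2 + w.im ^ 2 = ‖w‖ ^ 2 := by
    rw [← Complex.normSq_eq_norm_sq, Complex.normSq_apply]; ring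
  have e1 : ‖1 - w‖ ^ 2 = 1 - 2 * w.re + ‖w‖ ^ 2 := by
    rw [← him, ← Complex.normSq_eq_norm_sq, Complex.normSq_apply]; simp; ring
  have e2 : ‖1 + w‖ ^ 2 = 1 + 2 * w.re + ‖w‖ ^ 2 := by
    rw [← him, ← Complex.normSq_eq_norm_sq, Complex.normSq_apply]; simp; ring
  set p := ‖1 - w‖ with hpd
  set q := ‖1 + w‖ with hqd
  have e3 : ‖(b:ℂ) * (1 + w) - (1 - w)‖ ^ 2 = b ^ 2 * q ^ 2 + p ^ 2 - 2 * b * (1 - ‖w‖ ^ 2) := by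
    rw [e1, e2, ← him, ← Complex.normSq_eq_norm_sq, Complex.normSq_apply]; simp; ring
  have e4 : ‖(b:ℂ) * (1 + w) + (1 - w)‖ ^ 2 = b ^ 2 * q ^ 2 + p ^ 2 + 2 * b * (1 - ‖w‖ ^ 2) := by
    rw [e1, e2, ← him, ← Complex.normSq_eq_norm_sq, Complex.normSq_apply]; simp; ring
  set δ := Real.log (p / q) - t with hδ
  have e5 : b ^ 2 * q ^ 2 + p ^ 2 = 2 * b * (p * q * Real.cosh δ) := by
    rw [Real.cosh_eq, hδ, neg_sub, Real.exp_sub, Real.exp_sub, Real.exp_log (by positivity), ← hb]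
    field_simp
    ring
  have hK : 0 < 1 - ‖w‖ ^ 2 := by nlinarith [norm_nonneg w]
  have hch : Real.cosh δ * Real.cosh c ≤ Real.cosh (|δ| + c) := by
    rw [Real.cosh_add, Real.cosh_abs]
    have : 0 ≤ Real.sinh |δ| * Real.sinh c :=
      mul_nonneg (Real.sinh_nonneg_iff.2 (abs_nonneg _)) (Real.sinh_nonneg_iff.2 hc)
    linarith
  have hcd := Real.cosh_pos δ
  have key : p * q * Real.cosh δ ≤ (1 - ‖w‖ ^ 2) * Real.cosh (|δ| + c) := by
    calc p * q * Real.cosh δ ≤ (1 - ‖w‖ ^ 2) * Real.cosh c * Real.cosh δ := by gcongr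
      _ = (1 - ‖w‖ ^ 2) * (Real.cosh δ * Real.cosh c) := by ring
      _ ≤ _ := by gcongr
  have ht0 : 0 ≤ Real.tanh ((|δ| + c) / 2) := by
    rw [Real.tanh_eq_sinh_div_cosh]
    exact div_nonneg (Real.sinh_nonneg_iff.2 (by positivity)) (Real.cosh_pos _).le
  refine le_of_sq_le_sq ?_ ht0
  rw [hbl, norm_div, div_pow, e3, e4, tanh_sq_half, e5]
  have hX := Real.one_le_cosh (|δ| + c)
  rw [div_le_div_iff₀ (by positivity) (by linarith)]
  nlinarith

lemma zeta_lower (u v M : ℝ) (hu : 0 < u) (hM : u ≤ M)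
    (w : ℂ) (hw : w = Complex.exp (-((u : ℂ) + (v : ℂ) * I))) :
    u / (2 * (1 + M)) ≤ ‖1 - w‖ / ‖1 + w‖ := by
  have hn : ‖w‖ = Real.exp (-u) := by rw [hw, norm_w]
  have hn1 : ‖w‖ < 1 := by rw [hn]; exact Real.exp_lt_one_iff.2 (by linarith)
  have h1 : 1 - ‖w‖ ≤ ‖1 - w‖ := by
    have := norm_sub_norm_le (1:ℂ) w
    rwa [norm_one] at this
  have hq : 0 < ‖1 + w‖ := by
    have := norm_sub_norm_le (1:ℂ) (-w)
    rw [norm_one, norm_neg, sub_neg_eq_add] at this; linarith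
  have h2 : ‖1 + w‖ ≤ 2 := by
    have := norm_add_le (1:ℂ) w
    rw [norm_one] at this; linarith
  have h3 : u / (1 + M) ≤ 1 - ‖w‖ := by
    rw [hn, div_le_iff₀ (by linarith)]
    have h4 := Real.add_one_le_exp u
    have h5 : Real.exp u * Real.exp (-u) = 1 := by rw [← Real.exp_add]; simp
    have h6 := Real.exp_pos (-u)
    have h7 : (1 + u) * Real.exp (-u) ≤ 1 := by nlinarith
    rw [hn] at hn1
    nlinarith
  rw [le_div_iff₀ hq]
  have h8 : 0 ≤ u / (2 * (1 + M)) := div_nonneg hu.le (by linarith)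
  calc u / (2 * (1 + M)) * ‖1 + w‖ ≤ u / (2 * (1 + M)) * 2 := by gcongr
    _ = u / (1 + M) := by
      have : (1 + M) ≠ 0 := by linarith
      field_simp
    _ ≤ _ := by linarith

lemma one_sub_lower (u M : ℝ) (hu : 0 < u) (hM : u ≤ M) :
    u / (1 + M) ≤ 1 - Real.exp (-u) ^ 2 := by
  have hn1 : Real.exp (-u) < 1 := Real.exp_lt_one_iff.2 (by linarith)
  rw [div_le_iff₀ (by linarith)]
  have h4 := Real.add_one_le_exp u
  have h5 : Real.exp u * Real.exp (-u) = 1 := by rw [← Real.exp_add]; simp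
  have h6 := Real.exp_pos (-u)
  have h7 : (1 + u) * Real.exp (-u) ≤ 1 := by nlinarith
  have h8 : Real.exp (-u) ^ 2 ≤ Real.exp (-u) := by nlinarith
  have h9 : u ≤ (1 - Real.exp (-u)) * (1 + M) := by nlinarith
  nlinarith

lemma zeta_upper (u v : ℝ) (hu : 0 < u) (hv : |v| ≤ 1)
    (w : ℂ) (hw : w = Complex.exp (-((u : ℂ) + (v : ℂ) * I))) :
    ‖1 - w‖ / ‖1 + w‖ ≤ 2 := by
  have hn : ‖w‖ = Real.exp (-u) := by rw [hw, norm_w]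
  have hn1 : ‖w‖ < 1 := by rw [hn]; exact Real.exp_lt_one_iff.2 (by linarith)
  have h1 : ‖1 - w‖ ≤ 2 := by
    have := norm_sub_le (1:ℂ) w
    rw [norm_one] at this; linarith
  have hcos : 0 ≤ Real.cos v := by
    obtain ⟨a, b⟩ := abs_le.1 hv
    have := Real.pi_gt_three
    exact Real.cos_nonneg_of_neg_pi_div_two_le_of_le (by linarith) (by linarith)
  have h2 : 1 ≤ ‖1 + w‖ := by
    have h3 := Complex.re_le_norm (1 + w)
    rw [Complex.add_re, Complex.one_re, hw, w_re, ← hw] at h3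
    have := Real.exp_pos (-u)
    nlinarith [mul_nonneg this.le hcos]
  rw [div_le_iff₀ (by linarith)]; linarith

lemma T_bound {φ : ℂ → ℂ} {T : H2 →L[ℂ] H2}
    (hT : ∀ (a : H2) (z : ℂ), ‖z‖ < 1 → fa (T a) z = fa a (φ z)) :
    ∃ K : ℝ, 0 < K ∧ ∀ (f : H2) (G M : ℝ), 0 ≤ M → K * G ≤ M ^ 2 → 
      (∀ r θ : ℝ, 0 ≤ r → r < 1 → θ ≠ 0 → |θ| ≤ Real.pi →
        ‖fa f (φ ((r:ℂ) * Complex.exp (θ * I)))‖ ^ 2 ≤ G * |θ| ^ (-(3/4) : ℝ)) → ‖T f‖ ≤ M := by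
  have hpi := Real.pi_pos
  have hIab : IntervalIntegrable (fun θ : ℝ => |θ| ^ (-(3/4) : ℝ)) volume (-Real.pi) Real.pi := by
    have h1 : IntervalIntegrable (fun θ : ℝ => |θ| ^ (-(3/4) : ℝ)) volume 0 Real.pi := by
      refine (intervalIntegral.intervalIntegrable_rpow' (r := -(3/4)) (by norm_num)).congr ?_
      intro x hx
      rw [uIoc_of_le hpi.le] at hx
      simp only [abs_of_pos hx.1]
    have h2 : IntervalIntegrable (fun θ : ℝ => |θ| ^ (-(3/4) : ℝ)) volume (-Real.pi) 0 := by
      have := (IntervalIntegrable.iff_comp_neg).1 h1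
      simp only [abs_neg, neg_zero] at this
      exact this.symm
    exact h2.trans h1
  set K0 := ∫ θ in (-Real.pi)..Real.pi, |θ| ^ (-(3/4) : ℝ) with hK0
  have hK0' : 0 ≤ K0 := intervalIntegral.integral_nonneg (by linarith) (fun x _ => by positivity)
  refine ⟨(K0 + 1) / (2 * Real.pi), by positivity, ?_⟩
  intro f G M hM hG hf
  have hG0 : 0 ≤ G := by
    have := hf 0 1 le_rfl one_pos one_ne_zero (by rw [abs_one]; linarith [Real.pi_gt_three])
    simp only [abs_one, Real.one_rpow, mul_one] at this
    exact (sq_nonneg _).trans this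
  refine norm_le_of_means _ _ hM ?_
  intro r h0 h1
  have hcont : Continuous (fun θ : ℝ => ‖fa (T f) (r * Complex.exp (θ * I))‖ ^ 2) := 
    (fa_circle_cont (T f) h0 h1).norm.pow 2
  calc ∫ θ in (-Real.pi)..Real.pi, ‖fa (T f) (r * Complex.exp (θ * I))‖ ^ 2
      ≤ ∫ θ in (-Real.pi)..Real.pi, G * |θ| ^ (-(3/4) : ℝ) := by
        refine intervalIntegral.integral_mono_ae_restrict (by linarith)
          (hcont.intervalIntegrable _ _) (hIab.const_mul _) ?_
        have hz : ∀ᵐ θ : ℝ, θ ≠ 0 := by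
          simp [ae_iff]
        filter_upwards [ae_restrict_mem measurableSet_Icc, ae_restrict_of_ae hz] with θ hθ hθ0
        rw [hT _ _ (by rw [norm_rexp r θ h0]; exact h1)]
        exact hf r θ h0 h1 hθ0 (abs_le.2 hθ)
    _ = G * K0 := by rw [intervalIntegral.integral_const_mul]
    _ ≤ 2 * Real.pi * M ^ 2 := by
      have : 2 * Real.pi * ((K0 + 1) / (2 * Real.pi) * G) ≤ 2 * Real.pi * M ^ 2 := by gcongr
      have e : 2 * Real.pi * ((K0 + 1) / (2 * Real.pi) * G) = (K0 + 1) * G := by field_simp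
      nlinarith

end QS

namespace QS

lemma u_const {U : ℝ → ℝ} (hU : ClassU U) {x₁ : ℝ}
    (hη_diff : ∀ x : ℝ, x₁ ≤ x → DifferentiableAt ℝ (etaU U) x)
    (hη : Tendsto (fun x : ℝ => x * deriv (etaU U) x / etaU U x) atTop (nhds 0)) :
    ∃ C : ℝ, 0 < C ∧ ∀ r θ : ℝ, 0 ≤ r → r < 1 → θ ≠ 0 → |θ| ≤ Real.pi →
      0 < poisson U r θ ∧
      1 / (1 - Real.exp (-poisson U r θ) ^ 2) ≤ C * |θ| ^ (-(1/2) : ℝ) := by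
  have hpi := Real.pi_pos
  obtain ⟨c, hc, hcU⟩ := U_ge_sqrt hU hη_diff hη
  set M := U Real.pi with hM
  have hM0 : 0 < M := U_pos hU hpi le_rfl
  refine ⟨8 * (1 + M) / c, by positivity, ?_⟩
  intro r θ h0 h1 hθ hθπ
  have hθ' : 0 < |θ| := abs_pos.2 hθ
  have hl := u_lower hU h0 h1 hθπ
  have hm0 : 0 < min |θ| (Real.pi / 2) := lt_min hθ' (by linarith)
  have hmπ : min |θ| (Real.pi / 2) ≤ Real.pi := (min_le_left _ _).trans hθπ
  have hc1 := hcU _ hm0.le hmπ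
  have hs : √|θ| / 2 ≤ √(min |θ| (Real.pi / 2)) := by
    refine Real.le_sqrt_of_sq_le ?_
    rw [div_pow, Real.sq_sqrt hθ'.le]
    refine le_min (by linarith) (by linarith)
  have hsp : 0 < √|θ| := Real.sqrt_pos.2 hθ'
  have hu : c * √|θ| / 8 ≤ poisson U r θ := by
    have : c * (√|θ| / 2) ≤ c * √(min |θ| (Real.pi / 2)) := by gcongr
    linarith
  have hu0 : 0 < poisson U r θ := lt_of_lt_of_le (by positivity) hu
  refine ⟨hu0, ?_⟩
  have h2 := one_sub_lower _ M hu0 (u_upper hU h0 h1 θ)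
  have h3 : c * √|θ| / (8 * (1 + M)) ≤ 1 - Real.exp (-poisson U r θ) ^ 2 := by
    refine le_trans ?_ h2
    rw [div_le_div_iff₀ (by positivity) (by positivity)]
    nlinarith
  rw [Real.rpow_neg hθ'.le, ← Real.sqrt_eq_rpow]
  calc 1 / (1 - Real.exp (-poisson U r θ) ^ 2) ≤ 1 / (c * √|θ| / (8 * (1 + M))) :=
        one_div_le_one_div_of_le (by positivity) h3
    _ = _ := by field_simp

lemma grid_shift (A d : ℝ) (hd : 0 < d) :
    ∃ A', A' ≤ A ∧ A - d ≤ A' ∧ ∀ j : ℕ, A' + j * d ≠ 0 := by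
  by_cases h : ∃ j : ℕ, A + j * d = 0
  · obtain ⟨j, hj⟩ := h
    refine ⟨A - d / 2, by linarith, by linarith, ?_⟩
    intro i hi
    have h1 : ((i:ℝ) - j - 1 / 2) * d = 0 := by linarith
    have h2 : (i:ℝ) - j - 1 / 2 = 0 := by
      rcases mul_eq_zero.1 h1 with h | h
      · exact h
      · exact absurd h hd.ne'
    have h3 : (2 * i : ℝ) = 2 * j + 1 := by linarith
    have h4 : 2 * i = 2 * j + 1 := by exact_mod_cast h3
    omega
  · push Not at h
    exact ⟨A, le_rfl, by linarith, h⟩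

lemma tanh_inj' {a b : ℝ} (h : Real.tanh a = Real.tanh b) : a = b := by
  rw [← Real.artanh_tanh a, h, Real.artanh_tanh]

set_option maxHeartbeats 1000000 in
/-- all the pointwise estimates combined -/
lemma pointwise {U : ℝ → ℝ} (hU : ClassU U) {x₁ : ℝ}
    (hη_diff : ∀ x : ℝ, x₁ ≤ x → DifferentiableAt ℝ (etaU U) x)
    (hη : Tendsto (fun x : ℝ => x * deriv (etaU U) x / etaU U x) atTop (nhds 0))
    {F : ℂ → ℂ} (hF : DifferentiableOn ℂ F (Metric.ball 0 1))
    (hFre : ∀ r θ : ℝ, 0 ≤ r → r < 1 →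
      (F ((r : ℂ) * Complex.exp (θ * Complex.I))).re = poisson U r θ)
    (hFim : (F 0).im = 0)
    {φ : ℂ → ℂ} (hφ : ∀ z, φ z = Complex.exp (-F z)) {ε : ℝ} (hε : 0 < ε) :
    ∃ a0 Λ C c0, 0 < a0 ∧ 0 < Λ ∧ 0 < C ∧ 0 < c0 ∧
      ∀ (X ξ d A : ℝ) (m q : ℕ) (f : H2), 0 ≤ X → 0 ≤ ξ → 0 < d → d ≤ a0 →
      (∀ j : ℕ, A + j * d ≠ 0) →
      A + Λ ≤ -etaU U X → Λ ≤ A + m * d →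
      Real.exp (-(X / 4)) ≤ ξ → Real.exp (-(Real.pi ^ 2 / 2 - ε) / d) ^ 2 ≤ ξ →
      Real.exp (-(c0 * q)) ≤ ξ →
      (∀ k < q, f k = 0) →
      (∀ i : Fin m, fa f (Real.tanh (-(A + (i : ℕ) * d) / 2) : ℂ) = 0) →
      ∀ r θ : ℝ, 0 ≤ r → r < 1 → θ ≠ 0 → |θ| ≤ Real.pi →
        ‖fa f (φ ((r:ℂ) * Complex.exp (θ * I)))‖ ^ 2 ≤
          (C * ξ * ‖f‖ ^ 2) * |θ| ^ (-(3/4) : ℝ) := by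
  have hpi := Real.pi_gt_three
  have hpi4 := Real.pi_lt_four
  obtain ⟨C1, hC10, hC1⟩ := u_const hU hη_diff hη
  obtain ⟨a1, Λ1, ha1, hΛ1, hE3⟩ := E3 hε
  set M := U Real.pi with hM
  have hM0 : 0 < M := U_pos hU (by linarith) le_rfl
  set c := min (a1 / 2) (1 / (1 + M)) with hc
  have hc0 : 0 < c := lt_min (by positivity) (by positivity)
  have hca : c ≤ a1 / 2 := min_le_left _ _
  have hcM : c * M ≤ 1 := by
    have : c ≤ 1 / (1 + M) := min_le_right _ _
    rw [le_div_iff₀ (by positivity)] at this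
    nlinarith
  obtain ⟨θ0, hθ00, hθ01, hv⟩ := v_bound hU hη_diff hη hc0
  have hUθ : 0 < U θ0 := U_pos hU hθ00 (by linarith)
  clear_value c
  refine ⟨a1 / 2, Λ1 + |Real.log (8 * (1 + M))| + 1, 2 * C1, U θ0 / 2, by positivity,
    by positivity, by positivity, by positivity, ?_⟩
  intro X ξ d A m q f hX hξ hd hda hA hA1 hA2 hξ1 hξ2 hξ3 hf0 hf r θ h0 h1 hθ hθπ
  have hθ' : 0 < |θ| := abs_pos.2 hθ
  obtain ⟨hu0, hinv⟩ := hC1 r θ h0 h1 hθ hθπ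
  have huM := u_upper hU h0 h1 θ
  have hul := u_lower hU h0 h1 hθπ
  have hphi := phi_eq hU F hF hFre hFim h0 h1 θ
  rw [← hφ] at hphi
  have hvθ := hv r θ h0 h1
  set w := φ ((r:ℂ) * Complex.exp (θ * I)) with hw
  set u := poisson U r θ with hu
  set v := conjP U r θ with hvd
  clear_value u v w
  have hn : ‖w‖ = Real.exp (-u) := by rw [hphi, norm_w]
  have hn1 : ‖w‖ < 1 := by rw [hn]; exact Real.exp_lt_one_iff.2 (by linarith)
  set P := ∏ i : Fin m, ‖bl (Real.tanh (-(A + ((i : ℕ) : ℝ) * d) / 2) : ℂ) w‖ with hP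
  have hmain : ‖fa f w‖ ^ 2 ≤ (‖w‖ ^ q * P) ^ 2 * (‖f‖ ^ 2 / (1 - ‖w‖ ^ 2)) := by
    refine fa_vanish_le m q (fun i => (Real.tanh (-(A + ((i : ℕ) : ℝ) * d) / 2) : ℂ)) ?_ ?_ ?_ f
      hf0 hf hn1
    · intro i
      rw [Complex.norm_real, Real.norm_eq_abs]; exact Real.abs_tanh_lt_one _
    · intro i hi
      have h2 : Real.tanh (-(A + ((i : ℕ) : ℝ) * d) / 2) = Real.tanh 0 := by
        rw [Real.tanh_zero]; exact_mod_cast hi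
      have := tanh_inj' h2
      exact hA i (by linarith)
    · intro i j hij
      have h2 : Real.tanh (-(A + ((i : ℕ) : ℝ) * d) / 2) =
        Real.tanh (-(A + ((j : ℕ) : ℝ) * d) / 2) := Complex.ofReal_injective hij
      have h3 := tanh_inj' h2
      have h4 : (((i : ℕ) : ℝ) - ((j : ℕ) : ℝ)) * d = 0 := by linarith
      rcases mul_eq_zero.1 h4 with h | h
      · have h5 : ((i : ℕ) : ℝ) = ((j : ℕ) : ℝ) := by linarith
        exact Fin.ext (by exact_mod_cast h5)
      · exact absurd h hd.ne'
  have hP0 : 0 ≤ P := Finset.prod_nonneg (fun _ _ => norm_nonneg _)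
  have hP1 : P ≤ 1 := by
    refine Finset.prod_le_one (fun _ _ => norm_nonneg _) (fun i _ => ?_)
    refine (bl_bound u v (|v| / u) _ hu0 (by positivity) (by field_simp; exact le_rfl) w hphi).trans ?_
    exact (le_abs_self _).trans (Real.abs_tanh_lt_one _).le
  have hw1 : ‖w‖ ^ q ≤ 1 := pow_le_one₀ (norm_nonneg _) hn1.le
  have hw0 : 0 ≤ ‖w‖ ^ q := by positivity
  have hfn : ‖f‖ ^ 2 / (1 - ‖w‖ ^ 2) ≤ ‖f‖ ^ 2 * (C1 * |θ| ^ (-(1/2) : ℝ)) := by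
    rw [hn, div_eq_mul_one_div]; gcongr
  have hmain2 : ‖fa f w‖ ^ 2 ≤ (‖w‖ ^ q * P) ^ 2 * (‖f‖ ^ 2 * (C1 * |θ| ^ (-(1/2) : ℝ))) :=
    hmain.trans (by gcongr)
  have hsplit : |θ| ^ (-(1/2) : ℝ) = |θ| ^ (1/4 : ℝ) * |θ| ^ (-(3/4) : ℝ) := by
    rw [← Real.rpow_add hθ']; norm_num
  -- it suffices to bound the product
  suffices hs : (‖w‖ ^ q * P) ^ 2 * |θ| ^ (1/4 : ℝ) ≤ 2 * ξ by
    refine hmain2.trans ?_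
    rw [hsplit]
    calc (‖w‖ ^ q * P) ^ 2 * (‖f‖ ^ 2 * (C1 * (|θ| ^ (1/4 : ℝ) * |θ| ^ (-(3/4) : ℝ))))
        = ((‖w‖ ^ q * P) ^ 2 * |θ| ^ (1/4 : ℝ)) * (C1 * ‖f‖ ^ 2 * |θ| ^ (-(3/4) : ℝ)) := by ring
      _ ≤ (2 * ξ) * (C1 * ‖f‖ ^ 2 * |θ| ^ (-(3/4) : ℝ)) := by gcongr
      _ = _ := by ring
  have hθ4 : |θ| ^ (1/4 : ℝ) ≤ 2 := by
    calc |θ| ^ (1/4 : ℝ) ≤ (16:ℝ) ^ (1/4 : ℝ) := by gcongr; linarith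
      _ = 2 := by
        rw [show (16:ℝ) = 2 ^ (4:ℝ) by norm_num, ← Real.rpow_mul (by norm_num)]; norm_num
  have hθ40 : 0 ≤ |θ| ^ (1/4 : ℝ) := by positivity
  have hprod0 : 0 ≤ ‖w‖ ^ q * P := by positivity
  have hprod1 : ‖w‖ ^ q * P ≤ 1 := mul_le_one₀ hw1 hP0 hP1
  rcases lt_or_ge |θ| (Real.exp (-X)) with hcase | hcase
  · have h2 : |θ| ^ (1/4 : ℝ) ≤ Real.exp (-(X / 4)) := by
      calc |θ| ^ (1/4 : ℝ) ≤ Real.exp (-X) ^ (1/4 : ℝ) := by gcongr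
        _ = _ := by rw [← Real.exp_mul]; congr 1; ring
    have h3 : (‖w‖ ^ q * P) ^ 2 ≤ 1 := pow_le_one₀ hprod0 hprod1
    calc (‖w‖ ^ q * P) ^ 2 * |θ| ^ (1/4 : ℝ) ≤ 1 * |θ| ^ (1/4 : ℝ) := by gcongr
      _ ≤ 2 * ξ := by linarith
  suffices hs : (‖w‖ ^ q * P) ^ 2 ≤ ξ by
    calc (‖w‖ ^ q * P) ^ 2 * |θ| ^ (1/4 : ℝ) ≤ ξ * 2 := by gcongr
      _ = _ := by ring
  rcases le_or_gt |θ| θ0 with hcase2 | hcase2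
  · -- middle region
    have hvu := hvθ hcase2
    have hv1 : |v| ≤ 1 := by
      refine hvu.trans (le_trans ?_ hcM); gcongr
    have hmin : min |θ| (Real.pi / 2) = |θ| := min_eq_left (by linarith)
    rw [hmin] at hul
    have hul2 : Real.exp (-etaU U X) / 4 ≤ u := by
      have h2 : U (Real.exp (-X)) ≤ U |θ| := U_mono hU (Real.exp_pos _).le hcase hθπ
      have h3 : Real.exp (-X) ≤ 1 := Real.exp_le_one_iff.2 (by linarith)
      rw [U_eq_exp hU (Real.exp_pos _) (by linarith), Real.log_exp, neg_neg] at h2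
      linarith
    have hz1 := zeta_lower u v M hu0 huM w hphi
    have hz2 := zeta_upper u v hu0 hv1 w hphi
    set Z := ‖1 - w‖ / ‖1 + w‖ with hZ
    have hZ0 : 0 < Z := lt_of_lt_of_le (by positivity) hz1
    have hs1 : Real.log Z ≤ 1 := by
      have := Real.log_le_log hZ0 hz2
      linarith [Real.log_two_lt_d9]
    have hs2 : -etaU U X - Real.log (8 * (1 + M)) ≤ Real.log Z := by
      have h2 : Real.exp (-etaU U X) / (8 * (1 + M)) ≤ Z := by
        refine le_trans ?_ hz1
        rw [div_le_div_iff₀ (by positivity) (by positivity)]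
        have h9 : Real.exp (-etaU U X) ≤ 4 * u := by linarith
        calc Real.exp (-etaU U X) * (2 * (1 + M)) ≤ 4 * u * (2 * (1 + M)) := by gcongr
          _ = _ := by ring
      have h3 := Real.log_le_log (by positivity) h2
      rwa [Real.log_div (by positivity) (by positivity), Real.log_exp] at h3
    have hPle : P ≤ Real.exp (-(Real.pi ^ 2 / 2 - ε) / d) := by
      refine le_trans ?_ (hE3 d c A (Real.log Z) m hd hc0 (by linarith) ?_ ?_)
      · refine Finset.prod_le_prod (fun _ _ => norm_nonneg _) (fun i _ => ?_)
        exact bl_bound u v c _ hu0 hc0.le hvu w hphi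
      · have := le_abs_self (Real.log (8 * (1 + M)))
        linarith
      · have := abs_nonneg (Real.log (8 * (1 + M)))
        linarith
    refine le_trans ?_ hξ2
    have : ‖w‖ ^ q * P ≤ 1 * P := by gcongr
    gcongr
    linarith
  · -- far region
    have h2 : θ0 ≤ min |θ| (Real.pi / 2) := le_min hcase2.le (by linarith)
    have h3 : U θ0 ≤ U (min |θ| (Real.pi / 2)) :=
      U_mono hU hθ00.le h2 ((min_le_left _ _).trans hθπ)
    refine le_trans ?_ hξ3
    have h4 : (‖w‖ ^ q * P) ^ 2 ≤ (‖w‖ ^ q * 1) ^ 2 := by gcongr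
    refine h4.trans ?_
    rw [mul_one, hn, ← pow_mul, ← Real.exp_nat_mul, Real.exp_le_exp]
    push_cast
    have h5 : U θ0 / 4 * q ≤ u * q := by gcongr; linarith
    linarith

set_option maxHeartbeats 1000000 in
lemma upper_bound {U : ℝ → ℝ} (hU : ClassU U) {x₁ : ℝ}
    (hη_diff : ∀ x : ℝ, x₁ ≤ x → DifferentiableAt ℝ (etaU U) x)
    (hη : Tendsto (fun x : ℝ => x * deriv (etaU U) x / etaU U x) atTop (nhds 0))
    {ω : ℝ → ℝ} (hω_top : Tendsto ω atTop atTop)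
    {x₂ : ℝ} (hωeq : ∀ x : ℝ, x₂ ≤ x → etaU U (x / ω x) = ω x)
    {F : ℂ → ℂ} (hF : DifferentiableOn ℂ F (Metric.ball 0 1))
    (hFre : ∀ r θ : ℝ, 0 ≤ r → r < 1 →
      (F ((r : ℂ) * Complex.exp (θ * Complex.I))).re = poisson U r θ)
    (hFim : (F 0).im = 0)
    {φ : ℂ → ℂ} (hφ : ∀ z, φ z = Complex.exp (-F z))
    {T : H2 →L[ℂ] H2}
    (hT : ∀ (a : H2) (z : ℂ), ‖z‖ < 1 → fa (T a) z = fa a (φ z))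
    {ε : ℝ} (hε : 0 < ε) :
    ∀ᶠ n : ℕ in atTop, approxNum T n ≤ Real.exp (-(Real.pi ^ 2 / 2 - ε) * n / ω n) := by
  have hpi := Real.pi_gt_three
  have hpi2 : Real.pi ^ 2 ≤ 10 := by nlinarith [Real.pi_lt_d2]
  have hy := y_tendsto hU hω_top hωeq
  have hn : Tendsto (fun n : ℕ => (n : ℝ)) atTop atTop := tendsto_natCast_atTop_atTop
  have hω_n := hω_top.comp hn
  set ε1 := min (1 / 52) (ε / 52) with hε1
  have hε10 : 0 < ε1 := lt_min (by norm_num) (by positivity)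
  have hε11 : ε1 ≤ 1 / 52 := min_le_left _ _
  have hε12 : ε1 ≤ ε / 52 := min_le_right _ _
  clear_value ε1
  obtain ⟨K, hK0, hK⟩ := T_bound hT
  obtain ⟨a0, Λ, C, c0, ha0, hΛ, hC, hc0, hpt⟩ :=
    pointwise hU hη_diff hη hF hFre hFim hφ hε10
  have hslow := eta_slow hU hη_diff hη (c := 40) (by norm_num) hε10
  filter_upwards [hy.eventually hslow, hy.eventually_ge_atTop 1, hn.eventually_ge_atTop x₂,
    hy.eventually_ge_atTop (2 / a0), hy.eventually_ge_atTop (K * C / ε),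
    hn.eventually_ge_atTop (2 / ε1),
    hω_n.eventually_ge_atTop (1 + (Λ + a0) / ε1),
    hω_n.eventually_ge_atTop (20 / (c0 * ε1))] with n h1 h2 h3 h4 h5 h6 h7 h8
  simp only [Function.comp_apply] at h7 h8
  set W := ω n with hW
  set y := (n:ℝ) / W with hyd
  rw [hωeq _ h3] at h1
  rw [← hW] at h1
  have hW0 : 0 < W := by
    have : 0 ≤ (Λ + a0) / ε1 := by positivity
    linarith
  have h7' : Λ + a0 ≤ ε1 * W := by
    have : (Λ + a0) / ε1 ≤ W := by linarith
    rw [div_le_iff₀ hε10] at this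
    linarith
  have h6' : 2 ≤ ε1 * n := by
    rw [div_le_iff₀ hε10] at h6; linarith
  have hn0 : (0:ℝ) < n := by
    by_contra hcon
    push Not at hcon
    nlinarith
  have hyW : y * W = n := by rw [hyd]; field_simp
  have hy0 : 0 < y := by linarith
  set q := ⌊ε1 * n⌋₊ with hq
  have hq1 : (q:ℝ) ≤ ε1 * n := Nat.floor_le (by positivity)
  have hq2 : ε1 * n - 1 < q := by
    have := Nat.lt_floor_add_one (ε1 * n)
    linarith
  have hq2' : ε1 * n / 2 ≤ q := by linarith
  have hqn : q + 1 ≤ n := by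
    have : (q:ℝ) + 1 ≤ n := by nlinarith
    exact_mod_cast this
  set m := n - 1 - q with hm
  have hmn : m + q = n - 1 := by omega
  have hmr : (m:ℝ) = n - 1 - q := by
    have : m + q + 1 = n := by omega
    have : (m:ℝ) + q + 1 = n := by exact_mod_cast this
    linarith
  have hm1 : (1 - 2 * ε1) * n ≤ m := by rw [hmr]; nlinarith
  clear_value m q W y
  have hm0 : (0:ℝ) < m := lt_of_lt_of_le (mul_pos (by linarith) hn0) hm1
  set d := (1 + 3 * ε1) * W / m with hd
  have hd0 : 0 < d := by positivity
  have hmd : m * d = (1 + 3 * ε1) * W := by rw [hd]; field_simp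
  have hdy : d ≤ 2 / y := by
    rw [hd, div_le_div_iff₀ hm0 hy0]
    calc (1 + 3 * ε1) * W * y = (1 + 3 * ε1) * n := by rw [← hyW]; ring
      _ ≤ 2 * ((1 - 2 * ε1) * n) := by nlinarith
      _ ≤ 2 * m := by linarith
  have hda : d ≤ a0 := by
    refine hdy.trans ?_
    rw [div_le_iff₀ hy0]
    rw [div_le_iff₀ ha0] at h4
    linarith
  have hdinv : (1 - 5 * ε1) * y ≤ 1 / d := by
    rw [le_div_iff₀ hd0, hd, mul_div_assoc', div_le_one hm0]
    refine le_trans ?_ hm1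
    calc (1 - 5 * ε1) * y * ((1 + 3 * ε1) * W) = (1 - 5 * ε1) * (1 + 3 * ε1) * n := by
          rw [← hyW]; ring
      _ ≤ _ := by gcongr; nlinarith
  clear_value d
  obtain ⟨A, hA1, hA2, hA3⟩ := grid_shift (-(1 + 2 * ε1) * W) d hd0
  set ξ := Real.exp (-((Real.pi ^ 2 - ε) * y)) with hξ
  refine approx_upper T n m q (by omega) (fun i => (Real.tanh (-(A + ((i : ℕ) : ℝ) * d) / 2) : ℂ))
    (fun i => by rw [Complex.norm_real, Real.norm_eq_abs]; exact Real.abs_tanh_lt_one _)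
    _ (Real.exp_pos _).le ?_
  intro f hf0 hf
  refine hK f (C * ξ * ‖f‖ ^ 2) _ (by positivity) ?_
    (hpt (40 * y) ξ d A m q f (by positivity) (Real.exp_pos _).le hd0 hda hA3 ?_ ?_ ?_ ?_ ?_ hf0 hf)
  · rw [mul_pow, ← mul_assoc]
    gcongr
    have e1 : Real.exp (-(Real.pi ^ 2 / 2 - ε) * n / W) ^ 2 = ξ * Real.exp (ε * y) := by
      rw [hξ, ← Real.exp_nat_mul, ← Real.exp_add, hyd]; congr 1; push_cast; ring
    rw [e1]
    have h9 := Real.add_one_le_exp (ε * y)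
    rw [div_le_iff₀ hε] at h5
    have hξ0 : 0 < ξ := Real.exp_pos _
    calc K * (C * ξ) = ξ * (K * C) := by ring
      _ ≤ _ := by gcongr; linarith
  · nlinarith
  · rw [hmd]; nlinarith
  · rw [hξ, Real.exp_le_exp]
    nlinarith
  · rw [hξ, ← Real.exp_nat_mul, Real.exp_le_exp]
    push_cast
    have e1 : 2 * (-(Real.pi ^ 2 / 2 - ε1) / d) = -((Real.pi ^ 2 - 2 * ε1) * (1 / d)) := by ring
    rw [e1, neg_le_neg_iff]
    calc (Real.pi ^ 2 - ε) * y ≤ ((Real.pi ^ 2 - 2 * ε1) * (1 - 5 * ε1)) * y := by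
          gcongr
          nlinarith
      _ = (Real.pi ^ 2 - 2 * ε1) * ((1 - 5 * ε1) * y) := by ring
      _ ≤ _ := by
        gcongr
        nlinarith
  · rw [hξ, Real.exp_le_exp, neg_le_neg_iff]
    have h9 : 10 * n ≤ c0 * (ε1 * n / 2) * W := by
      rw [div_le_iff₀ (by positivity)] at h8
      nlinarith
    have h10 : 10 * y ≤ c0 * (ε1 * n / 2) := by
      rw [← hyW] at h9
      have : (10 * y) * W ≤ (c0 * (ε1 * (y * W) / 2)) * W := by linarith
      rw [← hyW]
      exact le_of_mul_le_mul_right this hW0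
    have h11 : c0 * (ε1 * n / 2) ≤ c0 * q := by gcongr
    nlinarith

end QS

theorem stmt1 (U : ℝ → ℝ) (hU_mem : ClassU U)
    (x₁ : ℝ) (hη_diff : ∀ x : ℝ, x₁ ≤ x → DifferentiableAt ℝ (etaU U) x)
    (hη : Tendsto (fun x : ℝ => x * deriv (etaU U) x / etaU U x) atTop (nhds 0))
    (ω : ℝ → ℝ) (hω_mono : Monotone ω) (hω_top : Tendsto ω atTop atTop)
    (x₂ : ℝ) (hωeq : ∀ x : ℝ, x₂ ≤ x → etaU U (x / ω x) = ω x)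
    (F : ℂ → ℂ) (hF : DifferentiableOn ℂ F (Metric.ball 0 1))
    (hFre : ∀ r θ : ℝ, 0 ≤ r → r < 1 →
      (F ((r : ℂ) * Complex.exp (θ * Complex.I))).re = poisson U r θ)
    (hFim : (F 0).im = 0)
    (φ : ℂ → ℂ) (hφ : ∀ z, φ z = Complex.exp (-F z))
    (T : H2 →L[ℂ] H2)
    (hT : ∀ (a : H2) (z : ℂ), ‖z‖ < 1 → fa (T a) z = fa a (φ z)) :
    ∀ ε : ℝ, 0 < ε → ∃ N : ℕ, ∀ n : ℕ, N ≤ n →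
      Real.exp (-(Real.pi ^ 2 / 2 + ε) * n / ω n) ≤ approxNum T n ∧
      approxNum T n ≤ Real.exp (-(Real.pi ^ 2 / 2 - ε) * n / ω n) := by
  intro ε hε
  have h1 := QS.lower_bound hU_mem hη_diff hη hω_top hωeq hF hFre hFim hφ hT hε
  have h2 := QS.upper_bound hU_mem hη_diff hη hω_top hωeq hF hFre hFim hφ hT hε
  obtain ⟨N, hN⟩ := Filter.eventually_atTop.1 (h1.and h2)
  exact ⟨N, fun n hn => hN n hn⟩

end
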